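/- (Bounded Height Theorem, Habegger) Let X be an irreducible closed subvariety of the torus G_m^n defined over ℚ̄ and let s be a non-negative integer. Then the absolute logarithmic Weil height is bounded from above on X^{oa,s} ∩ G^{[s]}, where G^{[s]} is the union of all algebraic subgroups of G_m^n of codimension at least s. -/

import Mathlib

noncomputable section

abbrev Qbar : Type := AlgebraicClosure ℚ

/-- The absolute logarithmic Weil height of an algebraic number, via the
Mahler-measure formula applied to its (integer-scaled) minimal polynomial. -/
noncomputable def weilHeight (α : Qbar) : ℝ :=
  (Real.log (((minpoly ℚ α).support.lcm fun i => ((minpoly ℚ α).coeff i).den : ℕ) : ℝ) +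
      (((minpoly ℚ α).aroots ℂ).map fun z => Real.log (max 1 ‖z‖)).sum) /
    ((minpoly ℚ α).natDegree : ℝ)

/-- Points of the torus `G_m^n` over the algebraic numbers. -/
abbrev TorusPt (n : ℕ) : Type := Fin n → Qbarˣ

/-- Zariski-closed subsets of the torus: zero sets of families of polynomials. -/
def ZClosed {n : ℕ} (S : Set (TorusPt n)) : Prop :=
  ∃ I : Set (MvPolynomial (Fin n) Qbar),
    S = {x : TorusPt n | ∀ f ∈ I, MvPolynomial.eval (fun i => (x i : Qbar)) f = 0}

/-- Irreducibility (of a subset of the torus) for the Zariski topology. -/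
def ZIrred {n : ℕ} (S : Set (TorusPt n)) : Prop :=
  S.Nonempty ∧ ∀ Z₁ Z₂ : Set (TorusPt n), ZClosed Z₁ → ZClosed Z₂ →
    S ⊆ Z₁ ∪ Z₂ → S ⊆ Z₁ ∨ S ⊆ Z₂

/-- Dimension via lengths of chains of irreducible closed subsets. -/
def zdim {n : ℕ} (S : Set (TorusPt n)) : ℕ :=
  sSup {d : ℕ | ∃ Z : Fin (d + 1) → Set (TorusPt n),
    (∀ i, ZClosed (Z i) ∧ ZIrred (Z i) ∧ Z i ⊆ S) ∧
    ∀ i j : Fin (d + 1), i < j → Z i ⊂ Z j}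

/-- An algebraic subgroup of the torus: a Zariski-closed subgroup. -/
def IsAlgSubgroup {n : ℕ} (H : Set (TorusPt n)) : Prop :=
  ZClosed H ∧ (1 : TorusPt n) ∈ H ∧ (∀ x ∈ H, ∀ y ∈ H, x * y ∈ H) ∧ ∀ x ∈ H, x⁻¹ ∈ H

/-- A coset: a translate of an algebraic subgroup. -/
def IsCoset {n : ℕ} (C : Set (TorusPt n)) : Prop :=
  ∃ (g : TorusPt n) (H : Set (TorusPt n)), IsAlgSubgroup H ∧ C = (g * ·) '' H

/-- Zariski connectedness of a subset of the torus. -/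
def ZConnected {n : ℕ} (H : Set (TorusPt n)) : Prop :=
  ∀ Z₁ Z₂ : Set (TorusPt n), ZClosed Z₁ → ZClosed Z₂ → H ⊆ Z₁ ∪ Z₂ →
    H ∩ Z₁ ∩ Z₂ = ∅ → H ⊆ Z₁ ∨ H ⊆ Z₂

/-- `Y` is an `s`-anomalous subvariety of `X`. -/
def IsAnomalous {n : ℕ} (X Y : Set (TorusPt n)) (s : ℕ) : Prop :=
  Y ⊆ X ∧ ZClosed Y ∧ ZIrred Y ∧ 1 ≤ zdim Y ∧
    ∃ H : Set (TorusPt n), IsCoset H ∧ Y ⊆ H ∧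
      (s : ℤ) + (zdim H : ℤ) - (n : ℤ) < (zdim Y : ℤ)

/-- `X^{oa,s}` : the complement in `X` of the union of all `s`-anomalous subvarieties. -/
def openAnom {n : ℕ} (X : Set (TorusPt n)) (s : ℕ) : Set (TorusPt n) :=
  X \ ⋃ (Y : Set (TorusPt n)) (_ : IsAnomalous X Y s), Y

/-- `X` is defined over (the subfield) `K`: cut out by polynomials with coefficients in `K`. -/
def DefinedOver {n : ℕ} (K : IntermediateField ℚ Qbar) (X : Set (TorusPt n)) : Prop :=
  ∃ I : Set (MvPolynomial (Fin n) Qbar),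
    (∀ f ∈ I, ∀ m, MvPolynomial.coeff m f ∈ K) ∧
    X = {x : TorusPt n | ∀ f ∈ I, MvPolynomial.eval (fun i => (x i : Qbar)) f = 0}

def IsRootOfUnity (α : Qbar) : Prop := ∃ k : ℕ, 1 ≤ k ∧ α ^ k = 1

/-- The Bogomolov property for a subfield of the algebraic numbers. -/
def HasBogomolov (L : IntermediateField ℚ Qbar) : Prop :=
  ∃ C : ℝ, 0 < C ∧ ∀ α : Qbar, α ∈ L → α ≠ 0 → ¬ IsRootOfUnity α → C ≤ weilHeight α


/-! ## Derivations of fields -/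
section A1
open MvPolynomial

/-- the field of constants of a derivation -/
def derKer {k E M : Type*} [Field k] [Field E] [Algebra k E] [AddCommGroup M] [Module E M]
    [Module k M] [IsScalarTower k E M] (d : Derivation k E M) : IntermediateField k E where
  carrier := {x | d x = 0}
  mul_mem' {a b} ha hb := by
    simp only [Set.mem_ofPred_eq] at *
    simp [ha, hb]
  add_mem' {a b} ha hb := by
    simp only [Set.mem_ofPred_eq] at *
    simp [ha, hb]
  algebraMap_mem' r := by simp
  inv_mem' x hx := by
    simp only [Set.mem_ofPred_eq] at *
    simp [Derivation.leibniz_inv, hx]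

theorem mem_derKer {k E M : Type*} [Field k] [Field E] [Algebra k E] [AddCommGroup M] [Module E M]
    [Module k M] [IsScalarTower k E M] (d : Derivation k E M) (x : E) :
    x ∈ derKer d ↔ d x = 0 := Iff.rfl

theorem derKer_algebraic {k E M : Type*} [Field k] [Field E] [CharZero E] [Algebra k E]
    [AddCommGroup M] [Module E M]
    [Module k M] [IsScalarTower k E M] (d : Derivation k E M) (x : E)
    (hx : IsAlgebraic (derKer d) x) : d x = 0 := by
  have key : ∀ p : Polynomial (derKer d),
      d (Polynomial.aeval x p) = (Polynomial.aeval x (Polynomial.derivative p)) • d x := by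
    intro p
    induction p using Polynomial.induction_on' with
    | add p q hp hq => simp [hp, hq, add_smul]
    | monomial n a =>
      have ha : d (a : E) = 0 := a.2
      simp only [Polynomial.aeval_monomial, Polynomial.derivative_monomial]
      rw [Derivation.leibniz, Derivation.leibniz_pow]
      have : d (algebraMap (derKer d) E a) = 0 := ha
      rw [this]
      simp only [smul_zero, add_zero, map_mul, map_natCast, ← Nat.cast_smul_eq_nsmul E, smul_smul]
      congr 1
      ring
  have h1 := key (minpoly (derKer d) x)
  rw [minpoly.aeval, map_zero] at h1
  have hsep : (minpoly (derKer d) x).Separable :=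
    (minpoly.irreducible hx.isIntegral).separable
  have h2 := hsep.aeval_derivative_ne_zero (minpoly.aeval _ x)
  have := h1.symm
  rcases smul_eq_zero.mp this with h | h
  · exact absurd h h2
  · exact h

theorem derivation_ext_of_algebraic {k E M ι : Type*} [Field k] [Field E] [CharZero E] [Algebra k E]
    [AddCommGroup M] [Module E M] [Module k M] [IsScalarTower k E M]
    (v : ι → E) [Algebra.IsAlgebraic (IntermediateField.adjoin k (Set.range v)) E]
    (d : Derivation k E M) (h : ∀ i, d (v i) = 0) : d = 0 := by
  ext x
  apply derKer_algebraic
  have hle : IntermediateField.adjoin k (Set.range v) ≤ derKer d := by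
    rw [IntermediateField.adjoin_le_iff]
    rintro _ ⟨i, rfl⟩
    exact h i
  have hx : IsAlgebraic (IntermediateField.adjoin k (Set.range v)) x :=
    Algebra.IsAlgebraic.isAlgebraic x
  letI := (IntermediateField.inclusion hle).toRingHom.toAlgebra
  haveI : IsScalarTower (IntermediateField.adjoin k (Set.range v)) (derKer d) E :=
    IsScalarTower.of_algebraMap_eq (fun _ => rfl)
  exact hx.tower_top _

theorem formallyEtale_of_isTranscendenceBasis {k E ι : Type*} [Field k] [Field E] [CharZero k]
    [Algebra k E] [Algebra (MvPolynomial ι k) E] [IsScalarTower k (MvPolynomial ι k) E]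
    (hv : IsTranscendenceBasis k (fun i : ι => algebraMap (MvPolynomial ι k) E (X i))) :
    Algebra.FormallyEtale (MvPolynomial ι k) E := by
  set v := (fun i : ι => algebraMap (MvPolynomial ι k) E (X i)) with hvdef
  have haev : ∀ p : MvPolynomial ι k, algebraMap (MvPolynomial ι k) E p = aeval v p := by
    intro p
    have : (IsScalarTower.toAlgHom k (MvPolynomial ι k) E) = aeval v := by
      ext i; simp [hvdef]
    exact DFunLike.congr_fun this p
  have hinj : Function.Injective (algebraMap (MvPolynomial ι k) E) := by
    have h1 : Function.Injective (aeval v : MvPolynomial ι k →ₐ[k] E) := hv.1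
    intro p q hpq
    exact h1 (by rw [← haev, ← haev, hpq])
  haveI : FaithfulSMul (MvPolynomial ι k) E := (faithfulSMul_iff_algebraMap_injective _ _).mpr hinj
  letI : Algebra (FractionRing (MvPolynomial ι k)) E := FractionRing.liftAlgebra _ _
  haveI : IsScalarTower (MvPolynomial ι k) (FractionRing (MvPolynomial ι k)) E := inferInstance
  haveI : Algebra.FormallyEtale (MvPolynomial ι k) (FractionRing (MvPolynomial ι k)) :=
    Algebra.FormallyEtale.of_isLocalization (nonZeroDivisors _)
  haveI : FaithfulSMul (MvPolynomial ι k) E := (faithfulSMul_iff_algebraMap_injective _ _).mpr hinj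
  haveI halg : Algebra.IsAlgebraic (MvPolynomial ι k) E := by
    have := hv.isAlgebraic
    constructor
    intro x
    obtain ⟨p, hp0, hp⟩ := this.isAlgebraic x
    let φ : Algebra.adjoin k (Set.range v) →+* MvPolynomial ι k := hv.1.aevalEquiv.symm.toRingEquiv
    have hr : Function.Injective φ := hv.1.aevalEquiv.symm.injective
    refine ⟨p.map φ, ?_, ?_⟩
    · exact (Polynomial.map_ne_zero_iff hr).mpr hp0
    · rw [← hp, Polynomial.aeval_def, Polynomial.aeval_def, Polynomial.eval₂_map]
      congr 1
      ext y
      obtain ⟨q, rfl⟩ := hv.1.aevalEquiv.surjective y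
      simp [haev, φ]
  haveI : Algebra.IsAlgebraic (FractionRing (MvPolynomial ι k)) E :=
    (IsFractionRing.comap_isAlgebraic_iff (A := MvPolynomial ι k)
      (K := FractionRing (MvPolynomial ι k))).mp halg
  haveI : CharZero (FractionRing (MvPolynomial ι k)) := 
    charZero_of_injective_algebraMap (R := k) (algebraMap k _).injective
  haveI : Algebra.FormallyEtale (FractionRing (MvPolynomial ι k)) E :=
    Algebra.FormallyEtale.of_isSeparable _ _
  exact Algebra.FormallyEtale.comp _ (FractionRing (MvPolynomial ι k)) _

theorem exists_derivation_of_isTranscendenceBasis {k E M ι : Type*} [Field k] [Field E] [CharZero k]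
    [Algebra k E] [AddCommGroup M] [Module E M] [Module k M] [IsScalarTower k E M]
    (v : ι → E) (hv : IsTranscendenceBasis k v) (m : ι → M) :
    ∃ d : Derivation k E M, ∀ i, d (v i) = m i := by
  letI : Algebra (MvPolynomial ι k) E := (aeval v : MvPolynomial ι k →ₐ[k] E).toAlgebra
  haveI : IsScalarTower k (MvPolynomial ι k) E := IsScalarTower.of_algebraMap_eq
    (fun x => ((aeval v : MvPolynomial ι k →ₐ[k] E).commutes x).symm)
  have hX : ∀ i, algebraMap (MvPolynomial ι k) E (X i) = v i := fun i => aeval_X v i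
  haveI : Algebra.FormallyEtale (MvPolynomial ι k) E :=
    formallyEtale_of_isTranscendenceBasis (by simpa only [hX] using hv)
  letI : Module (MvPolynomial ι k) M := Module.compHom M (algebraMap (MvPolynomial ι k) E)
  haveI : IsScalarTower (MvPolynomial ι k) E M := IsScalarTower.of_algebraMap_smul (fun _ _ => rfl)
  haveI : IsScalarTower k (MvPolynomial ι k) M := by
    refine IsScalarTower.of_algebraMap_smul (fun r x => ?_)
    rw [← algebraMap_smul E (algebraMap k (MvPolynomial ι k) r) x, ← IsScalarTower.algebraMap_apply,
      algebraMap_smul]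
  let d0 : Derivation k (MvPolynomial ι k) M := mkDerivation k m
  let l : TensorProduct (MvPolynomial ι k) E (Ω[MvPolynomial ι k⁄k]) →ₗ[E] M :=
    LinearMap.liftBaseChange E d0.liftKaehlerDifferential
  let e := KaehlerDifferential.tensorKaehlerEquivOfFormallyEtale k (MvPolynomial ι k) E
  let L : Ω[E⁄k] →ₗ[E] M := l ∘ₗ e.symm.toLinearMap
  refine ⟨L.compDer (KaehlerDifferential.D k E), fun i => ?_⟩
  have : KaehlerDifferential.D k E (v i) = e (1 ⊗ₜ KaehlerDifferential.D k _ (X i)) := by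
    change _ = KaehlerDifferential.mapBaseChange k (MvPolynomial ι k) E _
    rw [KaehlerDifferential.mapBaseChange_tmul, one_smul, KaehlerDifferential.map_D, hX]
  change l (e.symm (KaehlerDifferential.D k E (v i))) = _
  rw [this, LinearEquiv.symm_apply_apply]
  simp [l, d0]

end A1

/-! ## Logarithmic derivatives and residues -/
section A2
open Polynomial

/-- regard a derivation as a derivation over a bigger ring of constants -/
def derOver {k E M : Type*} [Field k] [Field E] [Algebra k E] [AddCommGroup M] [Module E M]
    [Module k M] [IsScalarTower k E M] (d : Derivation k E M) (L : Type*) [Field L] [Algebra L E]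
    [Module L M] [IsScalarTower L E M] (h : ∀ l : L, d (algebraMap L E l) = 0) :
    Derivation L E M :=
  Derivation.mk' 
    { toFun := d
      map_add' := d.map_add
      map_smul' := fun l x => by
        rw [Algebra.smul_def, Derivation.leibniz, h]
        simp }
    (fun a b => d.leibniz a b)

theorem derOver_apply {k E M : Type*} [Field k] [Field E] [Algebra k E] [AddCommGroup M] [Module E M]
    [Module k M] [IsScalarTower k E M] (d : Derivation k E M) (L : Type*) [Field L] [Algebra L E]
    [Module L M] [IsScalarTower L E M] (h : ∀ l : L, d (algebraMap L E l) = 0) (x : E) :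
    derOver d L h x = d x := rfl

/-- logarithmic derivative -/
def ld {k E M : Type*} [Field k] [Field E] [Algebra k E] [AddCommGroup M] [Module E M]
    [Module k M] (d : Derivation k E M) (u : E) : M := u⁻¹ • d u

section
variable {k E M : Type*} [Field k] [Field E] [Algebra k E] [AddCommGroup M] [Module E M]
    [Module k M] (d : Derivation k E M)

theorem ld_mul {u v : E} (hu : u ≠ 0) (hv : v ≠ 0) : ld d (u * v) = ld d u + ld d v := by
  simp only [ld, Derivation.leibniz, smul_add, smul_smul]
  rw [add_comm]
  congr 2 <;> field_simp

theorem ld_one : ld d (1 : E) = 0 := by simp [ld]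

theorem ld_inv {u : E} (hu : u ≠ 0) : ld d u⁻¹ = - ld d u := by
  have := ld_mul d hu (inv_ne_zero hu)
  rw [mul_inv_cancel₀ hu, ld_one] at this
  exact (neg_eq_of_add_eq_zero_right this.symm).symm

theorem ld_div {u v : E} (hu : u ≠ 0) (hv : v ≠ 0) : ld d (u / v) = ld d u - ld d v := by
  rw [div_eq_mul_inv, ld_mul d hu (inv_ne_zero hv), ld_inv d hv, sub_eq_add_neg]

theorem ld_pow {u : E} (hu : u ≠ 0) (n : ℕ) : ld d (u ^ n) = n • ld d u := by
  induction n with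
  | zero => simp [ld_one]
  | succ n ih => rw [pow_succ, ld_mul d (pow_ne_zero _ hu) hu, ih, succ_nsmul]

theorem ld_zpow {u : E} (hu : u ≠ 0) (n : ℤ) : ld d (u ^ n) = n • ld d u := by
  cases n with
  | ofNat n => simpa using ld_pow d hu n
  | negSucc n =>
    rw [zpow_negSucc, ld_inv d (pow_ne_zero _ hu), ld_pow d hu, negSucc_zsmul]

theorem ld_prod {ι : Type*} (s : Finset ι) (u : ι → E) (hu : ∀ i ∈ s, u i ≠ 0) :
    ld d (∏ i ∈ s, u i) = ∑ i ∈ s, ld d (u i) := by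
  classical
  induction s using Finset.induction_on with
  | empty => simp [ld_one]
  | insert a s ha ih =>
    rw [Finset.prod_insert ha, Finset.sum_insert ha, ld_mul d (hu a (Finset.mem_insert_self a s))
      (Finset.prod_ne_zero_iff.mpr fun i hi => hu i (Finset.mem_insert_of_mem hi)),
      ih (fun i hi => hu i (Finset.mem_insert_of_mem hi))]

end

theorem residue_aux {L E ι : Type*} [Field L] [Field E] [Algebra L E] [Fintype ι]
    {z : E} (hz : Transcendental L z) (c : L) (γ : ι → L) (R : ι → L[X])
    (hR : ∀ j, (R j).eval 0 ≠ 0)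
    (h : algebraMap L E c / z +
      ∑ j, algebraMap L E (γ j) * (aeval z (derivative (R j)) / aeval z (R j)) = 0) : c = 0 := by
  classical
  have hz0 : z ≠ 0 := by
    rintro rfl
    exact hz isAlgebraic_zero
  have hRz : ∀ j, aeval z (R j) ≠ 0 := by
    intro j h0
    have : R j = 0 := by
      by_contra hne
      exact hz ⟨R j, hne, h0⟩
    exact hR j (by rw [this]; simp)
  let W : L[X] := ∑ j, C (γ j) * derivative (R j) * ∏ i ∈ Finset.univ.erase j, R i
  let T : L[X] := C c * ∏ j, R j + X * W
  have hT : aeval z T = 0 := by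
    have h2 : aeval z W = (∑ j, algebraMap L E (γ j) *
        (aeval z (derivative (R j)) / aeval z (R j))) * ∏ j, aeval z (R j) := by
      simp only [W, map_sum, map_mul, map_prod, Finset.sum_mul, aeval_C]
      refine Finset.sum_congr rfl fun j _ => ?_
      rw [← Finset.mul_prod_erase Finset.univ (fun j => aeval z (R j)) (Finset.mem_univ j)]
      have := hRz j
      field_simp
    simp only [T, map_add, map_mul, aeval_C, map_prod, aeval_X, h2]
    have h3 : (∑ j, algebraMap L E (γ j) *
        (aeval z (derivative (R j)) / aeval z (R j))) = - (algebraMap L E c / z) := by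
      linear_combination h
    rw [h3]
    field_simp
    ring
  have hT0 : T = 0 := by
    by_contra hne
    exact hz ⟨T, hne, hT⟩
  have := congrArg (eval 0) hT0
  simp only [T, eval_add, eval_mul, eval_C, eval_X, zero_mul, add_zero, eval_zero, eval_prod] at this
  rcases mul_eq_zero.mp this with h | h
  · exact h
  · exact absurd h (Finset.prod_ne_zero_iff.mpr fun j _ => hR j)

theorem der_aeval {L E : Type*} [Field L] [Field E] [Algebra L E] (d : Derivation L E E) {z : E}
    (hz : d z = 1) (p : L[X]) : d (aeval z p) = aeval z (derivative p) := by
  have := d.map_aeval p z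
  rw [this, hz]; simp

theorem residue_main {L E ι : Type*} [Field L] [Field E] [Algebra L E] [Fintype ι]
    {z : E} (hz : Transcendental L z) (d : Derivation L E E) (hd : d z = 1)
    (γ : ι → L) (u : ι → E) (hu0 : ∀ k, u k ≠ 0) (p q : ι → L[X])
    (hu : ∀ k, u k = aeval z (p k) / aeval z (q k))
    (h : ∑ k, algebraMap L E (γ k) * ld d (u k) = 0) :
    ∃ a : ι → ℤ, ∑ k, γ k * (a k : L) = 0 ∧ ∀ k, ∀ N : ℤ, u k = z ^ N → a k = N := by
  have hz0 : z ≠ 0 := by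
    rintro rfl
    exact hz isAlgebraic_zero
  have hinj : ∀ p : L[X], aeval z p = 0 → p = 0 := fun p hp => by
    by_contra hne
    exact hz ⟨p, hne, hp⟩
  have dec : ∀ p : L[X], p ≠ 0 → ∃ (i : ℕ) (P : L[X]), p = X ^ i * P ∧ P.eval 0 ≠ 0 := by
    intro p hp
    obtain ⟨P, hP, hP'⟩ := Polynomial.exists_eq_pow_rootMultiplicity_mul_and_not_dvd p hp 0
    refine ⟨_, P, by simpa using hP, fun h0 => hP' ?_⟩
    exact Polynomial.dvd_iff_isRoot.mpr h0
  have hp0 : ∀ k, p k ≠ 0 := fun k h0 => hu0 k (by rw [hu, h0]; simp)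
  have hq0 : ∀ k, q k ≠ 0 := fun k h0 => hu0 k (by rw [hu, h0]; simp)
  choose i P hP hP0 using fun k => dec (p k) (hp0 k)
  choose j Q hQ hQ0 using fun k => dec (q k) (hq0 k)
  have hPz : ∀ k, aeval z (P k) ≠ 0 := fun k h0 => hP0 k (by rw [hinj _ h0]; simp)
  have hQz : ∀ k, aeval z (Q k) ≠ 0 := fun k h0 => hQ0 k (by rw [hinj _ h0]; simp)
  have hform : ∀ k, u k = z ^ ((i k : ℤ) - j k) * (aeval z (P k) / aeval z (Q k)) := by
    intro k
    rw [hu, hP, hQ, zpow_sub₀ hz0]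
    have := hPz k
    have := hQz k
    simp only [map_mul, map_pow, aeval_X, zpow_natCast]
    field_simp
  have hldz : ld d z = z⁻¹ := by simp [ld, hd]
  have hldP : ∀ p : L[X], ld d (aeval z p) = aeval z (derivative p) / aeval z p := by
    intro p
    rw [ld, der_aeval d hd, smul_eq_mul, div_eq_inv_mul]
  refine ⟨fun k => (i k : ℤ) - j k, ?_, ?_⟩
  · apply residue_aux hz _ (fun x : ι ⊕ ι => Sum.elim γ (fun k => - γ k) x)
      (fun x => Sum.elim P Q x)
    · rintro (k | k)
      · exact hP0 k
      · exact hQ0 k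
    · rw [← h, Fintype.sum_sum_type, map_sum, Finset.sum_div, ← Finset.sum_add_distrib,
        ← Finset.sum_add_distrib]
      refine Finset.sum_congr rfl fun k _ => ?_
      rw [hform, ld_mul d (zpow_ne_zero _ hz0) (div_ne_zero (hPz k) (hQz k)), ld_zpow d hz0,
        ld_div d (hPz k) (hQz k), hldz, hldP, hldP]
      simp only [Sum.elim_inl, Sum.elim_inr, map_mul, map_neg, zsmul_eq_mul, map_intCast]
      ring
  · intro k N hN
    rw [hform k] at hN
    have h1 : z ^ ((i k : ℤ) - j k - N) * aeval z (P k) = aeval z (Q k) := by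
      rw [zpow_sub₀ hz0 _ N]
      have := hQz k
      have h2 : z ^ N ≠ 0 := zpow_ne_zero _ hz0
      field_simp
      field_simp at hN
      rw [hN]; ring
    rcases lt_trichotomy ((i k : ℤ) - j k - N) 0 with hlt | heq | hgt
    · exfalso
      obtain ⟨m, hm⟩ := Int.exists_eq_neg_ofNat hlt.le
      have hm0 : m ≠ 0 := by rintro rfl; omega
      rw [hm, zpow_neg, zpow_natCast, inv_mul_eq_iff_eq_mul₀ (pow_ne_zero _ hz0)] at h1
      have h3 : aeval z (P k - X ^ m * Q k) = 0 := by simp [h1]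
      have h4 := congrArg (eval 0) (hinj _ h3)
      simp [hm0] at h4
      exact hP0 k h4
    · show (i k : ℤ) - j k = N
      omega
    · exfalso
      obtain ⟨m, hm⟩ := Int.eq_ofNat_of_zero_le hgt.le
      have hm0 : m ≠ 0 := by rintro rfl; omega
      rw [hm, zpow_natCast] at h1
      have h3 : aeval z (X ^ m * P k - Q k) = 0 := by simp [h1]
      have h4 := congrArg (eval 0) (hinj _ h3)
      simp [hm0] at h4
      exact hQ0 k h4

end A2

/-! ## Ax end game -/
section A3
open Polynomial

theorem der_comm_algHom {L F Ω ι : Type*} [Field L] [Field F] [Field Ω] [CharZero F] [Algebra L F]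
    [Algebra L Ω] (σ : F →ₐ[L] Ω) (d : Derivation L F F) (D : Derivation L Ω Ω)
    (v : ι → F) [Algebra.IsAlgebraic (IntermediateField.adjoin L (Set.range v)) F]
    (h : ∀ i, σ (d (v i)) = D (σ (v i))) (x : F) : σ (d x) = D (σ x) := by
  letI : Algebra F Ω := σ.toRingHom.toAlgebra
  haveI : IsScalarTower L F Ω := IsScalarTower.of_algebraMap_eq (fun l => (σ.commutes l).symm)
  have hs : ∀ (a : F) (b : Ω), a • b = σ a * b := fun a b => rfl
  let e : Derivation L F Ω := Derivation.mk'
    { toFun := fun x => σ (d x) - D (σ x)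
      map_add' := fun x y => by simp; ring
      map_smul' := fun l x => by simp [smul_sub] }
    (fun a b => by simp [hs]; ring)
  have he : e = 0 := derivation_ext_of_algebraic v e (fun i => sub_eq_zero.mpr (h i))
  exact sub_eq_zero.mp (DFunLike.congr_fun he x)

theorem isTB_of_field {F E ι : Type*} {x : ι → E} [Field F] [Field E] [Algebra F E]
    (hx : AlgebraicIndependent F x)
    (h : Algebra.IsAlgebraic (IntermediateField.adjoin F (Set.range x)) E) :
    IsTranscendenceBasis F x := by
  rw [hx.isTranscendenceBasis_iff_isAlgebraic]
  open scoped IntermediateField.algebraAdjoinAdjoin in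
  exact (IsFractionRing.comap_isAlgebraic_iff (A := Algebra.adjoin F (Set.range x))
    (K := IntermediateField.adjoin F (Set.range x)) (C := E)).mpr h

theorem aeval_mem_if {F E : Type*} [Field F] [Field E] [Algebra F E] (K : IntermediateField F E)
    {x : E} (hx : x ∈ K) (p : F[X]) : aeval x p ∈ K := by
  have : aeval x p = algebraMap K E (aeval (⟨x, hx⟩ : K) p) := by
    rw [← aeval_algebraMap_apply]; rfl
  rw [this]; exact (aeval (⟨x, hx⟩ : K) p).2

theorem ax_step {L F ι : Type*} [Field L] [CharZero L] [Field F] [CharZero F] [Algebra L F]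
    [Algebra.EssFiniteType L F] [Fintype ι]
    {z : F} (hz : Transcendental L z) [hal : Algebra.IsAlgebraic (IntermediateField.adjoin L {z}) F]
    (d : Derivation L F F) (hd : d z = 1)
    (γ : ι → L) (u : ι → F) (hu0 : ∀ k, u k ≠ 0)
    (h : ∑ k, algebraMap L F (γ k) * ld d (u k) = 0) :
    ∃ a : ι → ℤ, ∑ k, γ k * (a k : L) = 0 ∧ ∀ k, u k = z → a k ≠ 0 := by
  classical
  set K := IntermediateField.adjoin L {z} with hK
  haveI : Algebra.EssFiniteType K F := Algebra.EssFiniteType.of_comp L K F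
  haveI : Module.Finite K F := Algebra.finite_of_essFiniteType_of_isAlgebraic
  let Ω := AlgebraicClosure K
  haveI : CharZero K := charZero_of_injective_algebraMap (algebraMap L K).injective
  haveI : CharZero Ω := charZero_of_injective_algebraMap (algebraMap K Ω).injective
  let zK : K := IntermediateField.AdjoinSimple.gen L z
  have hzK : algebraMap K F zK = z := rfl
  have hzKt : Transcendental L zK := by
    intro hh
    exact hz (hh.algebraMap (A := F))
  let zΩ : Ω := algebraMap K Ω zK
  have hzΩ : Transcendental L zΩ := by
    rw [transcendental_algebraMap_iff (algebraMap K Ω).injective]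
    exact hzKt
  have hrep : ∀ w : K, ∃ p q : L[X], w = aeval zK p / aeval zK q := by
    intro w
    obtain ⟨p, q, hpq⟩ := (IntermediateField.mem_adjoin_simple_iff L (w : F)).mp w.2
    refine ⟨p, q, ?_⟩
    apply (algebraMap K F).injective
    rw [map_div₀, ← aeval_algebraMap_apply, ← aeval_algebraMap_apply]
    exact hpq
  have hΩalg : Algebra.IsAlgebraic (IntermediateField.adjoin L (Set.range fun _ : Unit => zΩ)) Ω := by
    have hle : ∀ w : K, algebraMap K Ω w ∈
        IntermediateField.adjoin L (Set.range fun _ : Unit => zΩ) := by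
      intro w
      obtain ⟨p, q, rfl⟩ := hrep w
      have hm : zΩ ∈ IntermediateField.adjoin L (Set.range fun _ : Unit => zΩ) :=
        IntermediateField.subset_adjoin _ _ ⟨(), rfl⟩
      rw [map_div₀, ← aeval_algebraMap_apply, ← aeval_algebraMap_apply]
      refine div_mem ?_ ?_
      · exact aeval_mem_if _ hm _
      · exact aeval_mem_if _ hm _
    letI : Algebra K (IntermediateField.adjoin L (Set.range fun _ : Unit => zΩ)) :=
      ((algebraMap K Ω).codRestrict _ hle).toAlgebra
    haveI : IsScalarTower K (IntermediateField.adjoin L (Set.range fun _ : Unit => zΩ)) Ω :=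
      IsScalarTower.of_algebraMap_eq (fun _ => rfl)
    exact Algebra.IsAlgebraic.tower_top (K := K) _
  have hbasis : IsTranscendenceBasis L (fun _ : Unit => zΩ) := by
    have hai : AlgebraicIndependent L (fun _ : Unit => zΩ) :=
      (algebraicIndependent_unique_type_iff).mpr hzΩ
    exact isTB_of_field hai hΩalg
  obtain ⟨D, hD⟩ := exists_derivation_of_isTranscendenceBasis _ hbasis (fun _ => (1 : Ω))
  have hD1 : D zΩ = 1 := hD ()
  haveI hal2 : Algebra.IsAlgebraic (IntermediateField.adjoin L (Set.range fun _ : Unit => z)) F := by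
    have : (Set.range fun _ : Unit => z) = {z} := by simp
    rw [this]; exact hal
  have hcomm : ∀ (σ : F →ₐ[K] Ω) (x : F), σ (d x) = D (σ x) := by
    intro σ x
    have := der_comm_algHom (σ.restrictScalars L) d D (fun _ : Unit => z) (fun _ => by
      rw [hd]
      have : σ z = zΩ := by rw [← hzK]; exact σ.commutes zK
      simp [this, hD1]) x
    exact this
  -- norms
  haveI : Algebra.IsSeparable K F := inferInstance
  have hnorm : ∀ x : F, algebraMap K Ω (Algebra.norm K x) = ∏ σ : F →ₐ[K] Ω, σ x :=
    fun x => Algebra.norm_eq_prod_embeddings K Ω x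
  have hld : ∀ (σ : F →ₐ[K] Ω) (x : F), ld D (σ x) = σ (ld d x) := by
    intro σ x
    simp [ld, hcomm σ x]
  have hsum : ∑ k, algebraMap L Ω (γ k) * ld D (algebraMap K Ω (Algebra.norm K (u k))) = 0 := by
    have h1 : ∀ k, ld D (algebraMap K Ω (Algebra.norm K (u k))) = ∑ σ : F →ₐ[K] Ω, σ (ld d (u k)) := by
      intro k
      rw [hnorm, ld_prod D _ _ (fun σ _ => (map_ne_zero σ).mpr (hu0 k))]
      exact Finset.sum_congr rfl fun σ _ => hld σ _
    simp_rw [h1, Finset.mul_sum]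
    rw [Finset.sum_comm]
    apply Finset.sum_eq_zero
    intro σ _
    have h2 : ∀ k, algebraMap L Ω (γ k) = σ (algebraMap L F (γ k)) := fun k =>
      ((σ.restrictScalars L).commutes (γ k)).symm
    simp_rw [h2, ← map_mul, ← map_sum, h, map_zero]
  choose p q hpq using fun k => hrep (Algebra.norm K (u k))
  obtain ⟨a, ha, hb⟩ := residue_main hzΩ D hD1 γ (fun k => algebraMap K Ω (Algebra.norm K (u k)))
    (fun k => by simpa using hu0 k) p q (fun k => by
      rw [hpq k, map_div₀, ← aeval_algebraMap_apply, ← aeval_algebraMap_apply]) hsum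
  refine ⟨a, ha, fun k hk => ?_⟩
  have := hb k (Module.finrank K F) (by
    show algebraMap K Ω (Algebra.norm K (u k)) = _
    rw [hk, ← hzK, Algebra.norm_algebraMap, map_pow, zpow_natCast])
  rw [this]
  have := Module.finrank_pos (R := K) (M := F)
  omega

theorem ax_end {k F ι : Type*} [Field k] [CharZero k] [Field F] [Algebra k F]
    [Algebra.EssFiniteType k F] [Fintype ι]
    (γ : ι → k) (hγ : LinearIndependent ℚ γ) (u : ι → F) (hu0 : ∀ i, u i ≠ 0)
    (h : ∀ d : Derivation k F F, ∑ i, algebraMap k F (γ i) * ld d (u i) = 0) (i : ι) :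
    IsAlgebraic k (u i) := by
  classical
  haveI : CharZero F := charZero_of_injective_algebraMap (algebraMap k F).injective
  by_contra hz
  have hz : Transcendental k (u i) := hz
  have hind : AlgebraicIndepOn k id ({u i} : Set F) := 
    (algebraicIndependent_unique_type_iff).mpr hz
  obtain ⟨s, hs, hb⟩ := exists_isTranscendenceBasis_superset hind
  have hmem : u i ∈ s := hs rfl
  obtain ⟨d, hd⟩ := exists_derivation_of_isTranscendenceBasis _ hb
    (fun x => if (x : F) = u i then (1 : F) else 0)
  have hd1 : d (u i) = 1 := by
    have := hd ⟨u i, hmem⟩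
    simpa using this
  have hd0 : ∀ x ∈ s, x ≠ u i → d x = 0 := by
    intro x hx hne
    have := hd ⟨x, hx⟩
    simpa [hne] using this
  let L := derKer d
  haveI : CharZero L := charZero_of_injective_algebraMap (algebraMap k L).injective
  have hzL : Transcendental L (u i) := by
    intro hh
    have := derKer_algebraic d _ hh
    rw [hd1] at this
    exact one_ne_zero this
  haveI : Algebra.EssFiniteType L F := Algebra.EssFiniteType.of_comp k L F
  let d' : Derivation L F F := derOver d L (fun l => l.2)
  haveI : Algebra.IsAlgebraic (IntermediateField.adjoin L {u i}) F := by
    have h1 := hb.isAlgebraic_field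
    have hle : ∀ w : IntermediateField.adjoin k (Set.range (Subtype.val : s → F)), 
        (w : F) ∈ IntermediateField.adjoin L {u i} := by
      intro w
      have : IntermediateField.adjoin k (Set.range (Subtype.val : s → F)) ≤ 
        (IntermediateField.adjoin L {u i}).restrictScalars k := by
        rw [IntermediateField.adjoin_le_iff]
        rintro _ ⟨⟨x, hx⟩, rfl⟩
        rcases eq_or_ne x (u i) with hxi | hxi
        · subst hxi
          exact IntermediateField.mem_adjoin_simple_self L (u i)
        · exact (IntermediateField.adjoin L {u i}).algebraMap_mem ⟨x, hd0 x hx hxi⟩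
      exact this w.2
    letI : Algebra (IntermediateField.adjoin k (Set.range (Subtype.val : s → F))) 
        (IntermediateField.adjoin L {u i}) := 
      ((algebraMap (IntermediateField.adjoin k (Set.range (Subtype.val : s → F))) F).codRestrict 
        (IntermediateField.adjoin L {u i}) hle).toAlgebra
    haveI : IsScalarTower (IntermediateField.adjoin k (Set.range (Subtype.val : s → F))) 
        (IntermediateField.adjoin L {u i}) F := IsScalarTower.of_algebraMap_eq (fun _ => rfl)
    exact Algebra.IsAlgebraic.tower_top 
      (K := IntermediateField.adjoin k (Set.range (Subtype.val : s → F))) _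
  obtain ⟨a, ha, hne⟩ := ax_step hzL d' hd1 (fun j => algebraMap k L (γ j)) u hu0 (by
    have := h d
    exact this)
  have h0 : ∑ j, (a j : ℚ) • γ j = 0 := by
    apply (algebraMap k L).injective
    rw [map_zero, ← ha, map_sum]
    refine Finset.sum_congr rfl fun j _ => ?_
    rw [Algebra.smul_def, map_mul, mul_comm]
    simp
  have := Fintype.linearIndependent_iff.mp hγ (fun j => (a j : ℚ)) h0 i
  exact hne i rfl (by exact_mod_cast this)
end A3

/-! ## Ax theorem -/
section A4

theorem isAlg_of_subset {k k' F : Type*} [Field k] [Field k'] [Field F] [Algebra k F] [Algebra k' F]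
    (K : IntermediateField k F) (K' : IntermediateField k' F) (hle : ∀ w ∈ K, w ∈ K') {x : F}
    (hx : IsAlgebraic K x) : IsAlgebraic K' x := by
  letI : Algebra K K' := ((algebraMap K F).codRestrict K' (fun w => hle _ w.2)).toAlgebra
  haveI : IsScalarTower K K' F := IsScalarTower.of_algebraMap_eq (fun _ => rfl)
  exact hx.tower_top _

theorem isAlg_of_subset' {k k' F : Type*} [Field k] [Field k'] [Field F] [Algebra k F] [Algebra k' F]
    (K : IntermediateField k F) (K' : IntermediateField k' F) (hle : ∀ w ∈ K, w ∈ K') 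
    (h : Algebra.IsAlgebraic K F) : Algebra.IsAlgebraic K' F :=
  ⟨fun x => isAlg_of_subset K K' hle (h.isAlgebraic x)⟩

theorem exists_alg_basis_in {k F : Type*} [Field k] [Field F] [Algebra k F] {r : ℕ}
    (hr : Algebra.trdeg k F = r) (S : Set F) :
    ∃ (ρ : ℕ) (v : Fin ρ → F), ρ ≤ r ∧ (∀ i, v i ∈ S) ∧ AlgebraicIndependent k v ∧
      ∀ x ∈ S, IsAlgebraic (IntermediateField.adjoin k (Set.range v)) x := by
  obtain ⟨I, hI⟩ := (AlgebraicIndependent.matroid k F).exists_isBasis S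
  rw [AlgebraicIndependent.matroid_isBasis_iff] at hI
  obtain ⟨h1, h2, h3⟩ := hI
  have hcard : Cardinal.mk I ≤ r := by
    rw [← hr]
    exact AlgebraicIndependent.cardinalMk_le_trdeg (x := ((↑) : I → F)) h1
  have hfin : Finite I := Cardinal.lt_aleph0_iff_finite.mp (hcard.trans_lt (Cardinal.natCast_lt_aleph0))
  letI := Fintype.ofFinite I
  have hc : Fintype.card I ≤ r := by
    rw [Cardinal.mk_fintype] at hcard
    exact_mod_cast hcard
  let e := Fintype.equivFin I
  have hrange : Set.range (fun i => ((e.symm i : I) : F)) = I := by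
    ext y; constructor
    · rintro ⟨i, rfl⟩; exact (e.symm i).2
    · intro hy; exact ⟨e ⟨y, hy⟩, by simp⟩
  refine ⟨Fintype.card I, fun i => (e.symm i : F), hc, fun i => h2 (e.symm i).2,
    AlgebraicIndependent.comp h1 e.symm e.symm.injective, fun x hx => ?_⟩
  rw [hrange]
  have h4 := h3 x hx
  letI : Algebra (Algebra.adjoin k I) (IntermediateField.adjoin k I) :=
    (Subalgebra.inclusion (IntermediateField.algebra_adjoin_le_adjoin k I)).toRingHom.toAlgebra
  haveI : IsScalarTower (Algebra.adjoin k I) (IntermediateField.adjoin k I) F :=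
    IsScalarTower.of_algebraMap_eq (congrFun rfl)
  exact h4.extendScalars (Subalgebra.inclusion_injective _)

theorem der_dim {k F : Type*} [Field k] [CharZero k] [Field F] [Algebra k F] {r : ℕ}
    (hr : Algebra.trdeg k F = r) {ρ : ℕ} (v : Fin ρ → F) (hv : AlgebraicIndependent k v) :
    FiniteDimensional F (Derivation (IntermediateField.adjoin k (Set.range v)) F F) ∧
    Module.finrank F (Derivation (IntermediateField.adjoin k (Set.range v)) F F) + ρ ≤ r := by
  classical
  haveI : CharZero F := charZero_of_injective_algebraMap (algebraMap k F).injective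
  obtain ⟨s, hs, hb⟩ := exists_isTranscendenceBasis_superset hv.to_subtype_range
  have hcard : Cardinal.mk s = r := by rw [← hr]; exact hb.cardinalMk_eq_trdeg
  have hfin : Finite s := Cardinal.lt_aleph0_iff_finite.mp
    (hcard.le.trans_lt (Cardinal.natCast_lt_aleph0))
  have hsf : s.Finite := hfin
  set C := IntermediateField.adjoin k (Set.range v) with hC
  let t : Set F := s \ Set.range v
  have htf : t.Finite := hsf.subset Set.diff_subset
  haveI : Fintype t := htf.fintype
  have halg : Algebra.IsAlgebraic (IntermediateField.adjoin C (Set.range (Subtype.val : t → F))) F := by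
    refine isAlg_of_subset' (IntermediateField.adjoin k (Set.range (Subtype.val : s → F))) _ ?_
      hb.isAlgebraic_field
    have : IntermediateField.adjoin k (Set.range (Subtype.val : s → F)) ≤
        (IntermediateField.adjoin C (Set.range (Subtype.val : t → F))).restrictScalars k := by
      rw [IntermediateField.adjoin_le_iff]
      rintro _ ⟨⟨y, hy⟩, rfl⟩
      by_cases hyv : y ∈ Set.range v
      · exact (IntermediateField.adjoin C (Set.range (Subtype.val : t → F))).algebraMap_mem
          ⟨y, IntermediateField.subset_adjoin _ _ hyv⟩
      · exact IntermediateField.subset_adjoin C _ ⟨⟨y, hy, hyv⟩, rfl⟩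
    exact fun w hw => this hw
  let f : Derivation C F F →ₗ[F] (t → F) :=
    { toFun := fun d y => d y
      map_add' := fun d e => rfl
      map_smul' := fun c d => rfl }
  have hf : Function.Injective f := by
    rw [← LinearMap.ker_eq_bot, LinearMap.ker_eq_bot']
    intro d hd
    exact derivation_ext_of_algebraic (Subtype.val : t → F) d (fun i => congrFun hd i)
  refine ⟨FiniteDimensional.of_injective f hf, ?_⟩
  have h1 := LinearMap.finrank_le_finrank_of_injective hf
  rw [Module.finrank_pi] at h1
  have h2 : s.ncard = r := by
    have := Set.cast_ncard hsf
    rw [hcard] at this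
    exact_mod_cast this
  have h3 : (Set.range v).ncard = ρ := by
    rw [← Set.image_univ, Set.ncard_image_of_injective _ hv.injective, Set.ncard_univ]; simp
  have h4 : t.ncard + (Set.range v).ncard = s.ncard := Set.ncard_sdiff_add_ncard_of_subset hs hsf
  have h5 : Fintype.card t = t.ncard := by rw [Set.ncard_eq_toFinset_card', Set.toFinset_card]
  omega

/-- Laurent monomials -/
def mono {n : ℕ} {F : Type*} [Field F] (x : Fin n → F) (b : Fin n → ℤ) : F := ∏ i, x i ^ b i

theorem mono_ne_zero {n : ℕ} {F : Type*} [Field F] {x : Fin n → F} (hx : ∀ i, x i ≠ 0)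
    (b : Fin n → ℤ) : mono x b ≠ 0 := Finset.prod_ne_zero_iff.mpr fun i _ => zpow_ne_zero _ (hx i)

theorem mono_add {n : ℕ} {F : Type*} [Field F] {x : Fin n → F} (hx : ∀ i, x i ≠ 0)
    (b c : Fin n → ℤ) : mono x (b + c) = mono x b * mono x c := by
  simp only [mono, ← Finset.prod_mul_distrib]
  exact Finset.prod_congr rfl fun i _ => zpow_add₀ (hx i) _ _

theorem mono_zero {n : ℕ} {F : Type*} [Field F] (x : Fin n → F) : mono x 0 = 1 := by simp [mono]

theorem ld_mono {n : ℕ} {k F M : Type*} [Field k] [Field F] [Algebra k F] [AddCommGroup M]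
    [Module F M] [Module k M] (d : Derivation k F M) {x : Fin n → F} (hx : ∀ i, x i ≠ 0)
    (b : Fin n → ℤ) : ld d (mono x b) = ∑ i, b i • ld d (x i) := by
  rw [mono, ld_prod d _ _ (fun i _ => zpow_ne_zero _ (hx i))]
  exact Finset.sum_congr rfl fun i _ => ld_zpow d (hx i) _

/-- the geometric condition : no large-dimensional families of anomalous fibres -/
def MCond (k : Type*) {F : Type*} [Field k] [Field F] [Algebra k F] {n : ℕ} (x : Fin n → F)
    (s r : ℕ) : Prop :=
  ∀ (B : Submodule ℤ (Fin n → ℤ)) (ρ : ℕ) (β : Fin ρ → Fin n → ℤ), (∀ i, β i ∈ B) →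
    AlgebraicIndependent k (fun i => mono x (β i)) →
    (∀ b ∈ B, IsAlgebraic (IntermediateField.adjoin k (Set.range fun i => mono x (β i))) (mono x b)) →
    ρ < r → Module.finrank ℤ B + r ≤ s + ρ

section stable
variable {k F : Type*} [Field k] [Field F] [Algebra k F] {n : ℕ} (D : Derivation k F F)
  (K : Submodule F (Fin n → F))

open Classical in
theorem stable_aux1 (hK : ∀ w ∈ K, (fun i => D (w i)) ∈ K) (m : ℕ) : ∀ w ∈ K, w ≠ 0 → (Finset.univ.filter fun i => w i ≠ 0).card ≤ m →
    ∃ v ∈ K, v ≠ 0 ∧ (∀ i, D (v i) = 0) ∧ ∀ i, w i = 0 → v i = 0 := by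
  induction m with
  | zero =>
    intro w _ hw0 hc
    exfalso; apply hw0
    have : (Finset.univ.filter fun i => w i ≠ 0) = ∅ := Finset.card_eq_zero.mp (by omega)
    ext i
    by_contra hi
    have : i ∈ (Finset.univ.filter fun i => w i ≠ 0) := by simpa using hi
    simp_all
  | succ m ih =>
    intro w hw hw0 hc
    obtain ⟨i, hi⟩ := Function.ne_iff.mp hw0
    have hi : w i ≠ 0 := hi
    set u : Fin n → F := (w i)⁻¹ • w with hu
    have huK : u ∈ K := K.smul_mem _ hw
    have hui : u i = 1 := by simp [hu, hi]
    have hu0 : ∀ j, w j = 0 → u j = 0 := fun j hj => by simp [hu, hj]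
    have hune : u ≠ 0 := fun h => by rw [h] at hui; simp at hui
    by_cases hd : (fun j => D (u j)) = 0
    · exact ⟨u, huK, hune, fun j => congrFun hd j, hu0⟩
    · obtain ⟨v, hv, hv0, hvc, hvs⟩ := ih _ (hK u huK) hd (by
        have : (Finset.univ.filter fun j => D (u j) ≠ 0) ⊂ (Finset.univ.filter fun j => w j ≠ 0) := by
          rw [Finset.ssubset_iff_of_subset]
          · exact ⟨i, by simpa using hi, by simp [hui]⟩
          · intro j hj
            simp only [Finset.mem_filter, Finset.mem_univ, true_and] at hj ⊢
            intro h
            exact hj (by simp [hu0 j h])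
        have := Finset.card_lt_card this
        omega)
      exact ⟨v, hv, hv0, hvc, fun j hj => hvs j (by simp [hu0 j hj])⟩

open Classical in
theorem stable_aux2 (hK : ∀ w ∈ K, (fun i => D (w i)) ∈ K) (U : Submodule F (Fin n → F)) (hU : ∀ v ∈ K, (∀ i, D (v i) = 0) → v ∈ U) (m : ℕ) :
    ∀ w ∈ K, (Finset.univ.filter fun i => w i ≠ 0).card ≤ m → w ∈ U := by
  induction m with
  | zero =>
    intro w _ hc
    have : w = 0 := by
      have : (Finset.univ.filter fun i => w i ≠ 0) = ∅ := Finset.card_eq_zero.mp (by omega)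
      ext i
      by_contra hi
      have : i ∈ (Finset.univ.filter fun i => w i ≠ 0) := by simpa using hi
      simp_all
    rw [this]; exact U.zero_mem
  | succ m ih =>
    intro w hw hc
    by_cases hw0 : w = 0
    · rw [hw0]; exact U.zero_mem
    obtain ⟨v, hv, hv0, hvc, hvs⟩ := stable_aux1 D K hK _ w hw hw0 le_rfl
    obtain ⟨i, hi⟩ := Function.ne_iff.mp hv0
    have hi : v i ≠ 0 := hi
    have hwi : w i ≠ 0 := fun h => hi (hvs i h)
    have h1 : w - (w i / v i) • v ∈ U := by
      apply ih _ (K.sub_mem hw (K.smul_mem _ hv))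
      have : (Finset.univ.filter fun j => (w - (w i / v i) • v) j ≠ 0) ⊂
          (Finset.univ.filter fun j => w j ≠ 0) := by
        rw [Finset.ssubset_iff_of_subset]
        · exact ⟨i, by simpa using hwi, by simp [hi]⟩
        · intro j hj
          simp only [Finset.mem_filter, Finset.mem_univ, true_and] at hj ⊢
          intro h
          exact hj (by simp [h, hvs j h])
      have := Finset.card_lt_card this
      omega
    have h2 := U.add_mem h1 (U.smul_mem (w i / v i) (hU v hv hvc))
    simpa using h2

end stable

theorem exists_int_repr {V : Type*} [AddCommGroup V] [Module ℚ V] {n : ℕ} (w : Fin n → V) :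
    ∃ (m : ℕ) (γ : Fin m → V) (N : Fin m → Fin n → ℤ), LinearIndependent ℚ γ ∧
      ∀ i, w i = ∑ k, N k i • γ k := by
  let S := Submodule.span ℤ (Set.range w)
  haveI : Module.Finite ℤ S := Module.Finite.span_of_finite ℤ (Set.finite_range w)
  haveI : IsAddTorsionFree V := IsAddTorsionFree.of_module_rat V
  haveI : Module.IsTorsionFree ℤ S := inferInstance
  let b := Module.finBasis ℤ S
  refine ⟨_, fun k => (b k : V), fun k i => b.repr ⟨w i, Submodule.subset_span ⟨i, rfl⟩⟩ k, ?_, ?_⟩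
  · have h1 : LinearIndependent ℤ (fun k => (b k : V)) :=
      b.linearIndependent.map' S.subtype (Submodule.ker_subtype S)
    exact (LinearIndependent.iff_fractionRing (R := ℤ) (K := ℚ)).mp h1
  · intro i
    have := congrArg (S.subtype) (b.sum_repr ⟨w i, Submodule.subset_span ⟨i, rfl⟩⟩)
    rw [map_sum] at this
    simp only [map_smul] at this
    exact this.symm
end A4

/-! ## Ax theorem, main -/
section A5

/-- log-derivative pairing -/
def ldPair {C F : Type*} [Field C] [Field F] [Algebra C F] {n : ℕ} (x : Fin n → F) :
    (Fin n → F) →ₗ[F] Module.Dual F (Derivation C F F) where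
  toFun w :=
    { toFun := fun d => ∑ i, w i * ld d (x i)
      map_add' := fun d e => by simp [ld, mul_add, Finset.sum_add_distrib]
      map_smul' := fun c d => by
        simp only [ld, Derivation.smul_apply, smul_eq_mul, RingHom.id_apply, Finset.mul_sum]
        exact Finset.sum_congr rfl fun i _ => by ring }
  map_add' v w := by
    ext d
    show ∑ i, (v i + w i) * ld d (x i) = ∑ i, v i * ld d (x i) + ∑ i, w i * ld d (x i)
    simp [add_mul, Finset.sum_add_distrib]
  map_smul' c w := by
    ext d
    show ∑ i, (c * w i) * ld d (x i) = c * ∑ i, w i * ld d (x i)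
    simp [Finset.mul_sum, mul_assoc]

theorem ldPair_apply {C F : Type*} [Field C] [Field F] [Algebra C F] {n : ℕ} (x w : Fin n → F)
    (d : Derivation C F F) : ldPair x w d = ∑ i, w i * ld d (x i) := rfl

theorem ax_main {k F : Type*} [Field k] [CharZero k] [Field F] [Algebra k F]
    [Algebra.EssFiniteType k F] {n s r : ℕ} (hr : Algebra.trdeg k F = r)
    (x : Fin n → F) (hx : ∀ i, x i ≠ 0) (A : Fin s → Fin n → k) (hA : LinearIndependent k A)
    (hc : MCond k x s r) (D : Derivation k F F)
    (hD : ∀ j, ∑ i, algebraMap k F (A j i) * ld D (x i) = 0) : D = 0 := by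
  classical
  by_contra hD0
  haveI : CharZero F := charZero_of_injective_algebraMap (algebraMap k F).injective
  -- the lattice B
  let B : Submodule ℤ (Fin n → ℤ) :=
    { carrier := {b | ∑ i, b i • ld D (x i) = 0}
      add_mem' := fun {a b} ha hb => by
        simp only [Set.mem_ofPred_eq] at *
        simp only [Pi.add_apply, add_smul, Finset.sum_add_distrib, ha, hb, add_zero]
      zero_mem' := by simp
      smul_mem' := fun c b hb => by
        simp only [Set.mem_ofPred_eq] at *
        simp only [Pi.smul_apply, smul_assoc, ← Finset.smul_sum, hb, smul_zero] }
  have hB : ∀ b, b ∈ B ↔ D (mono x b) = 0 := by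
    intro b
    have h1 : b ∈ B ↔ ∑ i, b i • ld D (x i) = 0 := Iff.rfl
    rw [h1, ← ld_mono D hx, ld]
    simp [mono_ne_zero hx]
  obtain ⟨ρ, v, hρr, hvS, hvi, hvalg⟩ := exists_alg_basis_in hr {y | ∃ b ∈ B, y = mono x b}
  choose β hβB hβ using hvS
  have hvβ : v = fun i => mono x (β i) := funext hβ
  set C := IntermediateField.adjoin k (Set.range v) with hC
  have hCD : ∀ c : C, D (algebraMap C F c) = 0 := by
    have : C ≤ derKer D := by
      rw [hC, IntermediateField.adjoin_le_iff]
      rintro _ ⟨i, rfl⟩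
      show D (v i) = 0
      rw [hβ]
      exact (hB _).mp (hβB i)
    exact fun c => this c.2
  let D' : Derivation C F F := derOver D C hCD
  have hD'0 : D' ≠ 0 := by
    intro h
    exact hD0 (by ext y; exact DFunLike.congr_fun h y)
  obtain ⟨hfd, hdim⟩ := der_dim hr v hvi
  rw [← hC] at hfd hdim
  have hpos : 0 < Module.finrank F (Derivation C F F) := by
    haveI : Nontrivial (Derivation C F F) := ⟨⟨D', 0, hD'0⟩⟩
    exact Module.finrank_pos
  have hcond := hc B ρ β hβB (by rw [← hvβ]; exact hvi) (by
    rw [← hvβ]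
    intro b hb
    exact hvalg _ ⟨b, hb, rfl⟩) (by omega)
  -- W
  let AF : Fin s → Fin n → F := fun j i => algebraMap k F (A j i)
  have hAF : LinearIndependent F AF := by
    exact (linearIndependent_algebraMap_comp_iff (v := A)).mpr hA
  let W := Submodule.span F (Set.range AF)
  have hW : Module.finrank F W = s := by
    rw [finrank_span_eq_card hAF]; simp
  let L := ldPair (C := C) x
  let K := W ⊓ LinearMap.ker L
  -- dimension of K
  have hWD : ∀ w ∈ W, ∀ f : F → F, (∀ j, ∑ i, AF j i * f (x i) = 0) → ∑ i, w i * f (x i) = 0 := by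
    intro w hw f hf
    induction hw using Submodule.span_induction with
    | mem y hy => obtain ⟨j, rfl⟩ := hy; exact hf j
    | zero => simp
    | add a b _ _ ha hb => simp [add_mul, Finset.sum_add_distrib, ha, hb]
    | smul c a _ ha => simp [mul_assoc, ← Finset.mul_sum, ha]
  let LW : W →ₗ[F] Module.Dual F (Derivation C F F) := L.comp W.subtype
  have hrange : Module.finrank F (LinearMap.range LW) + 1 ≤
      Module.finrank F (Derivation C F F) := by
    have h1 : LinearMap.range LW ≤ (Submodule.span F {D'}).dualAnnihilator := by
      rintro _ ⟨w, rfl⟩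
      rw [Submodule.mem_dualAnnihilator]
      intro e he
      obtain ⟨c, rfl⟩ := Submodule.mem_span_singleton.mp he
      rw [map_smul]
      have : LW w D' = 0 := hWD w w.2 (ld D') hD
      rw [this, smul_zero]
    have h2 := Submodule.finrank_mono h1
    have h3 := Subspace.finrank_add_finrank_dualAnnihilator_eq (Submodule.span F {D'})
    rw [finrank_span_singleton hD'0] at h3
    omega
  have hker : Module.finrank F (LinearMap.ker LW) = Module.finrank F K := by
    have : K = (LinearMap.ker LW).map W.subtype := by
      ext w
      simp only [K, LW, Submodule.mem_inf, LinearMap.mem_ker, Submodule.mem_map, LinearMap.comp_apply]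
      constructor
      · rintro ⟨h1, h2⟩; exact ⟨⟨w, h1⟩, h2, rfl⟩
      · rintro ⟨y, h1, rfl⟩; exact ⟨y.2, h1⟩
    rw [this]
    exact (LinearEquiv.finrank_eq (Submodule.equivMapOfInjective _ W.injective_subtype _))
  have hrn := LinearMap.finrank_range_add_finrank_ker LW
  rw [hW] at hrn
  have hKB : Module.finrank ℤ B < Module.finrank F K := by omega
  -- B_F
  let bF := Module.finBasis ℤ B
  let BF := Submodule.span F (Set.range fun k => (fun i => (((bF k : Fin n → ℤ) i : ℤ) : F)))
  have hBFmem : ∀ b ∈ B, (fun i => ((b i : ℤ) : F)) ∈ BF := by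
    intro b hb
    have h1 := congrArg (B.subtype) (bF.sum_repr ⟨b, hb⟩)
    rw [map_sum] at h1
    simp only [map_smul] at h1
    have h2 : (fun i => ((b i : ℤ) : F)) = ∑ k, ((bF.repr ⟨b, hb⟩ k : ℤ) : F) •
        (fun i => (((bF k : Fin n → ℤ) i : ℤ) : F)) := by
      ext i
      have h3 := congrFun h1 i
      simp only [Finset.sum_apply, Pi.smul_apply, Submodule.subtype_apply, smul_eq_mul] at h3 ⊢
      rw [← h3]
      push_cast
      rfl
    rw [h2]
    exact Submodule.sum_mem _ fun k _ => Submodule.smul_mem _ _ (Submodule.subset_span ⟨k, rfl⟩)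
  have hBFdim : Module.finrank F BF ≤ Module.finrank ℤ B := by
    have := finrank_range_le_card (R := F) (fun k => (fun i => (((bF k : Fin n → ℤ) i : ℤ) : F)))
    simpa [Set.finrank] using this
  -- K stable
  have hKst : ∀ w ∈ K, (fun i => D (w i)) ∈ K := by
    intro w hw
    refine ⟨?_, ?_⟩
    · have hw1 : w ∈ W := hw.1
      clear hw
      induction hw1 using Submodule.span_induction with
      | mem y hy =>
        obtain ⟨j, rfl⟩ := hy
        have : (fun i => D (AF j i)) = 0 := by ext i; exact D.map_algebraMap _
        rw [this]; exact W.zero_mem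
      | zero =>
        have h9 : (fun i => D ((0 : Fin n → F) i)) = 0 := by ext i; simp
        rw [h9]; exact W.zero_mem
      | add a b _ _ ha hb =>
        have := W.add_mem ha hb
        have h9 : (fun i => D ((a + b) i)) = (fun i => D (a i)) + fun i => D (b i) := by
          ext i; simp
        rw [h9]; exact this
      | smul c a ha' ha =>
        have := W.add_mem (W.smul_mem c ha) (W.smul_mem (D c) ha')
        have h9 : (fun i => D ((c • a) i)) = (c • fun i => D (a i)) + D c • a := by
          ext i; simp; ring
        rw [h9]; exact this
    · rw [SetLike.mem_coe, LinearMap.mem_ker]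
      ext e
      have h0 : ∑ i, w i * ld e (x i) = 0 := by
        have := hw.2
        rw [SetLike.mem_coe, LinearMap.mem_ker] at this
        exact DFunLike.congr_fun this e
      -- commutator
      have h1 : ∑ i, w i * ld ⁅D', e⁆ (x i) = 0 := by
        have := hw.2
        rw [SetLike.mem_coe, LinearMap.mem_ker] at this
        exact DFunLike.congr_fun this ⁅D', e⁆
      have h2 : ∑ i, w i * e (ld D (x i)) = 0 := by
        refine hWD w hw.1 (fun y => e (ld D y)) fun j => ?_
        have h3 := congrArg e (hD j)
        rw [map_sum, map_zero] at h3
        rw [← h3]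
        refine Finset.sum_congr rfl fun i _ => ?_
        rw [Derivation.leibniz]
        have : e (algebraMap k F (A j i)) = 0 := by
          have h4 := e.map_algebraMap (algebraMap k C (A j i))
          exact h4
        simp [this, AF]
      have h3 : ∀ i, D (ld e (x i)) = e (ld D (x i)) + ld ⁅D', e⁆ (x i) := by
        intro i
        simp only [ld, smul_eq_mul, Derivation.leibniz, Derivation.commutator_apply,
          Derivation.leibniz_inv]
        have : ∀ y, D' y = D y := fun y => rfl
        rw [this, this]
        have := hx i
        field_simp
        ring
      have h4 := congrArg D h0
      rw [map_sum, map_zero] at h4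
      simp only [Derivation.leibniz, h3, smul_eq_mul, Finset.sum_add_distrib, mul_add, h1, h2] at h4
      show ∑ i, D (w i) * ld e (x i) = 0
      rw [← h4]
      simp [mul_comm]
  -- get constant vector
  have hex : ∃ w ∈ K, (∀ i, D (w i) = 0) ∧ w ∉ BF := by
    by_contra hcon
    push Not at hcon
    have : K ≤ BF := fun w hw => stable_aux2 D K hKst BF hcon _ w hw le_rfl
    have := Submodule.finrank_mono this
    omega
  obtain ⟨w, hwK, hwD, hwB⟩ := hex
  let F1 := derKer D
  haveI : CharZero F1 := charZero_of_injective_algebraMap (algebraMap k F1).injective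
  haveI : Algebra.EssFiniteType F1 F := Algebra.EssFiniteType.of_comp k F1 F
  obtain ⟨m, γ, N, hγ, hN⟩ := exists_int_repr (fun i => (⟨w i, hwD i⟩ : F1))
  have hN' : ∀ i, w i = ∑ k, (N k i : F) * (γ k : F) := by
    intro i
    have := congrArg (algebraMap F1 F) (hN i)
    rw [map_sum] at this
    simpa using this
  have halg := ax_end γ hγ (fun k => mono x (N k)) (fun k => mono_ne_zero hx _) (by
    intro d
    have h0 : ∑ i, w i * ld d (x i) = 0 := by
      have := hwK.2
      rw [SetLike.mem_coe, LinearMap.mem_ker] at this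
      exact DFunLike.congr_fun this (derOver d C (fun c => 
        d.map_algebraMap (⟨algebraMap C F c, hCD c⟩ : F1)))
    rw [← h0]
    simp_rw [ld_mono d hx, hN', Finset.sum_mul, Finset.mul_sum]
    rw [Finset.sum_comm]
    refine Finset.sum_congr rfl fun i _ => Finset.sum_congr rfl fun k _ => ?_
    rw [zsmul_eq_mul]
    show (γ k : F) * _ = _
    ring)
  apply hwB
  have hw : w = ∑ k, (γ k : F) • (fun i => ((N k i : ℤ) : F)) := by
    ext i
    rw [hN' i]
    simp [Finset.sum_apply, mul_comm]
  rw [hw]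
  exact Submodule.sum_mem _ fun k _ => BF.smul_mem _ (hBFmem _ ((hB _).mpr
    (derKer_algebraic D _ (halg k))))
end A5

/-! ## Embeddings -/
section B1
open MvPolynomial

theorem optE_aeval {k Ω σ : Type*} [Field k] [Field Ω] [Algebra k Ω] (p : Option σ → Ω)
    (G : MvPolynomial (Option σ) k) :
    aeval p G = (optionEquivLeft k σ G).eval₂ ((aeval (p ∘ some) : MvPolynomial σ k →ₐ[k] Ω) : MvPolynomial σ k →+* Ω) (p none) := by
  induction G using MvPolynomial.induction_on with
  | C a => simp
  | add f g hf hg => simp [Polynomial.eval₂_add, hf, hg]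
  | mul_X f i hf =>
    rw [map_mul, map_mul, Polynomial.eval₂_mul, hf]
    cases i <;> simp

theorem optE_pderiv {k σ : Type*} [Field k]
    (G : MvPolynomial (Option σ) k) :
    optionEquivLeft k σ (pderiv none G) = (optionEquivLeft k σ G).derivative := by
  classical
  induction G using MvPolynomial.induction_on with
  | C a => simp
  | add f g hf hg => simp [hf, hg]
  | mul_X f i hf =>
    rw [Derivation.leibniz, map_add, map_mul, Polynomial.derivative_mul]
    cases i <;> simp [hf, pderiv_X, Pi.single_apply]
    all_goals ring

theorem mvaeval_mem_if {k F σ : Type*} [Field k] [Field F] [Algebra k F] (K : IntermediateField k F)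
    {x : σ → F} (hx : ∀ i, x i ∈ K) (p : MvPolynomial σ k) : aeval x p ∈ K := by
  induction p using MvPolynomial.induction_on with
  | C a => rw [aeval_C]; exact K.algebraMap_mem a
  | add f g hf hg => rw [map_add]; exact add_mem hf hg
  | mul_X f i hf => rw [map_mul, aeval_X]; exact mul_mem hf (hx i)

theorem emb_exists {k F : Type*} [Field k] [CharZero k] [Field F] [Algebra k F]
    [Algebra.EssFiniteType k F] {r : ℕ} (hr : Algebra.trdeg k F = r) :
    ∃ (p : Option (Fin r) → F) (G : MvPolynomial (Option (Fin r)) k) (lead : MvPolynomial (Fin r) k),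
      IsTranscendenceBasis k (p ∘ some) ∧ IntermediateField.adjoin k (Set.range p) = ⊤ ∧
      aeval p G = 0 ∧ aeval p (pderiv none G) ≠ 0 ∧ lead ≠ 0 ∧
      ∀ {Ω : Type} [Field Ω] [Algebra k Ω] (p' : Option (Fin r) → Ω), aeval p' G = 0 →
        (aeval (p' ∘ some) lead ≠ 0 →
          IsAlgebraic (IntermediateField.adjoin k (Set.range (p' ∘ some))) (p' none)) ∧
        (AlgebraicIndependent k (p' ∘ some) → ∃ θ : F →ₐ[k] Ω, ∀ i, θ (p i) = p' i) := by
  classical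
  obtain ⟨ρ, Z, hρ, -, hZ, hZalg⟩ := exists_alg_basis_in hr Set.univ
  have hTB : IsTranscendenceBasis k Z := isTB_of_field hZ ⟨fun x => hZalg x trivial⟩
  have hρr : ρ = r := by
    have := hTB.lift_cardinalMk_eq_trdeg
    rw [hr] at this
    simpa using this
  subst hρr
  set R := MvPolynomial (Fin ρ) k with hR
  set Rt := FractionRing R with hRt
  letI alg0 : Algebra R F := (aeval Z : R →ₐ[k] F).toRingHom.toAlgebra
  have halg0 : ∀ q : R, algebraMap R F q = aeval Z q := fun q => rfl
  have hinj : Function.Injective (algebraMap R F) := hZ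
  haveI : FaithfulSMul R F := (faithfulSMul_iff_algebraMap_injective R F).mpr hinj
  letI alg1 : Algebra Rt F := FractionRing.liftAlgebra R F
  haveI : IsScalarTower R Rt F := inferInstance
  haveI t1 : IsScalarTower k R F := IsScalarTower.of_algebraMap_eq (fun a => by
    rw [halg0, MvPolynomial.algebraMap_eq, aeval_C])
  haveI t2 : IsScalarTower k Rt F := IsScalarTower.of_algebraMap_eq (fun a => by
    rw [IsScalarTower.algebraMap_apply k R Rt, ← IsScalarTower.algebraMap_apply R Rt F,
      ← IsScalarTower.algebraMap_apply k R F])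
  haveI : CharZero F := charZero_of_injective_algebraMap (algebraMap k F).injective
  haveI : CharZero Rt := charZero_of_injective_algebraMap (algebraMap k Rt).injective
  haveI : Algebra.IsAlgebraic R F := by
    constructor
    intro x
    have h := hTB.isAlgebraic.isAlgebraic x
    obtain ⟨f, hf, hfx⟩ := h
    let ψ : R →+* Algebra.adjoin k (Set.range Z) :=
      ((aeval Z : R →ₐ[k] F).codRestrict (Algebra.adjoin k (Set.range Z)) (fun q => by
        rw [Algebra.adjoin_range_eq_range_aeval]; exact ⟨q, rfl⟩)).toRingHom
    have hψ : Function.Surjective ψ := by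
      rintro ⟨y, hy⟩
      have hy' := hy
      rw [Algebra.adjoin_range_eq_range_aeval] at hy'
      obtain ⟨q, hq⟩ := hy'
      exact ⟨q, Subtype.ext hq⟩
    obtain ⟨g, hg⟩ := Polynomial.map_surjective ψ hψ f
    refine ⟨g, ?_, ?_⟩
    · rintro rfl
      exact hf (by rw [← hg]; simp)
    · rw [← hfx, ← hg, Polynomial.aeval_def, Polynomial.aeval_def, Polynomial.eval₂_map]
      rfl
  haveI : Algebra.IsAlgebraic Rt F :=
    (IsFractionRing.comap_isAlgebraic_iff (A := R) (K := Rt) (C := F)).mp inferInstance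
  haveI : Algebra.EssFiniteType Rt F := Algebra.EssFiniteType.of_comp k Rt F
  haveI : Module.Finite Rt F := Algebra.finite_of_essFiniteType_of_isAlgebraic
  haveI : Algebra.IsSeparable Rt F := inferInstance
  let pb := Field.powerBasisOfFiniteOfSeparable Rt F
  let Y := pb.gen
  let M : Polynomial R := IsLocalization.integerNormalization (nonZeroDivisors R) (minpoly Rt Y)
  obtain ⟨b, hbm, hbM⟩ := IsLocalization.integerNormalization_spec (nonZeroDivisors R) (minpoly Rt Y)
  have hb0 : (b : R) ≠ 0 := nonZeroDivisors.ne_zero hbm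
  have hMmap : M.map (algebraMap R Rt) = Polynomial.C (algebraMap R Rt b) * minpoly Rt Y := by
    rw [← Polynomial.smul_eq_C_mul, algebraMap_smul]; exact hbM
  have hmin0 : minpoly Rt Y ≠ 0 := minpoly.ne_zero (Algebra.IsIntegral.isIntegral Y)
  have hM0 : M ≠ 0 := by
    intro h
    rw [h, Polynomial.map_zero] at hMmap
    have := mul_eq_zero.mp hMmap.symm
    simp [hmin0, hb0] at this
  let p : Option (Fin ρ) → F := fun o => o.elim Y Z
  have hpZ : p ∘ some = Z := rfl
  have hev : ∀ Q : Polynomial R, aeval p ((optionEquivLeft k (Fin ρ)).symm Q) = Polynomial.aeval Y Q := by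
    intro Q
    rw [optE_aeval, AlgEquiv.apply_symm_apply]; rfl
  have hev2 : ∀ Q : Polynomial R, Polynomial.aeval Y Q = Polynomial.aeval Y (Q.map (algebraMap R Rt)) := by
    intro Q
    rw [Polynomial.aeval_map_algebraMap]
  refine ⟨p, (optionEquivLeft k (Fin ρ)).symm M, M.leadingCoeff, hTB, ?_, ?_, ?_, ?_, ?_⟩
  · rw [eq_top_iff]
    intro w _
    have hw : w ∈ Algebra.adjoin Rt {Y} := by rw [pb.adjoin_gen_eq_top]; trivial
    set K := IntermediateField.adjoin k (Set.range p)
    have hRK : ∀ q : R, algebraMap R F q ∈ K := by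
      intro q
      rw [halg0]
      exact mvaeval_mem_if K (fun i => IntermediateField.subset_adjoin _ _ ⟨some i, rfl⟩) q
    induction hw using Algebra.adjoin_induction with
    | mem x hx =>
      rw [Set.mem_singleton_iff.mp hx]
      exact IntermediateField.subset_adjoin _ _ ⟨none, rfl⟩
    | algebraMap c =>
      obtain ⟨a, b, hb, rfl⟩ := IsFractionRing.div_surjective (A := R) c
      rw [map_div₀, ← IsScalarTower.algebraMap_apply, ← IsScalarTower.algebraMap_apply]
      exact div_mem (hRK a) (hRK b)
    | add x y _ _ hx hy => exact add_mem (hx trivial) (hy trivial)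
    | mul x y _ _ hx hy => exact mul_mem (hx trivial) (hy trivial)
  · rw [hev, hev2, hMmap, map_mul, minpoly.aeval, mul_zero]
  · have h1 : pderiv none ((optionEquivLeft k (Fin ρ)).symm M) = (optionEquivLeft k (Fin ρ)).symm M.derivative := by
      apply (optionEquivLeft k (Fin ρ)).injective
      rw [optE_pderiv, AlgEquiv.apply_symm_apply, AlgEquiv.apply_symm_apply]
    rw [h1, hev, hev2, ← Polynomial.derivative_map, hMmap, Polynomial.derivative_C_mul, map_mul,
      Polynomial.aeval_C]
    refine mul_ne_zero ?_ ?_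
    · simpa using hb0
    · exact (Algebra.IsSeparable.isSeparable Rt Y).aeval_derivative_ne_zero (minpoly.aeval _ _)
  · exact Polynomial.leadingCoeff_ne_zero.mpr hM0
  · intro Ω _ _ p' hp'
    rw [optE_aeval, AlgEquiv.apply_symm_apply] at hp'
    constructor
    · intro hl
      let φ : R →+* IntermediateField.adjoin k (Set.range (p' ∘ some)) :=
        ((aeval (p' ∘ some) : R →ₐ[k] Ω) : R →+* Ω).codRestrict (IntermediateField.adjoin k (Set.range (p' ∘ some))) (fun q => 
          mvaeval_mem_if (IntermediateField.adjoin k (Set.range (p' ∘ some))) (fun i => IntermediateField.subset_adjoin _ _ ⟨i, rfl⟩) q)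
      refine ⟨M.map φ, ?_, ?_⟩
      · intro h
        apply hl
        have := congrArg (fun q => Polynomial.coeff q M.natDegree) h
        simp only [Polynomial.coeff_map, Polynomial.coeff_zero] at this
        exact congrArg Subtype.val this
      · rw [Polynomial.aeval_def, Polynomial.eval₂_map]
        exact hp'
    · intro hind
      letI a0 : Algebra R Ω := (aeval (p' ∘ some) : R →ₐ[k] Ω).toRingHom.toAlgebra
      have ha0 : ∀ q : R, algebraMap R Ω q = aeval (p' ∘ some) q := fun q => rfl
      haveI : FaithfulSMul R Ω := (faithfulSMul_iff_algebraMap_injective R Ω).mpr hind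
      letI a1 : Algebra Rt Ω := FractionRing.liftAlgebra R Ω
      haveI : IsScalarTower R Rt Ω := inferInstance
      haveI t1 : IsScalarTower k R Ω := IsScalarTower.of_algebraMap_eq (fun a => by
        rw [ha0, MvPolynomial.algebraMap_eq, aeval_C])
      haveI t2 : IsScalarTower k Rt Ω := IsScalarTower.of_algebraMap_eq (fun a => by
        rw [IsScalarTower.algebraMap_apply k R Rt, ← IsScalarTower.algebraMap_apply R Rt Ω,
          ← IsScalarTower.algebraMap_apply k R Ω])
      have hroot : Polynomial.aeval (p' none) (minpoly Rt pb.gen) = 0 := by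
        have h1 : Polynomial.aeval (p' none) (M.map (algebraMap R Rt)) = 0 := by
          rw [Polynomial.aeval_map_algebraMap]; exact hp'
        rw [hMmap, map_mul, Polynomial.aeval_C] at h1
        rcases mul_eq_zero.mp h1 with h | h
        · simp [hb0] at h
        · exact h
      refine ⟨(pb.lift (p' none) hroot).restrictScalars k, ?_⟩
      rintro (_ | i)
      · exact pb.lift_gen _ hroot
      · have : p (some i) = algebraMap Rt F (algebraMap R Rt (X i)) := by
          rw [← IsScalarTower.algebraMap_apply, halg0, aeval_X]; rfl
        rw [this, AlgHom.restrictScalars_apply, AlgHom.commutes, ← IsScalarTower.algebraMap_apply, ha0, aeval_X]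
        rfl

end B1

/-! ## Analytic lemma -/
section B2
open Topology

theorem an_select {V : Type*} [AddCommGroup V] [Module ℂ V] [FiniteDimensional ℂ V] {r s : ℕ}
    (hV : Module.finrank ℂ V = r + 1) (G' : V →ₗ[ℂ] ℂ) (hG' : G' ≠ 0) (ω : Fin s → V →ₗ[ℂ] ℂ)
    (hker : ∀ v, G' v = 0 → (∀ j, ω j v = 0) → v = 0) :
    ∃ J : Fin r → Fin s, ∀ v, G' v = 0 → (∀ j, ω (J j) v = 0) → v = 0 := by
  classical
  set W := LinearMap.ker G'
  have hW : Module.finrank ℂ W = r := by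
    have h1 := LinearMap.finrank_range_add_finrank_ker G'
    have h2 : Module.finrank ℂ (LinearMap.range G') = 1 := by
      rw [LinearMap.range_eq_top.mpr (LinearMap.surjective hG')]; simp
    change Module.finrank ℂ (LinearMap.ker G') = r
    omega
  let ω' : Fin s → Module.Dual ℂ W := fun j => (ω j).comp W.subtype
  obtain ⟨f, hf, hspan, -⟩ := Submodule.exists_fun_fin_finrank_span_eq ℂ (Set.range ω')
  have hbot : (Submodule.span ℂ (Set.range ω')).dualCoannihilator = ⊥ := by
    rw [eq_bot_iff]
    intro w hw
    rw [Submodule.mem_dualCoannihilator] at hw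
    have : (w : V) = 0 := hker w w.2 (fun j => hw _ (Submodule.subset_span ⟨j, rfl⟩))
    exact Subtype.ext this
  have hfr : Module.finrank ℂ (Submodule.span ℂ (Set.range ω')) = r := by
    have := Subspace.finrank_add_finrank_dualCoannihilator_eq (Submodule.span ℂ (Set.range ω'))
    rw [hbot, hW] at this
    simpa using this
  choose J hJ using hf
  refine ⟨fun j => J (Fin.cast hfr.symm j), fun v hv h => ?_⟩
  apply hker v hv
  intro j
  have h1 : ω' j ∈ Submodule.span ℂ (Set.range f) := by
    rw [hspan]; exact Submodule.subset_span ⟨j, rfl⟩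
  have h2 : Submodule.span ℂ (Set.range f) ≤ LinearMap.ker (LinearMap.applyₗ (R := ℂ) (M₂ := ℂ) (⟨v, hv⟩ : W)) := by
    rw [Submodule.span_le]
    rintro _ ⟨i, rfl⟩
    have := h (Fin.cast hfr i)
    rw [← hJ i]
    exact this
  exact h2 h1

theorem an_open {V : Type*} [NormedAddCommGroup V] [NormedSpace ℂ V] [FiniteDimensional ℂ V] {n r s : ℕ}
    (hV : Module.finrank ℂ V = r + 1) (p0 : V) (G : V → ℂ) (G' : V →L[ℂ] ℂ)
    (hG : HasStrictFDerivAt G G' p0) (hG0 : G p0 = 0) (hG' : G' ≠ 0)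
    (l : Fin n → V → ℂ) (l' : Fin n → V →L[ℂ] ℂ) (hl : ∀ i, HasStrictFDerivAt (l i) (l' i) p0)
    (hl0 : ∀ i, l i p0 = 0) (A : Fin s → Fin n → ℂ)
    (hker : ∀ v, G' v = 0 → (∀ j, ∑ i, A j i * l' i v = 0) → v = 0) :
    ∃ J : Fin r → Fin s, ∀ U ∈ 𝓝 p0, ∃ c > 0, ∃ η > 0, ∀ A' : Fin r → Fin n → ℂ,
      (∀ j i, ‖A' j i - A (J j) i‖ < η) → ∀ τ : Fin r → ℂ, (∀ j, ‖τ j‖ < c) →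
      ∃ p ∈ U, G p = 0 ∧ ∀ j, ∑ i, A' j i * l i p = τ j := by
  classical
  haveI := FiniteDimensional.complete ℂ V
  obtain ⟨J, hJ⟩ := an_select hV (G' : V →ₗ[ℂ] ℂ) (by intro h; apply hG'; ext v; exact LinearMap.congr_fun h v)
    (fun j => ((∑ i, A j i • l' i : V →L[ℂ] ℂ) : V →ₗ[ℂ] ℂ)) (by
      intro v hv h; exact hker v hv (fun j => by simpa using h j))
  refine ⟨J, fun U hU => ?_⟩
  let AJ : Fin r → Fin n → ℂ := fun j => A (J j)
  let Θ : V × (Fin r → Fin n → ℂ) → ℂ × (Fin r → ℂ) × (Fin r → Fin n → ℂ) := fun q =>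
    (G q.1, (fun j => ∑ i, q.2 j i * l i q.1), q.2)
  let L0 : V →L[ℂ] (Fin r → ℂ) := ContinuousLinearMap.pi fun j => ∑ i, AJ j i • l' i
  let Θ' : V × (Fin r → Fin n → ℂ) →L[ℂ] ℂ × (Fin r → ℂ) × (Fin r → Fin n → ℂ) :=
    (G'.comp (ContinuousLinearMap.fst ℂ _ _)).prod ((L0.comp (ContinuousLinearMap.fst ℂ _ _)).prod
      (ContinuousLinearMap.snd ℂ _ _))
  have hΘ : HasStrictFDerivAt Θ Θ' (p0, AJ) := by
    refine HasStrictFDerivAt.prodMk ?_ (HasStrictFDerivAt.prodMk ?_ ?_)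
    · exact HasStrictFDerivAt.comp (p0, AJ) hG hasStrictFDerivAt_fst
    · apply hasStrictFDerivAt_pi'.mpr
      intro j
      have h1 : ∀ i, HasStrictFDerivAt (fun q : V × (Fin r → Fin n → ℂ) => q.2 j i * l i q.1)
          (AJ j i • (l' i).comp (ContinuousLinearMap.fst ℂ _ _)) (p0, AJ) := by
        intro i
        have ha : HasStrictFDerivAt (fun q : V × (Fin r → Fin n → ℂ) => q.2 j i)
          (((ContinuousLinearMap.proj i).comp (ContinuousLinearMap.proj j)).comp (ContinuousLinearMap.snd ℂ V (Fin r → Fin n → ℂ))) (p0, AJ) :=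
          ContinuousLinearMap.hasStrictFDerivAt (((ContinuousLinearMap.proj (R := ℂ) (φ := fun _ : Fin n => ℂ) i).comp (ContinuousLinearMap.proj (R := ℂ) (φ := fun _ : Fin r => (Fin n → ℂ)) j)).comp (ContinuousLinearMap.snd ℂ V (Fin r → Fin n → ℂ)))
        have hb : HasStrictFDerivAt (fun q : V × (Fin r → Fin n → ℂ) => l i q.1)
          ((l' i).comp (ContinuousLinearMap.fst ℂ _ _)) (p0, AJ) :=
          HasStrictFDerivAt.comp (p0, AJ) (hl i) hasStrictFDerivAt_fst
        have := ha.mul hb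
        refine this.congr_fderiv ?_
        rw [hl0]
        refine ContinuousLinearMap.ext fun q => ?_
        simp
      have h2 := HasStrictFDerivAt.fun_sum (u := Finset.univ) (fun i _ => h1 i)
      refine h2.congr_fderiv ?_
      refine ContinuousLinearMap.ext fun q => ?_
      simp [L0]
    · exact hasStrictFDerivAt_snd
  have hsurj : Θ'.range = ⊤ := by
    have hinj : Function.Injective ((G' : V →ₗ[ℂ] ℂ).prod (L0 : V →ₗ[ℂ] (Fin r → ℂ))) := by
      rw [← LinearMap.ker_eq_bot, LinearMap.ker_eq_bot']
      intro v hv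
      have h1 := congrArg Prod.fst hv
      have h2 := congrArg Prod.snd hv
      exact hJ v h1 (fun j => congrFun h2 j)
    have hs : Function.Surjective ((G' : V →ₗ[ℂ] ℂ).prod (L0 : V →ₗ[ℂ] (Fin r → ℂ))) :=
      (LinearMap.injective_iff_surjective_of_finrank_eq_finrank (by simp [hV, add_comm])).mp hinj
    rw [eq_top_iff]
    rintro ⟨a, b, c⟩ -
    obtain ⟨v, hv⟩ := hs (a, b)
    have h1 := congrArg Prod.fst hv
    have h2 := congrArg Prod.snd hv
    exact ⟨(v, c), Prod.ext h1 (Prod.ext h2 rfl)⟩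
  have hmap := hΘ.map_nhds_eq_of_surj hsurj
  have hU' : Prod.fst ⁻¹' U ∈ 𝓝 (p0, AJ) := continuous_fst.continuousAt.preimage_mem_nhds hU
  have h3 : Θ '' (Prod.fst ⁻¹' U) ∈ 𝓝 (Θ (p0, AJ)) := by
    rw [← hmap]; exact Filter.image_mem_map hU'
  obtain ⟨ε, hε, hball⟩ := Metric.mem_nhds_iff.mp h3
  have hΘ0 : Θ (p0, AJ) = (0, 0, AJ) := by
    simp only [Θ, hG0, hl0, mul_zero, Finset.sum_const_zero]; rfl
  refine ⟨ε, hε, ε, hε, fun A' hA' τ hτ => ?_⟩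
  have hmem : ((0 : ℂ), τ, A') ∈ Metric.ball (Θ (p0, AJ)) ε := by
    rw [hΘ0, Metric.mem_ball, Prod.dist_eq, Prod.dist_eq]
    refine max_lt (by simpa using hε) (max_lt ?_ ?_)
    · rw [dist_pi_lt_iff hε]; intro j; simpa using hτ j
    · rw [dist_pi_lt_iff hε]; intro j; rw [dist_pi_lt_iff hε]; intro i
      rw [dist_eq_norm]; exact hA' j i
  obtain ⟨⟨p, A''⟩, hp, he⟩ := hball hmem
  have e1 := congrArg Prod.fst he
  have e2 := congrArg (fun q => q.2.1) he
  have e3 := congrArg (fun q => q.2.2) he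
  simp only [Θ] at e1 e2 e3
  subst e3
  exact ⟨p, hp, e1, fun j => congrFun e2 j⟩

end B2

/-! ## Cover -/
section B3
open Topology MvPolynomial

theorem mv_strict {k σ : Type*} [Field k] [Algebra k ℂ] [Fintype σ] (f : MvPolynomial σ k) (p0 : σ → ℂ) :
    HasStrictFDerivAt (fun p : σ → ℂ => aeval p f)
      (∑ i, (aeval p0 (pderiv i f)) • ContinuousLinearMap.proj (R := ℂ) (φ := fun _ : σ => ℂ) i) p0 := by
  classical
  induction f using MvPolynomial.induction_on with
  | C a =>
    have h0 : (∑ i : σ, (aeval p0 (pderiv i (C a : MvPolynomial σ k))) •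
        ContinuousLinearMap.proj (R := ℂ) (φ := fun _ : σ => ℂ) i) = 0 := by
      refine ContinuousLinearMap.ext fun q => ?_
      simp
    rw [h0]
    simp only [aeval_C]
    exact hasStrictFDerivAt_const (𝕜 := ℂ) (algebraMap k ℂ a) p0
  | add f g hf hg =>
    simp only [map_add]
    refine (hf.fun_add hg).congr_fderiv ?_
    refine ContinuousLinearMap.ext fun q => ?_
    simp [add_mul, Finset.sum_add_distrib]
  | mul_X f i hf =>
    have h1 : HasStrictFDerivAt (fun p : σ → ℂ => p i) (ContinuousLinearMap.proj (R := ℂ) (φ := fun _ : σ => ℂ) i) p0 :=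
      (ContinuousLinearMap.proj (R := ℂ) (φ := fun _ : σ => ℂ) i).hasStrictFDerivAt
    have := hf.fun_mul h1
    simp only [map_mul, aeval_X]
    refine this.congr_fderiv ?_
    refine ContinuousLinearMap.ext fun q => ?_
    simp [Derivation.leibniz, pderiv_X, Pi.single_apply, add_mul, Finset.sum_add_distrib, Finset.mul_sum]
    simp [apply_ite (aeval p0), ite_mul, mul_ite, mul_assoc]

theorem mv_der {k σ F M : Type*} [Field k] [Field F] [Algebra k F] [AddCommGroup M] [Module F M] [Module k M]
    [IsScalarTower k F M] [Fintype σ] (d : Derivation k F M) (f : MvPolynomial σ k) (p : σ → F) :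
    d (aeval p f) = ∑ i, aeval p (pderiv i f) • d (p i) := by
  classical
  induction f using MvPolynomial.induction_on with
  | C a => simp
  | add f g hf hg => simp [add_smul, Finset.sum_add_distrib, hf, hg]
  | mul_X f i hf =>
    rw [map_mul, Derivation.leibniz, hf, aeval_X]
    simp only [Derivation.leibniz, pderiv_X, map_add, add_smul, Finset.sum_add_distrib, smul_eq_mul, map_mul, aeval_X, mul_smul,
      Finset.smul_sum]
    congr 1
    rw [Finset.sum_eq_single i]
    · simp
    · intro j _ hj; simp [Pi.single_apply, hj.symm]
    · simp

theorem ax_vec {k F M : Type*} [Field k] [CharZero k] [Field F] [Algebra k F] [AddCommGroup M] [Module F M] [Module k M]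
    [IsScalarTower k F M]
    [Algebra.EssFiniteType k F] {n s r : ℕ} (hr : Algebra.trdeg k F = r)
    (x : Fin n → F) (hx : ∀ i, x i ≠ 0) (A : Fin s → Fin n → k) (hA : LinearIndependent k A)
    (hc : MCond k x s r) (d : Derivation k F M)
    (hd : ∀ j, ∑ i, A j i • ld d (x i) = 0) : d = 0 := by
  ext y
  rw [Derivation.zero_apply, ← Module.forall_dual_apply_eq_zero_iff F]
  intro φ
  have hD : φ.compDer d = 0 := by
    apply ax_main hr x hx A hA hc
    intro j
    have h1 : ∀ i, ld (φ.compDer d) (x i) = φ (ld d (x i)) := by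
      intro i; simp [ld]
    have := congrArg φ (hd j)
    rw [map_sum, map_zero] at this
    rw [← this]
    refine Finset.sum_congr rfl fun i _ => ?_
    rw [h1, ← algebraMap_smul F (A j i) (ld d (x i)), map_smul, smul_eq_mul]
  exact DFunLike.congr_fun hD y

theorem isAlg_map {k F Ω : Type*} [Field k] [Field F] [Field Ω] [Algebra k F] [Algebra k Ω] (σ : F →ₐ[k] Ω)
    {ι : Type*} (v : ι → F) {y : F} (hy : IsAlgebraic (IntermediateField.adjoin k (Set.range v)) y) :
    IsAlgebraic (IntermediateField.adjoin k (Set.range fun i => σ (v i))) (σ y) := by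
  obtain ⟨f, hf, hfy⟩ := hy
  have hmem : ∀ w ∈ IntermediateField.adjoin k (Set.range v), σ w ∈ IntermediateField.adjoin k (Set.range fun i => σ (v i)) := by
    have : IntermediateField.adjoin k (Set.range v) ≤ (IntermediateField.adjoin k (Set.range fun i => σ (v i))).comap σ := by
      rw [IntermediateField.adjoin_le_iff]
      rintro _ ⟨i, rfl⟩
      exact IntermediateField.subset_adjoin _ _ ⟨i, rfl⟩
    exact fun w hw => this hw
  let ψ : IntermediateField.adjoin k (Set.range v) →+* IntermediateField.adjoin k (Set.range fun i => σ (v i)) :=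
    ((σ : F →+* Ω).comp (algebraMap (IntermediateField.adjoin k (Set.range v)) F)).codRestrict
      (IntermediateField.adjoin k (Set.range fun i => σ (v i))) (fun w => hmem _ w.2)
  refine ⟨f.map ψ, (Polynomial.map_ne_zero_iff ψ.injective).mpr hf, ?_⟩
  rw [Polynomial.aeval_def, Polynomial.eval₂_map]
  have := congrArg σ hfy
  rw [map_zero, Polynomial.aeval_def, ← AlgHom.coe_toRingHom, Polynomial.hom_eval₂] at this
  exact this

theorem map_mono {n : ℕ} {F Ω : Type*} [Field F] [Field Ω] (σ : F →+* Ω) (x : Fin n → F) (b : Fin n → ℤ) :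
    σ (mono x b) = mono (fun i => σ (x i)) b := by
  simp [mono]

theorem MCond.of_map {k F Ω : Type*} [Field k] [Field F] [Field Ω] [Algebra k F] [Algebra k Ω] (σ : F →ₐ[k] Ω)
    {n s r : ℕ} (x : Fin n → F) (h : MCond k (fun i => σ (x i)) s r) : MCond k x s r := by
  intro B ρ β hβ hi ha hρ
  have e : ∀ b, mono (fun i => σ (x i)) b = σ (mono x b) := fun b => (map_mono (σ : F →+* Ω) x b).symm
  refine h B ρ β hβ ?_ ?_ hρ
  · simp only [e]
    exact hi.map' σ.injective
  · intro b hb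
    have e' : (fun i => mono (fun i => σ (x i)) (β i)) = fun i => σ (mono x (β i)) := funext fun i => e _
    rw [e b, e']
    exact isAlg_map σ _ (ha b hb)

end B3

/-! ## Cover -/
section B4
open Cardinal Topology MvPolynomial
theorem isAlg_adjoin_iff {k Ω : Type*} [Field k] [Field Ω] [Algebra k Ω] (S : Set Ω) (y : Ω) :
    IsAlgebraic (IntermediateField.adjoin k S) y ↔ IsAlgebraic (Algebra.adjoin k S) y := by
  open scoped IntermediateField.algebraAdjoinAdjoin in
  exact (IsFractionRing.isAlgebraic_iff (Algebra.adjoin k S) (IntermediateField.adjoin k S) Ω).symm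

theorem algIndep_exchange {k : Type*} {Ω : Type} [Field k] [Field Ω] [Algebra k Ω] {r : ℕ} (z f : Fin r → Ω)
    (hf : AlgebraicIndependent k f)
    (h : ∀ j, IsAlgebraic (IntermediateField.adjoin k (Set.range z)) (f j)) : AlgebraicIndependent k z := by
  set K := IntermediateField.adjoin k (Set.range z) with hK
  let L : IntermediateField k Ω := (algebraicClosure K Ω).restrictScalars k
  have hLmem : ∀ y, y ∈ L ↔ IsAlgebraic K y := fun y => mem_algebraicClosure_iff
  let z' : Fin r → L := fun i => ⟨z i, (hLmem _).mpr (isAlgebraic_algebraMap (⟨z i, IntermediateField.subset_adjoin _ _ ⟨i, rfl⟩⟩ : K))⟩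
  let f' : Fin r → L := fun i => ⟨f i, (hLmem _).mpr (h i)⟩
  have hf' : AlgebraicIndependent k f' := by
    have : f = L.val ∘ f' := rfl
    rw [this] at hf
    exact hf.of_comp L.val
  haveI : Algebra.IsAlgebraic (Algebra.adjoin k (Set.range z')) L := by
    constructor
    intro y
    rw [← isAlg_adjoin_iff]
    obtain ⟨g, hg, hgy⟩ := (hLmem _).mp y.2
    have hKle : ∀ w ∈ K, ∃ h : w ∈ L, (⟨w, h⟩ : L) ∈ IntermediateField.adjoin k (Set.range z') := by
      have : K ≤ (IntermediateField.adjoin k (Set.range z')).map L.val := by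
        rw [hK, IntermediateField.adjoin_le_iff]
        rintro _ ⟨i, rfl⟩
        exact ⟨z' i, IntermediateField.subset_adjoin _ _ ⟨i, rfl⟩, rfl⟩
      intro w hw
      obtain ⟨u, hu, rfl⟩ := this hw
      exact ⟨u.2, hu⟩
    let ψ : K →+* IntermediateField.adjoin k (Set.range z') :=
      { toFun := fun w => ⟨⟨w, (hKle w w.2).1⟩, (hKle w w.2).2⟩
        map_one' := rfl
        map_mul' := fun _ _ => rfl
        map_zero' := rfl
        map_add' := fun _ _ => rfl }
    refine ⟨g.map ψ, (Polynomial.map_ne_zero_iff ψ.injective).mpr hg, ?_⟩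
    apply L.val.injective
    rw [map_zero, Polynomial.aeval_def, Polynomial.eval₂_map, ← RingHom.coe_coe, Polynomial.hom_eval₂]
    exact hgy
  have hle : Cardinal.lift.{0} (Cardinal.mk (Fin r)) ≤ Cardinal.lift.{0} (Algebra.trdeg k L) := by
    simpa using hf'.cardinalMk_le_trdeg
  have := Algebra.IsAlgebraic.isTranscendenceBasis_of_le_trdeg_of_finite k z' (by simpa using hle)
  exact this.1.map' (f := L.val) L.val.injective


theorem cover {k : Type} [Field k] [CharZero k] [Algebra k ℂ] {n s r : ℕ} (x : Fin n → ℂ)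
    (hx : ∀ i, x i ≠ 0) (hr : Algebra.trdeg k (IntermediateField.adjoin k (Set.range x)) = r)
    (A : Fin s → Fin n → k) (hA : LinearIndependent k A) (hc : MCond k x s r) :
    ∃ J : Fin r → Fin s, ∃ c > 0, ∃ η > 0, ∀ A' : Fin r → Fin n → ℂ,
      (∀ j i, ‖A' j i - algebraMap k ℂ (A (J j) i)‖ < η) → ∀ τ : Fin r → ℂ, (∀ j, ‖τ j‖ < c) →
      ∃ x' : Fin n → ℂ, (∀ i, x' i ≠ 0) ∧ (∀ j, ∑ i, A' j i * Complex.log (x' i / x i) = τ j) ∧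
        ((∃ f' : Fin r → ℂ, AlgebraicIndependent k f' ∧
            ∀ j, f' j ∈ IntermediateField.adjoin k (Set.range x')) →
          ∃ θ : IntermediateField.adjoin k (Set.range x) →ₐ[k] ℂ,
            ∀ i (h : x i ∈ IntermediateField.adjoin k (Set.range x)), θ ⟨x i, h⟩ = x' i) := by
  classical
  set F := IntermediateField.adjoin k (Set.range x) with hF
  haveI : Algebra.EssFiniteType k F := by
    rw [IntermediateField.essFiniteType_iff]
    exact IntermediateField.fg_adjoin_of_finite (Set.finite_range x)
  have hxF : ∀ i, x i ∈ F := fun i => IntermediateField.subset_adjoin _ _ ⟨i, rfl⟩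
  let ξ : Fin n → F := fun i => ⟨x i, hxF i⟩
  have hξ0 : ∀ i, ξ i ≠ 0 := fun i h => hx i (congrArg Subtype.val h)
  have hcF : MCond k ξ s r := MCond.of_map F.val ξ hc
  obtain ⟨p, G, lead, hTB, htop, hG0, hGd, hlead, hemb⟩ := emb_exists hr
  have hNQ : ∀ i, ∃ N Q : MvPolynomial (Option (Fin r)) k, ξ i = aeval p N / aeval p Q := by
    intro i
    rw [← IntermediateField.mem_adjoin_range_iff, htop]; trivial
  choose N Q hNQ using hNQ
  have hN0 : ∀ i, aeval p (N i) ≠ 0 := by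
    intro i h; apply hξ0 i; rw [hNQ, h, zero_div]
  have hQ0 : ∀ i, aeval p (Q i) ≠ 0 := by
    intro i h; apply hξ0 i; rw [hNQ, h, div_zero]
  let p0 : Option (Fin r) → ℂ := fun o => (p o : ℂ)
  have hcoe : ∀ f : MvPolynomial (Option (Fin r)) k, aeval p0 f = ((aeval p f : F) : ℂ) := by
    intro f
    exact (MvPolynomial.comp_aeval_apply p F.val f).symm
  have hne : ∀ f : MvPolynomial (Option (Fin r)) k, aeval p f ≠ 0 → aeval p0 f ≠ 0 := by
    intro f hf h
    rw [hcoe] at h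
    exact hf (Subtype.ext h)
  let Nf : Fin n → (Option (Fin r) → ℂ) → ℂ := fun i q => aeval q (N i)
  let Qf : Fin n → (Option (Fin r) → ℂ) → ℂ := fun i q => aeval q (Q i)
  let der : MvPolynomial (Option (Fin r)) k → ((Option (Fin r) → ℂ) →L[ℂ] ℂ) := fun f =>
    ∑ i, (aeval p0 (pderiv i f)) • ContinuousLinearMap.proj (R := ℂ) (φ := fun _ : Option (Fin r) => ℂ) i
  have hder : ∀ f v, der f v = ∑ i, aeval p0 (pderiv i f) * v i := by intro f v; simp [der]
  have hxi : ∀ i, Nf i p0 / Qf i p0 = x i := by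
    intro i
    have := congrArg Subtype.val (hNQ i)
    simp only [Nf, Qf, hcoe]
    exact this.symm
  let l : Fin n → (Option (Fin r) → ℂ) → ℂ := fun i q => Complex.log (Nf i q * (Qf i q)⁻¹ * (x i)⁻¹)
  let l' : Fin n → (Option (Fin r) → ℂ) →L[ℂ] ℂ := fun i =>
    (Nf i p0)⁻¹ • der (N i) - (Qf i p0)⁻¹ • der (Q i)
  have hone : ∀ i, Nf i p0 * (Qf i p0)⁻¹ * (x i)⁻¹ = 1 := by
    intro i; rw [← div_eq_mul_inv (Nf i p0), hxi, mul_inv_cancel₀ (hx i)]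
  have hl : ∀ i, HasStrictFDerivAt (l i) (l' i) p0 := by
    intro i
    have h1 : HasStrictFDerivAt (Nf i) (der (N i)) p0 := mv_strict (N i) p0
    have h2 : HasStrictFDerivAt (Qf i) (der (Q i)) p0 := mv_strict (Q i) p0
    have hq := hne _ (hQ0 i)
    have hn := hne _ (hN0 i)
    have h3 := (hasStrictDerivAt_inv (x := Qf i p0) hq).comp_hasStrictFDerivAt p0 h2
    have h4 := ((h1.fun_mul h3).mul_const (x i)⁻¹).clog (by
      show Nf i p0 * (Qf i p0)⁻¹ * (x i)⁻¹ ∈ _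
      rw [hone]; exact Complex.one_mem_slitPlane)
    refine h4.congr_fderiv ?_
    refine ContinuousLinearMap.ext fun v => ?_
    have hn' : Nf i p0 ≠ 0 := hn
    have hq' : Qf i p0 ≠ 0 := hq
    have hxx := hx i
    simp [l', hone]
    rw [← hxi i]
    field_simp
    ring
  have hker : ∀ v, der G v = 0 → (∀ j, ∑ i, algebraMap k ℂ (A j i) * l' i v = 0) → v = 0 := by
    intro v hv hA0
    obtain ⟨d, hd⟩ := exists_derivation_of_isTranscendenceBasis (k := k) (M := ℂ) (p ∘ some) hTB (fun i => v (some i))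
    have hdG : d (aeval p G) = 0 := by rw [hG0, map_zero]
    have hdp : ∀ o, d (p o) = v o := by
      have hsome : ∀ i, d (p (some i)) = v (some i) := hd
      rintro (_ | i)
      · rw [mv_der, Fintype.sum_option] at hdG
        rw [hder, Fintype.sum_option] at hv
        have h1 : aeval p (pderiv none G) • d (p none) = aeval p0 (pderiv none G) * v none := by
          rw [eq_neg_of_add_eq_zero_left hdG, eq_neg_of_add_eq_zero_left hv]
          congr 1
          refine Finset.sum_congr rfl fun i _ => ?_
          rw [hsome, hcoe]; rfl
        rw [hcoe] at h1
        have h2 : ((aeval p (pderiv none G) : F) : ℂ) ≠ 0 := fun h => hGd (Subtype.ext h)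
        exact mul_left_cancel₀ h2 h1
      · exact hsome i
    have hdf : ∀ f, d (aeval p f) = der f v := by
      intro f
      rw [mv_der, hder]
      refine Finset.sum_congr rfl fun i _ => ?_
      rw [hdp, hcoe]; rfl
    have hld : ∀ i, ld d (ξ i) = l' i v := by
      intro i
      rw [hNQ, ld_div _ (hN0 i) (hQ0 i)]
      simp only [ld, hdf, l', Nf, Qf, hcoe]
      rfl
    have hd0 : d = 0 := by
      refine ax_vec hr ξ hξ0 A hA hcF d fun j => ?_
      rw [← hA0 j]
      refine Finset.sum_congr rfl fun i _ => ?_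
      rw [hld, Algebra.smul_def]
    funext o
    rw [← hdp o, hd0]; rfl
  have hGp0 : aeval p0 G = 0 := by rw [hcoe, hG0]; rfl
  have hder0 : der G ≠ 0 := by
    intro h
    have h1 := hder G (Pi.single none 1)
    rw [h, Fintype.sum_option] at h1
    simp at h1
    exact hne _ hGd h1.symm
  obtain ⟨J, hJ⟩ := an_open (r := r) (by simp) p0 (fun q => aeval q G) (der G) (mv_strict G p0) hGp0 hder0
    l l' hl (fun i => by simp only [l]; rw [hone, Complex.log_one]) (fun j i => algebraMap k ℂ (A j i)) hker
  have hcont : ∀ f : MvPolynomial (Option (Fin r)) k, ContinuousAt (fun q : Option (Fin r) → ℂ => aeval q f) p0 :=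
    fun f => (mv_strict f p0).continuousAt
  have hU : ∀ᶠ q in 𝓝 p0, (∀ i, Nf i q ≠ 0) ∧ (∀ i, Qf i q ≠ 0) ∧ aeval (q ∘ some) lead ≠ 0 := by
    have e1 : ∀ᶠ q in 𝓝 p0, ∀ i, Nf i q ≠ 0 :=
      Filter.eventually_all.mpr fun i => (hcont (N i)).eventually_ne (hne _ (hN0 i))
    have e2 : ∀ᶠ q in 𝓝 p0, ∀ i, Qf i q ≠ 0 :=
      Filter.eventually_all.mpr fun i => (hcont (Q i)).eventually_ne (hne _ (hQ0 i))
    have e3 : ∀ᶠ q in 𝓝 p0, aeval q (rename some lead) ≠ 0 := by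
      refine (hcont _).eventually_ne (hne _ ?_)
      rw [aeval_rename]
      intro h
      exact hlead (hTB.1 (by rw [h, map_zero]))
    filter_upwards [e1, e2, e3] with q h1 h2 h3
    refine ⟨h1, h2, ?_⟩
    rwa [aeval_rename] at h3
  obtain ⟨c, hc0, η, hη, hmain⟩ := hJ _ hU
  refine ⟨J, c, hc0, η, hη, fun A' hA' τ hτ => ?_⟩
  obtain ⟨q, ⟨hqN, hqQ, hql⟩, hqG, hqτ⟩ := hmain A' hA' τ hτ
  refine ⟨fun i => Nf i q / Qf i q, fun i => div_ne_zero (hqN i) (hqQ i), ?_, ?_⟩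
  · intro j
    rw [← hqτ j]
    refine Finset.sum_congr rfl fun i _ => ?_
    simp only [l, div_eq_mul_inv]
  · rintro ⟨f', hf', hmem⟩
    obtain ⟨halg, hθ⟩ := hemb q hqG
    have hal := halg hql
    set K := IntermediateField.adjoin k (Set.range (q ∘ some)) with hK
    let L : IntermediateField k ℂ := (algebraicClosure K ℂ).restrictScalars k
    have hLmem : ∀ y, y ∈ L ↔ IsAlgebraic K y := fun y => mem_algebraicClosure_iff
    have hqL : ∀ o, q o ∈ L := by
      rintro (_ | i)
      · exact (hLmem _).mpr hal
      · exact (hLmem _).mpr (isAlgebraic_algebraMap (⟨q (some i), IntermediateField.subset_adjoin _ _ ⟨i, rfl⟩⟩ : K))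
    have hle : IntermediateField.adjoin k (Set.range fun i => Nf i q / Qf i q) ≤ L := by
      rw [IntermediateField.adjoin_le_iff]
      rintro _ ⟨i, rfl⟩
      exact div_mem (mvaeval_mem_if L hqL _) (mvaeval_mem_if L hqL _)
    have hind := algIndep_exchange (q ∘ some) f' hf' (fun j => (hLmem _).mp (hle (hmem j)))
    obtain ⟨θ, hθ⟩ := hθ hind
    refine ⟨θ, fun i h => ?_⟩
    have e : (⟨x i, h⟩ : F) = aeval p (N i) / aeval p (Q i) := hNQ i
    have e2 : ∀ f : MvPolynomial (Option (Fin r)) k, θ (aeval p f) = aeval q f := by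
      intro f
      rw [MvPolynomial.comp_aeval_apply]
      congr 2
      funext o
      exact hθ o
    rw [e, map_div₀, e2, e2]

end B4

/-! ## Lower bound -/
section B5
open Cardinal Topology MvPolynomial

theorem exists_algIndep_nhds {k : Type} [Field k] [Countable k] [Algebra k ℂ] : ∀ {r : ℕ} (u : Fin r → ℂ)
    (U : Fin r → Set ℂ), (∀ j, U j ∈ 𝓝 (u j)) → ∃ g : Fin r → ℂ, AlgebraicIndependent k g ∧ ∀ j, g j ∈ U j
  | 0, u, U, _ => ⟨u, by
      exact (algebraicIndependent_empty_type_iff (R := k)).mpr (algebraMap k ℂ).injective, fun j => j.elim0⟩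
  | r + 1, u, U, h => by
    obtain ⟨g, hg, hgU⟩ := exists_algIndep_nhds (k := k) (fun j : Fin r => u j.succ) (fun j => U j.succ) (fun j => h j.succ)
    haveI : Countable (MvPolynomial (Fin r) k) := by
      rw [← Cardinal.mk_le_aleph0_iff]
      refine MvPolynomial.cardinalMk_le_max.trans (max_le (max_le ?_ ?_) le_rfl) <;> exact Cardinal.mk_le_aleph0
    haveI : Countable (Algebra.adjoin k (Set.range g)) := by
      rw [Algebra.adjoin_range_eq_range_aeval]
      exact (Set.countable_range (aeval (R := k) g)).to_subtype
    have hc : Set.Countable {y : ℂ | IsAlgebraic (Algebra.adjoin k (Set.range g)) y} := Algebraic.countable _ _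
    have hd := hc.dense_compl ℝ
    obtain ⟨y, hy, hyU⟩ := mem_closure_iff_nhds.mp (hd (u 0)) _ (h 0)
    have ht : Transcendental (Algebra.adjoin k (Set.range g)) y := hyU
    have := (hg.option_iff_transcendental y).mpr ht
    refine ⟨Fin.cons y g, ?_, ?_⟩
    · have h2 := this.comp (finSuccEquiv r) (finSuccEquiv r).injective
      convert h2 using 1
      funext j
      refine Fin.cases ?_ (fun j => ?_) j <;> simp
    · intro j
      refine Fin.cases ?_ (fun j => ?_) j
      · simpa using hy
      · simpa using hgU j

theorem exists_char_pts {ι : Type} [Fintype ι] {n : ℕ} {L : Type*} [Field L] (y : ι → Fin n → L)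
    (hy0 : ∀ κ i, y κ i ≠ 0) (hy : Function.Injective y) :
    ∃ m : ι → Fin n → ℤ, ∀ c : ι → L, (∀ κ, ∑ a, c a * mono (y κ) (m a) = 0) → c = 0 := by
  classical
  let χ : ι → (Multiplicative (Fin n → ℤ) →* L) := fun κ =>
    { toFun := fun b => mono (y κ) b.toAdd
      map_one' := mono_zero _
      map_mul' := fun a b => mono_add (hy0 κ) _ _ }
  have hχ : Function.Injective χ := by
    intro κ κ' h
    apply hy
    funext i
    have := DFunLike.congr_fun h (Multiplicative.ofAdd (Pi.single i 1))
    have e : ∀ z : Fin n → L, mono z (Pi.single i 1) = z i := by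
      intro z
      rw [mono, Finset.prod_eq_single i]
      · simp
      · intro j _ hj; simp [Pi.single_eq_of_ne hj]
      · simp
    have h1 : mono (y κ) (Pi.single i 1) = mono (y κ') (Pi.single i 1) := this
    rwa [e, e] at h1
  have hli : LinearIndependent L (fun κ => (χ κ : Multiplicative (Fin n → ℤ) → L)) :=
    (linearIndependent_monoidHom (Multiplicative (Fin n → ℤ)) L).comp χ hχ
  let v : (Fin n → ℤ) → (ι → L) := fun m κ => mono (y κ) m
  have hspan : Submodule.span L (Set.range v) = ⊤ := by
    by_contra hne
    obtain ⟨f, hf0, hf⟩ := Submodule.exists_le_ker_of_lt_top _ (lt_top_iff_ne_top.mpr hne)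
    apply hf0
    have hz : ∀ m, f (v m) = 0 := fun m => hf (Submodule.subset_span ⟨m, rfl⟩)
    have h3 : (∑ κ, f (Pi.single κ 1) • (fun b => χ κ b : Multiplicative (Fin n → ℤ) → L)) = 0 := by
      funext b
      have := hz b.toAdd
      rw [pi_eq_sum_univ' (v b.toAdd), map_sum] at this
      simp only [map_smul] at this
      simp only [Finset.sum_apply, Pi.smul_apply, smul_eq_mul, Pi.zero_apply]
      rw [← this]
      refine Finset.sum_congr rfl fun κ _ => ?_
      rw [smul_eq_mul, mul_comm]
      congr 2
    have h4 := Fintype.linearIndependent_iff.mp hli _ h3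
    apply LinearMap.pi_ext'
    intro κ
    apply LinearMap.ext_ring
    simpa using h4 κ
  obtain ⟨κ', a, ha, hs, hl⟩ := exists_linearIndependent' L v
  rw [hspan] at hs
  let b := Module.Basis.mk hl hs.ge
  haveI : Fintype κ' := Module.Basis.fintypeIndexOfRankLtAleph0 b (by
    simpa using Cardinal.nat_lt_aleph0 _)
  have hcard : Fintype.card ι = Fintype.card κ' := by
    rw [← Module.finrank_eq_card_basis b, Module.finrank_fintype_fun_eq_card]
  let eq := Fintype.equivOfCardEq hcard
  refine ⟨fun i => a (eq i), fun c hc => ?_⟩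
  have hl2 := hl.comp eq eq.injective
  have := Fintype.linearIndependent_iff.mp hl2 c (by
    funext κ
    have := hc κ
    simpa [v] using this)
  funext i; exact this i

theorem mono_exp {n : ℕ} (x x' : Fin n → ℂ) (hx : ∀ i, x i ≠ 0) (hx' : ∀ i, x' i ≠ 0) (b : Fin n → ℤ) :
    mono x' b = mono x b * Complex.exp (∑ i, b i * Complex.log (x' i / x i)) := by
  rw [Complex.exp_sum, mono, mono, ← Finset.prod_mul_distrib]
  refine Finset.prod_congr rfl fun i _ => ?_
  rw [Complex.exp_int_mul, Complex.exp_log (div_ne_zero (hx' i) (hx i)), ← mul_zpow, mul_div_cancel₀ _ (hx i)]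

theorem mono_sum {n : ℕ} {F : Type*} [Field F] {x : Fin n → F} (hx : ∀ i, x i ≠ 0) {ι : Type*} (S : Finset ι)
    (b : ι → Fin n → ℤ) : mono x (∑ j ∈ S, b j) = ∏ j ∈ S, mono x (b j) := by
  classical
  induction S using Finset.induction_on with
  | empty => simp [mono_zero]
  | insert a S ha ih => rw [Finset.sum_insert ha, Finset.prod_insert ha, mono_add hx, ih]

theorem mono_nsmul {n : ℕ} {F : Type*} [Field F] {x : Fin n → F} 
    (b : Fin n → ℤ) (c : ℕ) : mono x (c • b) = mono x b ^ c := by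
  simp only [mono, ← Finset.prod_pow]
  refine Finset.prod_congr rfl fun i _ => ?_
  rw [Pi.smul_apply, nsmul_eq_mul, mul_comm, zpow_mul, zpow_natCast]

theorem mono_mem {n : ℕ} {k Ω : Type*} [Field k] [Field Ω] [Algebra k Ω] (x : Fin n → Ω) (b : Fin n → ℤ)
    (K : IntermediateField k Ω) (h : ∀ i, x i ∈ K) : mono x b ∈ K :=
  prod_mem fun i _ => zpow_mem (h i) _

/-- many independent monomials near a lattice -/
theorem lower_q {k : Type} [Field k] [CharZero k] [Countable k] [Algebra k ℂ] {n s r : ℕ} (x : Fin n → ℂ)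
    (hx : ∀ i, x i ≠ 0) (hr : Algebra.trdeg k (IntermediateField.adjoin k (Set.range x)) = r)
    (A : Fin s → Fin n → k) (hA : LinearIndependent k A) (hc : MCond k x s r) :
    ∃ J : Fin r → Fin s, ∃ c > (0:ℝ), ∃ η > (0:ℝ), ∀ (q : ℕ) (_ : 0 < q) (b : Fin r → Fin n → ℤ),
      (∀ j i, ‖(b j i : ℂ) / q - algebraMap k ℂ (A (J j) i)‖ < η) → ∀ M : ℕ, (M : ℝ) * 8 ≤ c * q →
      ∃ m : (Fin r → Fin M) → Fin n → ℤ, ∀ K : ℕ,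
        LinearIndependent k (fun a : (Fin r → Fin M) × (Fin r → Fin K) =>
          mono x (m a.1 + ∑ j, (a.2 j : ℕ) • b j)) := by
  classical
  obtain ⟨J, c, hc0, η, hη, H⟩ := cover x hx hr A hA hc
  refine ⟨J, c, hc0, η, hη, fun q hq b hb M hM => ?_⟩
  have hq0 : (q : ℂ) ≠ 0 := by exact_mod_cast hq.ne'
  have H := H (fun j i => (b j i : ℂ) / q) hb
  -- value of monomials
  have hval : ∀ (x' : Fin n → ℂ) (τ : Fin r → ℂ), (∀ i, x' i ≠ 0) →
      (∀ j, ∑ i, (b j i : ℂ) / q * Complex.log (x' i / x i) = τ j) →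
      ∀ j, mono x' (b j) = mono x (b j) * Complex.exp (q * τ j) := by
    intro x' τ hx' h j
    rw [mono_exp x x' hx hx', ← h j, Finset.mul_sum]
    congr 3
    funext i
    field_simp
  have hxF : ∀ i, x i ∈ IntermediateField.adjoin k (Set.range x) :=
    fun i => IntermediateField.subset_adjoin _ _ ⟨i, rfl⟩
  -- step 1
  have hf : AlgebraicIndependent k (fun j => mono x (b j)) := by
    have hU : ∀ j, {g : ℂ | g ≠ 0 ∧ ‖Complex.log (g / mono x (b j)) / q‖ < c} ∈ 𝓝 (mono x (b j)) := by
      intro j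
      have h0 := mono_ne_zero hx (b j)
      have e1 : ∀ᶠ g in 𝓝 (mono x (b j)), g ≠ 0 := eventually_ne_nhds h0
      have hcont : ContinuousAt (fun g : ℂ => ‖Complex.log (g / mono x (b j)) / q‖) (mono x (b j)) := by
        apply ContinuousAt.norm
        apply ContinuousAt.div_const
        apply ContinuousAt.clog
        · exact continuousAt_id.div_const _
        · show mono x (b j) / mono x (b j) ∈ _
          rw [div_self h0]; exact Complex.one_mem_slitPlane
      have e2 := hcont.eventually_lt (continuousAt_const (y := c)) (by simpa [div_self h0] using hc0)
      filter_upwards [e1, e2] with g h1 h2 using ⟨h1, h2⟩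
    obtain ⟨g, hg, hgU⟩ := exists_algIndep_nhds (k := k) _ _ hU
    obtain ⟨x', hx', hlog, hθ⟩ := H (fun j => Complex.log (g j / mono x (b j)) / q) (fun j => (hgU j).2)
    have hgv : ∀ j, mono x' (b j) = g j := by
      intro j
      rw [hval x' _ hx' hlog j, mul_div_cancel₀ _ hq0, Complex.exp_log (div_ne_zero (hgU j).1 (mono_ne_zero hx _)),
        mul_div_cancel₀ _ (mono_ne_zero hx _)]
    obtain ⟨θ, hθ⟩ := hθ ⟨g, hg, fun j => hgv j ▸ mono_mem _ _ _
      (fun i => IntermediateField.subset_adjoin _ _ ⟨i, rfl⟩)⟩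
    let ξ : Fin n → IntermediateField.adjoin k (Set.range x) := fun i => ⟨x i, hxF i⟩
    have h1 : AlgebraicIndependent k (fun j => mono ξ (b j)) := by
      apply AlgebraicIndependent.of_comp θ
      have : (θ ∘ fun j => mono ξ (b j)) = g := by
        funext j
        rw [← hgv j, Function.comp]
        refine (map_mono θ.toRingHom ξ (b j)).trans ?_
        congr 1
        funext i; exact hθ i _
      rw [this]; exact hg
    have h2 := h1.map' (f := (IntermediateField.adjoin k (Set.range x)).val) Subtype.val_injective
    convert h2 using 1
    funext j
    exact (map_mono (IntermediateField.adjoin k (Set.range x)).val.toRingHom ξ (b j)).symm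
  -- step 2
  have hκ : ∀ κ : Fin r → Fin M, ∃ x' : Fin n → ℂ, (∀ i, x' i ≠ 0) ∧
      (∀ j, ∑ i, (b j i : ℂ) / q * Complex.log (x' i / x i) = 2 * Real.pi * Complex.I * (κ j : ℕ) / q) ∧
      ∃ θ : IntermediateField.adjoin k (Set.range x) →ₐ[k] ℂ, ∀ i h, θ ⟨x i, h⟩ = x' i := by
    intro κ
    obtain ⟨x', hx', hlog, hθ⟩ := H (fun j => 2 * Real.pi * Complex.I * (κ j : ℕ) / q) (fun j => by
      have h1 : ((κ j : ℕ) : ℝ) < M := by exact_mod_cast (κ j).2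
      have hqr : (0:ℝ) < q := by exact_mod_cast hq
      have h2 : ‖(2 * Real.pi * Complex.I * (κ j : ℕ) / q : ℂ)‖ = 2 * Real.pi * (κ j : ℕ) / q := by
        simp [abs_of_pos Real.pi_pos]
      rw [h2, div_lt_iff₀ hqr]
      have := Real.pi_lt_four
      have h3 : (0:ℝ) ≤ (κ j : ℕ) := Nat.cast_nonneg _
      nlinarith)
    refine ⟨x', hx', hlog, hθ ⟨_, hf, fun j => ?_⟩⟩
    have := hval x' _ hx' hlog j
    rw [mul_div_cancel₀ _ hq0, mul_comm _ ((κ j : ℕ) : ℂ), Complex.exp_nat_mul_two_pi_mul_I, mul_one] at this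
    rw [← this]
    exact mono_mem _ _ _ (fun i => IntermediateField.subset_adjoin _ _ ⟨i, rfl⟩)
  choose y hy0 hylog θ hθ using hκ
  have hyf : ∀ κ j, mono (y κ) (b j) = mono x (b j) := by
    intro κ j
    have := hval (y κ) _ (hy0 κ) (hylog κ) j
    rw [mul_div_cancel₀ _ hq0, mul_comm _ ((κ j : ℕ) : ℂ), Complex.exp_nat_mul_two_pi_mul_I, mul_one] at this
    exact this
  have hyinj : Function.Injective y := by
    intro κ κ' h
    funext j
    have h1 := hylog κ j
    rw [h, hylog κ' j, div_left_inj' hq0, mul_right_inj' Complex.two_pi_I_ne_zero] at h1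
    exact Fin.ext (by exact_mod_cast h1.symm)
  obtain ⟨m, hm⟩ := exists_char_pts y hy0 hyinj
  refine ⟨m, fun K => ?_⟩
  rw [Fintype.linearIndependent_iff]
  intro g hg
  let ξ : Fin n → IntermediateField.adjoin k (Set.range x) := fun i => ⟨x i, hxF i⟩
  have hξx : ∀ e, ((mono ξ e : IntermediateField.adjoin k (Set.range x)) : ℂ) = mono x e := fun e =>
    map_mono (IntermediateField.adjoin k (Set.range x)).val.toRingHom ξ e
  have hgF : ∑ a : (Fin r → Fin M) × (Fin r → Fin K), g a • mono ξ (m a.1 + ∑ j, (a.2 j : ℕ) • b j) = 0 := by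
    apply Subtype.val_injective
    rw [ZeroMemClass.coe_zero, ← hg, AddSubmonoidClass.coe_finset_sum]
    refine Finset.sum_congr rfl fun a _ => ?_
    rw [← hξx]; rfl
  have hmon : ∀ (z : Fin n → ℂ) (_ : ∀ i, z i ≠ 0) (μ : Fin n → ℤ) (t : Fin r → Fin K),
      mono z (μ + ∑ j, (t j : ℕ) • b j) = mono z μ * ∏ j, mono z (b j) ^ (t j : ℕ) := by
    intro z hz μ t
    rw [mono_add hz, mono_sum hz]
    simp only [mono_nsmul]
  have hz : (fun κ0 => ∑ t : Fin r → Fin K, algebraMap k ℂ (g (κ0, t)) * ∏ j, mono x (b j) ^ (t j : ℕ)) = 0 := by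
    apply hm
    intro κ
    have h1 := congrArg (θ κ) hgF
    rw [map_sum, map_zero, Fintype.sum_prod_type] at h1
    rw [← h1]
    refine Finset.sum_congr rfl fun κ0 _ => ?_
    rw [Finset.sum_mul]
    refine Finset.sum_congr rfl fun t _ => ?_
    rw [Algebra.smul_def, map_mul, AlgHom.commutes, show θ κ (mono ξ (m (κ0, t).1 + ∑ j, ((κ0, t).2 j : ℕ) • b j)) = mono (fun i => θ κ (ξ i)) _ from map_mono (θ κ).toRingHom ξ _]
    have : (fun i => θ κ (ξ i)) = y κ := by funext i; exact hθ κ i _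
    rw [this, hmon _ (hy0 κ)]
    simp only [hyf]
    ring
  rintro ⟨κ0, t0⟩
  have h2 := congrFun hz κ0
  simp only [Pi.zero_apply] at h2
  let ex : (Fin r → Fin K) → (Fin r →₀ ℕ) := fun t => Finsupp.equivFunOnFinite.symm fun j => (t j : ℕ)
  have hex : Function.Injective ex := by
    intro t t' h
    funext j
    exact Fin.ext (DFunLike.congr_fun h j)
  have h3 : (∑ t : Fin r → Fin K, MvPolynomial.monomial (ex t) (g (κ0, t))) = 0 := by
    apply hf
    rw [map_zero, map_sum, ← h2]
    refine Finset.sum_congr rfl fun t _ => ?_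
    rw [MvPolynomial.aeval_monomial, Finsupp.prod_fintype _ _ (fun _ => pow_zero _)]
    rfl
  have h4 := congrArg (MvPolynomial.coeff (ex t0)) h3
  rw [MvPolynomial.coeff_sum, Finset.sum_eq_single t0] at h4
  · simpa using h4
  · intro t _ ht
    rw [MvPolynomial.coeff_monomial, if_neg (fun h => ht (hex h))]
  · simp
end B5

/-! ## Lower bound, numeric form -/
section B6
open Cardinal Topology

theorem linIndep_transfer {k : Type} [Field k] [Algebra k ℂ] {n s : ℕ} (A : Fin s → Fin n → ℝ)
    (Ak : Fin s → Fin n → k) (hAk : ∀ j i, algebraMap k ℂ (Ak j i) = (A j i : ℂ))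
    (hA : LinearIndependent ℝ A) : LinearIndependent k Ak := by
  rw [Fintype.linearIndependent_iff] at hA ⊢
  intro g hg j
  have h : ∀ i, ∑ j, algebraMap k ℂ (g j) * (A j i : ℂ) = 0 := by
    intro i
    have := congrArg (algebraMap k ℂ) (congrFun hg i)
    simpa [hAk] using this
  have hre := hA (fun j => (algebraMap k ℂ (g j)).re) (by
    funext i
    have := congrArg Complex.re (h i)
    simpa using this) j
  have him := hA (fun j => (algebraMap k ℂ (g j)).im) (by
    funext i
    have := congrArg Complex.im (h i)
    simpa using this) j
  have : algebraMap k ℂ (g j) = 0 := Complex.ext hre him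
  exact (map_eq_zero _).mp this

set_option maxHeartbeats 1000000 in
theorem lower {k : Type} [Field k] [CharZero k] [Countable k] [Algebra k ℂ] {n s r : ℕ} (x : Fin n → ℂ)
    (hx : ∀ i, x i ≠ 0) (hr : Algebra.trdeg k (IntermediateField.adjoin k (Set.range x)) = r)
    (A : Fin s → Fin n → ℝ) (Ak : Fin s → Fin n → k) (hAk : ∀ j i, algebraMap k ℂ (Ak j i) = (A j i : ℂ))
    (hA : LinearIndependent ℝ A) (hc : MCond k x s r) :
    ∃ c > (0:ℝ), ∀ δ > (0:ℝ), ∀ T0 : ℕ, ∃ T : ℕ, T0 ≤ T ∧ ∃ (N : ℕ) (e : Fin N → Fin n → ℤ),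
      LinearIndependent k (fun a => mono x (e a)) ∧ (∀ a i, |(e a i : ℝ)| ≤ T) ∧
      (∀ a, ∃ t : Fin s → ℝ, (∀ j, |t j| ≤ T) ∧ ∀ i, |(e a i : ℝ) - ∑ j, t j * A j i| ≤ δ * T) ∧
      c * (T : ℝ) ^ r ≤ N := by
  classical
  obtain ⟨J, c, hc0, η, hη, H⟩ := lower_q x hx hr Ak (linIndep_transfer A Ak hAk hA) hc
  obtain ⟨C, hC⟩ : ∃ C : ℕ, ∀ j i, |A j i| ≤ C := by
    obtain ⟨C, hC⟩ := exists_nat_ge (∑ j, ∑ i, |A j i|)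
    refine ⟨C, fun j i => le_trans ?_ hC⟩
    refine le_trans (Finset.single_le_sum (f := fun i => |A j i|) (fun _ _ => abs_nonneg _) (Finset.mem_univ i)) ?_
    exact Finset.single_le_sum (f := fun j => ∑ i, |A j i|) (fun _ _ => Finset.sum_nonneg fun _ _ => abs_nonneg _)
      (Finset.mem_univ j)
  set R : ℕ := r * (C + 1) + 1 with hR
  have hRpos : (0:ℝ) < R := by positivity
  refine ⟨(c / 16 / R) ^ r, by positivity, fun δ hδ T0 => ?_⟩
  obtain ⟨q, hq⟩ := exists_nat_ge (16 / c + 1 / η + (r + 1) / δ + 1)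
  have p1 : 0 < 16 / c := by positivity
  have p2 : 0 < 1 / η := by positivity
  have p3 : 0 < ((r:ℝ) + 1) / δ := by positivity
  have hq0r : (0:ℝ) < q := by linarith
  have hq0 : 0 < q := by exact_mod_cast hq0r
  have hqc : 16 ≤ c * q := by
    have : 16 / c ≤ q := by linarith
    rw [div_le_iff₀ hc0] at this; linarith
  have hqη : 1 < η * q := by
    have : 1 / η < q := by linarith
    rw [div_lt_iff₀ hη] at this; linarith
  have hqδ : (r:ℝ) + 1 ≤ δ * q := by
    have : ((r:ℝ) + 1) / δ ≤ q := by linarith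
    rw [div_le_iff₀ hδ] at this; linarith
  let b : Fin r → Fin n → ℤ := fun j i => round (q * A (J j) i)
  have hb : ∀ j i, |(b j i : ℝ) - q * A (J j) i| ≤ 1 / 2 := fun j i => by
    rw [abs_sub_comm]; exact abs_sub_round _
  have hbη : ∀ j i, ‖(b j i : ℂ) / q - algebraMap k ℂ (Ak (J j) i)‖ < η := by
    intro j i
    rw [hAk]
    have e : (b j i : ℂ) / q - (A (J j) i : ℂ) = (((b j i : ℝ) - q * A (J j) i) / q : ℝ) := by
      have : (q : ℂ) ≠ 0 := by exact_mod_cast hq0.ne'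
      push_cast
      field_simp
    rw [e, Complex.norm_real, Real.norm_eq_abs, abs_div, abs_of_pos hq0r, div_lt_iff₀ hq0r]
    linarith [hb j i]
  let M : ℕ := ⌊c * q / 8⌋₊
  have hM1 : (M : ℝ) * 8 ≤ c * q := by
    have := Nat.floor_le (a := c * q / 8) (by positivity)
    linarith
  have hM2 : c / 16 * q ≤ M := by
    have := Nat.lt_floor_add_one (c * q / 8)
    have h2 : c * q / 8 < M + 1 := this
    linarith
  obtain ⟨m, hm⟩ := H q hq0 b hbη M hM1
  obtain ⟨mm, hmm⟩ : ∃ mm : ℕ, ∀ κ i, |(m κ i : ℝ)| ≤ mm := by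
    obtain ⟨C, hC⟩ := exists_nat_ge (∑ j, ∑ i, |(m j i : ℝ)|)
    refine ⟨C, fun j i => le_trans ?_ hC⟩
    refine le_trans (Finset.single_le_sum (f := fun i => |(m j i : ℝ)|) (fun _ _ => abs_nonneg _) (Finset.mem_univ i)) ?_
    exact Finset.single_le_sum (f := fun j => ∑ i, |(m j i : ℝ)|) (fun _ _ => Finset.sum_nonneg fun _ _ => abs_nonneg _)
      (Finset.mem_univ j)
  set K : ℕ := mm + T0 + 1 with hK
  have hKm : (mm : ℝ) ≤ K := by rw [hK]; push_cast; linarith [Nat.cast_nonneg (α := ℝ) T0]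
  let ι := (Fin r → Fin M) × (Fin r → Fin K)
  let eq : Fin (Fintype.card ι) ≃ ι := (Fintype.equivFin ι).symm
  let e : ι → Fin n → ℤ := fun a => m a.1 + ∑ j, (a.2 j : ℕ) • b j
  have hKq1 : (1:ℝ) ≤ q := by exact_mod_cast hq0
  have hRr : (R : ℝ) = r * (C + 1) + 1 := by rw [hR]; push_cast; ring
  have hTr : ((R * K * q : ℕ) : ℝ) = R * K * q := by push_cast; ring
  have hK0 : (0:ℝ) < K := by positivity
  have hcoord : ∀ a : ι, ∀ i, (e a i : ℝ) = m a.1 i + ∑ j, ((a.2 j : ℕ) : ℝ) * b j i := by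
    intro a i
    simp [e, Finset.sum_apply]
  have ht : ∀ (a : ι) j, ((a.2 j : ℕ) : ℝ) ≤ K := fun a j => by exact_mod_cast (a.2 j).2.le
  have hrC : (0:ℝ) ≤ C := Nat.cast_nonneg _
  have hrr : (0:ℝ) ≤ r := Nat.cast_nonneg _
  refine ⟨R * K * q, ?_, Fintype.card ι, fun u => e (eq u), (hm K).comp eq eq.injective, ?_, ?_, ?_⟩
  · calc T0 ≤ K := by omega
      _ ≤ R * K * q := by
        have : 1 ≤ R := by omega
        nlinarith [Nat.mul_le_mul this hq0, Nat.zero_le K]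
  · intro u i
    rw [hTr, hcoord]
    have hbb : ∀ j, |(b j i : ℝ)| ≤ q * (C + 1) := by
      intro j
      have h1 := hb j i
      have h2 : |(q:ℝ) * A (J j) i| ≤ q * C := by
        rw [abs_mul, abs_of_pos hq0r]; exact mul_le_mul_of_nonneg_left (hC _ _) hq0r.le
      have h3 := abs_sub_abs_le_abs_sub (b j i : ℝ) (q * A (J j) i)
      nlinarith
    have hs : |∑ j, (((eq u).2 j : ℕ) : ℝ) * b j i| ≤ r * (K * (q * (C + 1))) := by
      refine (Finset.abs_sum_le_sum_abs _ _).trans ?_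
      refine (Finset.sum_le_card_nsmul _ _ (K * (q * (C + 1) : ℝ)) fun j _ => ?_).trans ?_
      · rw [abs_mul, abs_of_nonneg (Nat.cast_nonneg _)]
        exact mul_le_mul (ht _ _) (hbb j) (abs_nonneg _) hK0.le
      · simp
    refine (abs_add_le _ _).trans ?_
    have := hmm (eq u).1 i
    rw [hRr]
    nlinarith
  · intro u
    refine ⟨fun j => ∑ i, if J i = j then (((eq u).2 i : ℕ) : ℝ) * q else 0, fun j => ?_, fun i => ?_⟩
    · rw [hTr, abs_of_nonneg (Finset.sum_nonneg fun i _ => by split_ifs <;> positivity)]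
      refine (Finset.sum_le_card_nsmul _ _ (K * q : ℝ) fun i _ => ?_).trans ?_
      · split_ifs
        · exact mul_le_mul_of_nonneg_right (ht _ _) hq0r.le
        · positivity
      · simp only [Finset.card_univ, Fintype.card_fin, nsmul_eq_mul]
        rw [hRr]
        have : (0:ℝ) < K * q := by positivity
        nlinarith [mul_nonneg (mul_nonneg hrr hrC) this.le]
    · have e1 : ∑ j, (∑ i', if J i' = j then (((eq u).2 i' : ℕ) : ℝ) * q else 0) * A j i
          = ∑ i', (((eq u).2 i' : ℕ) : ℝ) * q * A (J i') i := by
        simp only [Finset.sum_mul]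
        rw [Finset.sum_comm]
        refine Finset.sum_congr rfl fun i' _ => ?_
        rw [Finset.sum_eq_single (J i')]
        · simp
        · intro j _ hj; rw [if_neg (Ne.symm hj), zero_mul]
        · simp
      rw [e1, hcoord, add_sub_assoc, ← Finset.sum_sub_distrib, hTr]
      have hs : |∑ j, ((((eq u).2 j : ℕ) : ℝ) * b j i - (((eq u).2 j : ℕ) : ℝ) * q * A (J j) i)| ≤ r * K := by
        refine (Finset.abs_sum_le_sum_abs _ _).trans ?_
        refine (Finset.sum_le_card_nsmul _ _ (K : ℝ) fun j _ => ?_).trans ?_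
        · rw [mul_assoc, ← mul_sub, abs_mul, abs_of_nonneg (Nat.cast_nonneg _)]
          have := mul_le_mul (ht (eq u) j) ((hb j i).trans (by norm_num : (1/2:ℝ) ≤ 1)) (abs_nonneg _) hK0.le
          simpa using this
        · simp
      refine (abs_add_le _ _).trans ?_
      have := hmm (eq u).1 i
      have h5 : ((r:ℝ) + 1) * K ≤ δ * q * K := mul_le_mul_of_nonneg_right hqδ hK0.le
      have h6 : δ * q * K ≤ δ * (R * K * q) := by
        have : (1:ℝ) ≤ R := by rw [hRr]; nlinarith [mul_nonneg hrr hrC]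
        have h7 : 0 ≤ δ * q * K := by positivity
        nlinarith
      linarith
  · rw [hTr]
    have : Fintype.card ι = M ^ r * K ^ r := by simp [ι]
    rw [this]
    push_cast
    rw [← mul_pow, ← mul_pow]
    apply pow_le_pow_left₀ (by positivity)
    have : c / 16 / R * (R * K * q) = c / 16 * q * K := by field_simp
    rw [this]
    exact mul_le_mul_of_nonneg_right hM2 hK0.le
end B6

/-! ## Upper bound -/
section C1
open Pointwise

/-- polynomials of degree at most `N` in each variable -/
def polyLe (k : Type*) {F : Type*} [Field k] [Field F] [Algebra k F] {ρ : ℕ} (v : Fin ρ → F) (N : ℕ) :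
    Submodule k F := Submodule.span k (Set.range fun c : Fin ρ → Fin (N + 1) => ∏ j, v j ^ (c j : ℕ))

variable {k F : Type*} [Field k] [Field F] [Algebra k F] {ρ : ℕ} (v : Fin ρ → F)

theorem polyLe_mono {N M : ℕ} (h : N ≤ M) : polyLe k v N ≤ polyLe k v M := by
  refine Submodule.span_mono ?_
  rintro _ ⟨c, rfl⟩
  exact ⟨fun j => ⟨c j, by have := (c j).2; omega⟩, rfl⟩

theorem polyLe_mul (N M : ℕ) : polyLe k v N * polyLe k v M ≤ polyLe k v (N + M) := by
  rw [polyLe, polyLe, Submodule.span_mul_span]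
  refine Submodule.span_mono ?_
  rintro _ ⟨_, ⟨c, rfl⟩, _, ⟨c', rfl⟩, rfl⟩
  refine ⟨fun j => ⟨c j + c' j, by have := (c j).2; have := (c' j).2; omega⟩, ?_⟩
  simp [pow_add, Finset.prod_mul_distrib]

theorem one_mem_polyLe (N : ℕ) : (1 : F) ∈ polyLe k v N :=
  Submodule.subset_span ⟨fun _ => 0, by simp⟩

theorem exists_mem_polyLe {y : F} (hy : y ∈ Algebra.adjoin k (Set.range v)) : ∃ N, y ∈ polyLe k v N := by
  rw [Algebra.adjoin_range_eq_range_aeval] at hy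
  obtain ⟨p, rfl⟩ := hy
  refine ⟨p.totalDegree, ?_⟩
  show MvPolynomial.aeval v p ∈ _
  rw [MvPolynomial.aeval_def, MvPolynomial.eval₂_eq]
  refine Submodule.sum_mem _ fun d hd => ?_
  rw [← Algebra.smul_def]
  refine Submodule.smul_mem _ _ (Submodule.subset_span ?_)
  refine ⟨fun j => ⟨d j, ?_⟩, ?_⟩
  · have := MvPolynomial.le_totalDegree hd
    have h2 : d j ≤ d.sum fun _ e => e := by
      rw [Finsupp.sum_fintype _ _ (fun _ => rfl)]
      exact Finset.single_le_sum (f := fun i => d i) (fun _ _ => Nat.zero_le _) (Finset.mem_univ j)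
    omega
  · exact (Finsupp.prod_fintype d (fun i e => v i ^ e) (fun _ => pow_zero _)).symm

theorem finrank_polyLe_mul_le {ι : Type*} [Fintype ι] (ω : ι → F) (N : ℕ) :
    Module.Finite k (polyLe k v N * Submodule.span k (Set.range ω) : Submodule k F) ∧ 
    Module.finrank k (polyLe k v N * Submodule.span k (Set.range ω) : Submodule k F) ≤ (N + 1) ^ ρ * Fintype.card ι := by
  classical
  rw [polyLe, Submodule.span_mul_span]
  have e : (Set.range fun c : Fin ρ → Fin (N + 1) => ∏ j, v j ^ (c j : ℕ)) * Set.range ω =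
      Set.range (fun a : (Fin ρ → Fin (N + 1)) × ι => (∏ j, v j ^ (a.1 j : ℕ)) * ω a.2) := by
    ext y
    rw [Set.mem_mul]
    constructor
    · rintro ⟨_, ⟨c, rfl⟩, _, ⟨i, rfl⟩, rfl⟩; exact ⟨(c, i), rfl⟩
    · rintro ⟨⟨c, i⟩, rfl⟩; exact ⟨_, ⟨c, rfl⟩, _, ⟨i, rfl⟩, rfl⟩
  rw [e]
  refine ⟨Module.Finite.span_of_finite k (Set.finite_range _), ?_⟩
  have := finrank_range_le_card (R := k) (fun a : (Fin ρ → Fin (N + 1)) × ι => (∏ j, v j ^ (a.1 j : ℕ)) * ω a.2)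
  simpa [Set.finrank] using this

theorem upper [Algebra.EssFiniteType k F] {n r : ℕ} (hr : Algebra.trdeg k F = r) (x : Fin n → F)
    (hx : ∀ i, x i ≠ 0) : ∃ C : ℕ, ∀ T : ℕ, 1 ≤ T → ∀ S : Set (Fin n → ℤ), (∀ e ∈ S, ∀ i, (e i).natAbs ≤ T) →
      Module.Finite k (Submodule.span k (mono x '' S)) ∧ 
      Module.finrank k (Submodule.span k (mono x '' S)) ≤ C * T ^ r := by
  classical
  obtain ⟨ρ, v, hρ, -, hv, halg⟩ := exists_alg_basis_in hr Set.univ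
  set K := IntermediateField.adjoin k (Set.range v) with hK
  haveI : Algebra.EssFiniteType K F := Algebra.EssFiniteType.of_comp k K F
  haveI : Algebra.IsAlgebraic K F := ⟨fun y => halg y trivial⟩
  haveI : FiniteDimensional K F := Algebra.finite_of_essFiniteType_of_isAlgebraic 
  let bω := Module.finBasis K F
  let D := Module.finrank K F
  let ω : Fin D → F := bω
  let Ω : Submodule k F := Submodule.span k (Set.range ω)
  -- clear denominators
  let Y : Option (Fin n × Bool) → F := fun o => match o with
    | none => 1
    | some (i, true) => x i
    | some (i, false) => (x i)⁻¹
  obtain ⟨d, hd0, hd⟩ : ∃ d : F, d ≠ 0 ∧ ∀ o a b, ((bω.repr (Y o * ω a) b : K) : F) * d ∈ Algebra.adjoin k (Set.range v) := by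
    open scoped IntermediateField.algebraAdjoinAdjoin in
    obtain ⟨d, hd⟩ := IsLocalization.exist_integer_multiples_of_finite (S := K)
      (nonZeroDivisors (Algebra.adjoin k (Set.range v)))
      (fun o : Option (Fin n × Bool) × Fin D × Fin D => bω.repr (Y o.1 * ω o.2.1) o.2.2)
    refine ⟨((d : Algebra.adjoin k (Set.range v)) : F), ?_, fun o a b => ?_⟩
    · intro h
      exact nonZeroDivisors.ne_zero d.2 (Subtype.ext h)
    · obtain ⟨z, hz⟩ := hd (o, a, b)
      have h1 := congrArg (fun w : K => (w : F)) hz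
      have : ((bω.repr (Y o * ω a) b : K) : F) * ((d : Algebra.adjoin k (Set.range v)) : F) = (z : F) := by
        rw [mul_comm]; exact h1.symm
      rw [this]; exact z.2
  choose Nf hNf using fun o a b => exists_mem_polyLe v (hd o a b)
  let Δ := ∑ o, ∑ a, ∑ b, Nf o a b
  have hΔ : ∀ o a b, Nf o a b ≤ Δ := by
    intro o a b
    calc Nf o a b ≤ ∑ b, Nf o a b := Finset.single_le_sum (f := fun b => Nf o a b) (fun _ _ => Nat.zero_le _) (Finset.mem_univ b)
      _ ≤ ∑ a, ∑ b, Nf o a b := Finset.single_le_sum (f := fun a => ∑ b, Nf o a b) (fun _ _ => Nat.zero_le _) (Finset.mem_univ a)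
      _ ≤ Δ := Finset.single_le_sum (f := fun o => ∑ a, ∑ b, Nf o a b) (fun _ _ => Nat.zero_le _) (Finset.mem_univ o)
  let Q : ℕ → F → Prop := fun M y => Submodule.span k {y} * Ω ≤ polyLe k v (M * Δ) * Ω
  have hQY : ∀ o, Q 1 (d * Y o) := by
    intro o
    show Submodule.span k _ * Submodule.span k _ ≤ _
    rw [Submodule.span_mul_span, Submodule.span_le]
    rintro _ ⟨_, rfl, _, ⟨a, rfl⟩, rfl⟩
    show d * Y o * ω a ∈ _
    have : d * Y o * ω a = ∑ b, (((bω.repr (Y o * ω a) b : K) : F) * d) * ω b := by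
      conv_lhs => rw [mul_assoc, ← bω.sum_repr (Y o * ω a), Finset.mul_sum]
      refine Finset.sum_congr rfl fun b _ => ?_
      rw [Algebra.smul_def]
      show d * ((bω.repr (Y o * ω a) b : K) * ω b : F) = _
      ring
    rw [this, one_mul]
    exact Submodule.sum_mem _ fun b _ => Submodule.mul_mem_mul (polyLe_mono v (hΔ o a b) (hNf o a b))
      (Submodule.subset_span ⟨b, rfl⟩)
  have hQ0 : Q 0 1 := by
    show Submodule.span k _ * _ ≤ _
    refine mul_le_mul' ?_ le_rfl
    rw [Submodule.span_le, Set.singleton_subset_iff]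
    exact one_mem_polyLe v _
  have hQmul : ∀ M M' y y', Q M y → Q M' y' → Q (M + M') (y * y') := by
    intro M M' y y' h h'
    show Submodule.span k _ * Ω ≤ _
    have e : Submodule.span k {y * y'} = Submodule.span k {y} * Submodule.span k {y'} := by
      rw [Submodule.span_mul_span, Set.singleton_mul_singleton]
    calc Submodule.span k {y * y'} * Ω = Submodule.span k {y} * (Submodule.span k {y'} * Ω) := by rw [e, mul_assoc]
      _ ≤ Submodule.span k {y} * (polyLe k v (M' * Δ) * Ω) := mul_le_mul' le_rfl h'
      _ = polyLe k v (M' * Δ) * (Submodule.span k {y} * Ω) := by rw [mul_left_comm]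
      _ ≤ polyLe k v (M' * Δ) * (polyLe k v (M * Δ) * Ω) := mul_le_mul' le_rfl h
      _ = polyLe k v (M' * Δ) * polyLe k v (M * Δ) * Ω := by rw [mul_assoc]
      _ ≤ _ := mul_le_mul' ((polyLe_mul v _ _).trans (polyLe_mono v (by rw [add_mul, add_comm]))) le_rfl
  have hQpow : ∀ y, Q 1 y → ∀ M, Q M (y ^ M) := by
    intro y hy M
    induction M with
    | zero => simpa using hQ0
    | succ M ih => rw [pow_succ]; exact hQmul _ _ _ _ ih hy
  have hQe : ∀ e : Fin n → ℤ, Q (∑ i, (e i).natAbs) (∏ i, (d ^ (e i).natAbs * x i ^ e i)) := by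
    intro e
    have : ∀ S : Finset (Fin n), Q (∑ i ∈ S, (e i).natAbs) (∏ i ∈ S, (d ^ (e i).natAbs * x i ^ e i)) := by
      intro S
      induction S using Finset.induction_on with
      | empty => simpa using hQ0
      | insert i S hi ih =>
        rw [Finset.sum_insert hi, Finset.prod_insert hi]
        refine hQmul _ _ _ _ ?_ ih
        rcases Int.natAbs_eq (e i) with h | h
        · have := hQpow _ (hQY (some (i, true))) (e i).natAbs
          rw [mul_pow] at this
          have e2 : x i ^ e i = x i ^ (e i).natAbs := by
            conv_lhs => rw [h]
            rw [zpow_natCast]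
          rwa [e2]
        · have := hQpow _ (hQY (some (i, false))) (e i).natAbs
          rw [mul_pow] at this
          have e2 : x i ^ e i = (x i)⁻¹ ^ (e i).natAbs := by
            conv_lhs => rw [h]
            rw [zpow_neg, zpow_natCast, inv_pow]
          rwa [e2]
    exact this _
  have hDpos : 0 < D := Module.finrank_pos
  refine ⟨(n * Δ + 1) ^ ρ * D, fun T hT S hS => ?_⟩
  -- the multiplication map
  let w0 := ω ⟨0, hDpos⟩
  have hw0 : w0 ≠ 0 := bω.ne_zero _
  have hmem : ∀ e ∈ S, d ^ (n * T) * w0 * mono x e ∈ polyLe k v (n * T * Δ) * Ω := by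
    intro e he
    have hle : ∑ i, (e i).natAbs ≤ n * T := by
      refine (Finset.sum_le_card_nsmul _ _ T fun i _ => hS e he i).trans ?_
      simp
    obtain ⟨R, hR⟩ := Nat.exists_eq_add_of_le hle
    have h1 := hQmul _ _ _ _ (hQe e) (hQpow _ (hQY none) R)
    rw [← hR] at h1
    have h2 := h1 (Submodule.mul_mem_mul (Submodule.mem_span_singleton_self _) (Submodule.subset_span ⟨⟨0, hDpos⟩, rfl⟩))
    convert h2 using 1
    rw [hR, Finset.prod_mul_distrib, Finset.prod_pow_eq_pow_sum, pow_add]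
    simp only [mono, Y, mul_one]
    show _ * w0 * _ = _ * w0
    ring
  let f : F →ₗ[k] F := LinearMap.mulLeft k (d ^ (n * T) * w0)
  have hf : Function.Injective f := by
    intro a b h
    exact mul_left_cancel₀ (mul_ne_zero (pow_ne_zero _ hd0) hw0) h
  have hmap : (Submodule.span k (mono x '' S)).map f ≤ polyLe k v (n * T * Δ) * Ω := by
    rw [Submodule.map_span, Submodule.span_le]
    rintro _ ⟨_, ⟨e, he, rfl⟩, rfl⟩
    exact hmem e he
  obtain ⟨hfin, hrank⟩ := finrank_polyLe_mul_le (k := k) v ω (n * T * Δ)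
  haveI : Module.Finite k ((Submodule.span k (mono x '' S)).map f) := Submodule.finiteDimensional_of_le hmap
  let eqv := Submodule.equivMapOfInjective f hf (Submodule.span k (mono x '' S))
  refine ⟨Module.Finite.equiv eqv.symm, ?_⟩
  rw [eqv.finrank_eq]
  refine (Submodule.finrank_mono hmap).trans (hrank.trans ?_)
  rw [Fintype.card_fin]
  have h1 : n * T * Δ + 1 ≤ (n * Δ + 1) * T := by nlinarith
  calc (n * T * Δ + 1) ^ ρ * D ≤ ((n * Δ + 1) * T) ^ ρ * D := by gcongr
    _ = (n * Δ + 1) ^ ρ * D * T ^ ρ := by rw [mul_pow]; ring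
    _ ≤ (n * Δ + 1) ^ ρ * D * T ^ r := by gcongr

theorem mono_single {n : ℕ} (x : Fin n → F) (i : Fin n) (m : ℕ) : mono x (Pi.single i (m : ℤ)) = x i ^ m := by
  rw [mono, Finset.prod_eq_single i]
  · simp
  · intro j _ hj; simp [Pi.single_eq_of_ne hj]
  · simp

theorem relations {k0 k : Type} [Field k0] [Field k] [CharZero k] [Countable k] [Algebra k ℂ] [Algebra k0 k] [Algebra k0 ℂ]
    [IsScalarTower k0 k ℂ] {n s r : ℕ} (x : Fin n → ℂ)
    (hx : ∀ i, x i ≠ 0) (hr : Algebra.trdeg k (IntermediateField.adjoin k (Set.range x)) = r)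
    (hr0 : Algebra.trdeg k0 (IntermediateField.adjoin k0 (Set.range x)) = r)
    (A : Fin s → Fin n → ℝ) (Ak : Fin s → Fin n → k) (hAk : ∀ j i, algebraMap k ℂ (Ak j i) = (A j i : ℂ))
    (hA : LinearIndependent ℝ A) (hc : MCond k x s r) :
    ∃ δ > (0:ℝ), ∃ (a t N : ℕ) (e : Fin N → Fin n → ℤ) (η : ℝ), 1 ≤ t ∧ 4 * n * η ≤ t ∧ 0 ≤ η ∧
      (∀ A' : Fin s → Fin n → ℝ, (∀ j i, |A' j i - A j i| ≤ δ) → ∀ ℓ : Fin n → ℝ, (∀ j, ∑ i, A' j i * ℓ i = 0) →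
        ∀ b, ∑ i, e b i * ℓ i ≤ η * ∑ i, |ℓ i|) ∧
      LinearIndependent k0 (fun b => mono x (e b)) ∧
      ∀ i, ∃ coef : Fin (a + 1) → Fin N → k0, coef ≠ 0 ∧
        ∑ j, ∑ b, coef j b • (mono x (e b) * x i ^ (t * (j : ℕ))) = 0 := by
  classical
  obtain ⟨c, hc0, hlow⟩ := lower x hx hr A Ak hAk hA hc
  set F := IntermediateField.adjoin k0 (Set.range x) with hF
  haveI : Algebra.EssFiniteType k0 F := by
    rw [IntermediateField.essFiniteType_iff]
    exact IntermediateField.fg_adjoin_of_finite (Set.finite_range x)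
  have hxF : ∀ i, x i ∈ F := fun i => IntermediateField.subset_adjoin _ _ ⟨i, rfl⟩
  let ξ : Fin n → F := fun i => ⟨x i, hxF i⟩
  have hξ0 : ∀ i, ξ i ≠ 0 := fun i h => hx i (congrArg Subtype.val h)
  have hξ : ∀ e, ((mono ξ e : F) : ℂ) = mono x e := fun e => map_mono F.val.toRingHom ξ e
  obtain ⟨C, hC⟩ := upper hr0 ξ hξ0
  obtain ⟨a, ha⟩ := exists_nat_gt (C * 2 ^ r / c + 1)
  have ha1 : (1:ℝ) < a := by
    have : (0:ℝ) ≤ C * 2 ^ r / c := by positivity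
    linarith
  have ha0 : 0 < a := by exact_mod_cast (zero_lt_one.trans ha1)
  have hac : (C * 2 ^ r : ℝ) < (a + 1) * c := by
    have : (C * 2 ^ r / c : ℝ) < a + 1 := by linarith
    rwa [div_lt_iff₀ hc0] at this
  let δ : ℝ := 1 / (8 * (n + 1) * (s + 1) * a)
  have hδ : 0 < δ := by positivity
  obtain ⟨T, hT0, N, e, hli, heT, hdir, hcard⟩ := hlow δ hδ a
  have hTpos : 0 < T := by omega
  have hTr : (0:ℝ) < T := by exact_mod_cast hTpos
  let t := T / a
  have ht1 : 1 ≤ t := Nat.div_pos hT0 ha0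
  have hta : t * a ≤ T := Nat.div_mul_le_self T a
  have htT : (T : ℝ) ≤ 2 * a * t := by
    have h1 : T < a * (t + 1) := by
      have := Nat.lt_mul_div_succ T ha0
      simpa using this
    have h2 : (T : ℝ) < a * (t + 1) := by exact_mod_cast h1
    have h3 : (1:ℝ) ≤ t := by exact_mod_cast ht1
    nlinarith
  refine ⟨δ, hδ, a, t, N, e, (s + 1) * δ * T, ht1, ?_, by positivity, ?_, hli.restrict_scalars' k0, ?_⟩
  · have : 4 * (n:ℝ) * ((s + 1) * δ * T) = (n / (n + 1)) * (T / (2 * a)) := by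
      simp only [δ]; field_simp; ring
    rw [this]
    have h1 : (n:ℝ) / (n + 1) ≤ 1 := by
      rw [div_le_one (by positivity)]; linarith
    have h2 : (T:ℝ) / (2 * a) ≤ t := by
      rw [div_le_iff₀ (by positivity)]; linarith
    calc (n:ℝ) / (n + 1) * (T / (2 * a)) ≤ 1 * (T / (2 * a)) := by gcongr
      _ ≤ t := by linarith
  · intro A' hA' ℓ hℓ b
    obtain ⟨τ, hτ, hd⟩ := hdir b
    have e1 : ∑ i, (e b i : ℝ) * ℓ i = ∑ i, ((e b i : ℝ) - ∑ j, τ j * A' j i) * ℓ i := by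
      have : ∑ i, (∑ j, τ j * A' j i) * ℓ i = 0 := by
        simp only [Finset.sum_mul]
        rw [Finset.sum_comm]
        refine Finset.sum_eq_zero fun j _ => ?_
        have := congrArg (fun z => τ j * z) (hℓ j)
        simp only [Finset.mul_sum, mul_zero] at this
        rw [← this]
        exact Finset.sum_congr rfl fun i _ => by ring
      simp only [sub_mul, Finset.sum_sub_distrib, this, sub_zero]
    rw [e1, Finset.mul_sum]
    refine Finset.sum_le_sum fun i _ => ?_
    refine (le_abs_self _).trans ?_
    rw [abs_mul]
    refine mul_le_mul_of_nonneg_right ?_ (abs_nonneg _)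
    have e2 : (e b i : ℝ) - ∑ j, τ j * A' j i = ((e b i : ℝ) - ∑ j, τ j * A j i) - ∑ j, τ j * (A' j i - A j i) := by
      simp only [mul_sub, Finset.sum_sub_distrib]; ring
    rw [e2]
    have h3 : |∑ j, τ j * (A' j i - A j i)| ≤ s * (T * δ) := by
      refine (Finset.abs_sum_le_sum_abs _ _).trans ?_
      refine (Finset.sum_le_card_nsmul _ _ (T * δ : ℝ) fun j _ => ?_).trans (by simp)
      rw [abs_mul]
      exact mul_le_mul (hτ j) (hA' j i) (abs_nonneg _) hTr.le
    have h4 := hd i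
    have h5 := abs_sub ((e b i : ℝ) - ∑ j, τ j * A j i) (∑ j, τ j * (A' j i - A j i))
    nlinarith
  · intro i
    by_contra hno
    push Not at hno
    let E : Fin (a + 1) × Fin N → Fin n → ℤ := fun p => e p.2 + Pi.single i ((t * (p.1 : ℕ) : ℕ) : ℤ)
    have hE : ∀ p, mono x (E p) = mono x (e p.2) * x i ^ (t * (p.1 : ℕ)) := by
      intro p; rw [mono_add hx, mono_single]
    have hliE : LinearIndependent k0 (fun p => mono x (E p)) := by
      rw [Fintype.linearIndependent_iff]
      intro g hg p
      by_contra hgp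
      refine hno (fun j b => g (j, b)) (fun h => hgp ?_) ?_
      · exact congrFun (congrFun h p.1) p.2
      · rw [Fintype.sum_prod_type] at hg
        simp only [hE] at hg
        exact hg
    have hliξ : LinearIndependent k0 (fun p => mono ξ (E p)) := by
      apply LinearIndependent.of_comp F.val.toLinearMap
      have : (F.val.toLinearMap ∘ fun p => mono ξ (E p)) = fun p => mono x (E p) := by
        funext p; exact hξ _
      rw [this]; exact hliE
    have hEb : ∀ e' ∈ Set.range E, ∀ l, (e' l).natAbs ≤ 2 * T := by
      rintro _ ⟨p, rfl⟩ l
      have h1 : (e p.2 l).natAbs ≤ T := by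
        have := heT p.2 l
        have h2 : |e p.2 l| ≤ (T : ℤ) := by exact_mod_cast this
        rw [Int.abs_eq_natAbs] at h2
        exact_mod_cast h2
      have h2 : ((Pi.single i ((t * (p.1 : ℕ) : ℕ) : ℤ) : Fin n → ℤ) l).natAbs ≤ T := by
        by_cases hl : l = i
        · subst hl
          rw [Pi.single_eq_same]
          have h3 : (p.1 : ℕ) ≤ a := by have := p.1.2; omega
          calc _ = t * (p.1 : ℕ) := Int.natAbs_natCast _
            _ ≤ t * a := Nat.mul_le_mul_left _ h3
            _ ≤ T := hta
        · rw [Pi.single_eq_of_ne hl]; simp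
      calc (E p l).natAbs ≤ (e p.2 l).natAbs + ((Pi.single i ((t * (p.1 : ℕ) : ℕ) : ℤ) : Fin n → ℤ) l).natAbs :=
            Int.natAbs_add_le _ _
        _ ≤ 2 * T := by omega
    obtain ⟨hfin, hrank⟩ := hC (2 * T) (by omega) _ hEb
    have himg : mono ξ '' Set.range E = Set.range (fun p => mono ξ (E p)) := by
      rw [← Set.range_comp]; rfl
    rw [himg, finrank_span_eq_card hliξ] at hrank
    rw [Fintype.card_prod, Fintype.card_fin, Fintype.card_fin] at hrank
    have h6 : ((a + 1 : ℝ)) * N ≤ C * (2 * T) ^ r := by exact_mod_cast hrank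
    have h7 : (a + 1 : ℝ) * (c * T ^ r) ≤ (a + 1) * N := by gcongr
    rw [mul_pow] at h6
    have h8 : (0:ℝ) < T ^ r := by positivity
    nlinarith
end C1

section C2
open Cardinal Topology MvPolynomial

theorem emb_over {k F : Type} [Field k] [Field F] [Algebra k F] [Algebra k ℂ] {r : ℕ}
    (Z : Fin r → F) (hTB : IsTranscendenceBasis k Z) (g : Fin r → ℂ) (hg : AlgebraicIndependent k g) :
    ∃ θ : F →ₐ[k] ℂ, ∀ i, θ (Z i) = g i := by
  set R := MvPolynomial (Fin r) k with hR
  letI alg0 : Algebra R F := (aeval Z : R →ₐ[k] F).toRingHom.toAlgebra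
  have halg0 : ∀ q : R, algebraMap R F q = aeval Z q := fun q => rfl
  letI alg1 : Algebra R ℂ := (aeval g : R →ₐ[k] ℂ).toRingHom.toAlgebra
  have halg1 : ∀ q : R, algebraMap R ℂ q = aeval g q := fun q => rfl
  haveI : FaithfulSMul R F := (faithfulSMul_iff_algebraMap_injective R F).mpr hTB.1
  haveI : FaithfulSMul R ℂ := (faithfulSMul_iff_algebraMap_injective R ℂ).mpr hg
  haveI t1 : IsScalarTower k R F := IsScalarTower.of_algebraMap_eq (fun a => by
    rw [halg0, MvPolynomial.algebraMap_eq, aeval_C])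
  haveI t2 : IsScalarTower k R ℂ := IsScalarTower.of_algebraMap_eq (fun a => by
    rw [halg1, MvPolynomial.algebraMap_eq, aeval_C])
  haveI : Algebra.IsAlgebraic R F := by
    constructor
    intro x
    have h := hTB.isAlgebraic.isAlgebraic x
    obtain ⟨f, hf, hfx⟩ := h
    let ψ : R →+* Algebra.adjoin k (Set.range Z) :=
      ((aeval Z : R →ₐ[k] F).codRestrict (Algebra.adjoin k (Set.range Z)) (fun q => by
        rw [Algebra.adjoin_range_eq_range_aeval]; exact ⟨q, rfl⟩)).toRingHom
    have hψ : Function.Surjective ψ := by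
      rintro ⟨y, hy⟩
      have hy' := hy
      rw [Algebra.adjoin_range_eq_range_aeval] at hy'
      obtain ⟨q, hq⟩ := hy'
      exact ⟨q, Subtype.ext hq⟩
    obtain ⟨g, hg⟩ := Polynomial.map_surjective ψ hψ f
    refine ⟨g, ?_, ?_⟩
    · rintro rfl
      exact hf (by rw [← hg]; simp)
    · rw [← hfx, ← hg, Polynomial.aeval_def, Polynomial.aeval_def, Polynomial.eval₂_map]
      rfl
  let θ : F →ₐ[R] ℂ := IsAlgClosed.lift
  refine ⟨θ.restrictScalars k, fun i => ?_⟩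
  have := θ.commutes (X i)
  rw [halg0, halg1, aeval_X, aeval_X] at this
  exact this

section free
variable {k0 k F : Type} [Field k0] [Field k] [Field F] [Algebra k0 F] [Algebra k0 k] [Algebra k ℂ]
  [Algebra k0 ℂ] [IsScalarTower k0 k ℂ] {r : ℕ}

theorem adj_mono {S : Set ℂ} : ∀ w ∈ IntermediateField.adjoin k0 S, w ∈ IntermediateField.adjoin k S := by
  have : IntermediateField.adjoin k0 S ≤ (IntermediateField.adjoin k S).restrictScalars k0 := by
    rw [IntermediateField.adjoin_le_iff]
    exact IntermediateField.subset_adjoin _ _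
  exact fun w hw => this hw

theorem isAlg_theta (θ : F →ₐ[k0] ℂ) {ι : Type} (z : ι → F) {y : F}
    (hy : IsAlgebraic (IntermediateField.adjoin k0 (Set.range z)) y) :
    IsAlgebraic (IntermediateField.adjoin k (Set.range fun i => θ (z i))) (θ y) :=
  isAlg_of_subset _ _ adj_mono (isAlg_map θ z hy)

theorem free_lemma (hr : Algebra.trdeg k0 F = r) (v : Fin r → F) (θ : F →ₐ[k0] ℂ)
    (hg : AlgebraicIndependent k (fun i => θ (v i))) {ι : Type} (w : ι → F)
    (hw : AlgebraicIndependent k0 w) : AlgebraicIndependent k (fun i => θ (w i)) := by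
  obtain ⟨T, hT, hTB⟩ := exists_isTranscendenceBasis_superset (R := k0) (s := Set.range w) (AlgebraicIndependent.coe_range hw)
  have hc : Cardinal.mk T = r := by
    rw [← hr]; exact hTB.cardinalMk_eq_trdeg
  have : Finite T := Cardinal.lt_aleph0_iff_finite.mp (hc.trans_lt (Cardinal.natCast_lt_aleph0))
  letI := Fintype.ofFinite T
  have hc2 : Fintype.card T = r := by
    have := Cardinal.mk_fintype T
    rw [hc] at this; exact_mod_cast this.symm
  let eT : Fin r ≃ T := (Fintype.equivFinOfCardEq hc2).symm
  let z : Fin r → F := fun i => eT i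
  have hz : Set.range z = T := by
    have : z = Subtype.val ∘ eT := rfl
    rw [this, Set.range_comp, eT.surjective.range_eq]; simp
  have hzalg : ∀ y : F, IsAlgebraic (IntermediateField.adjoin k0 (Set.range z)) y := by
    intro y
    rw [isAlg_adjoin_iff, hz]
    have := hTB.isAlgebraic.isAlgebraic y
    rw [Subtype.range_coe] at this
    exact this
  have hzi : AlgebraicIndependent k (fun i => θ (z i)) :=
    algIndep_exchange _ _ hg (fun j => isAlg_theta θ z (hzalg _))
  let f : ι → Fin r := fun i => eT.symm ⟨w i, hT ⟨i, rfl⟩⟩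
  have hf : ∀ i, z (f i) = w i := fun i => by simp [z, f]
  have hfi : Function.Injective f := by
    intro i j hij
    apply hw.injective
    rw [← hf, ← hf, hij]
  have := hzi.comp f hfi
  have e : (fun i => θ (w i)) = (fun i => θ (z i)) ∘ f := funext fun i => by simp [hf]
  rw [e]; exact this

theorem MCond_theta (hr : Algebra.trdeg k0 F = r) (v : Fin r → F) (θ : F →ₐ[k0] ℂ)
    (hg : AlgebraicIndependent k (fun i => θ (v i))) {n s : ℕ} (ξ : Fin n → F)
    (hc : MCond k0 ξ s r) : MCond k (fun i => θ (ξ i)) s r := by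
  intro B ρ β hβ hi ha hρ
  have e : ∀ b, mono (fun i => θ (ξ i)) b = θ (mono ξ b) := fun b => (map_mono (θ : F →+* ℂ) ξ b).symm
  have e2 : (fun i => mono (fun i => θ (ξ i)) (β i)) = fun i => θ (mono ξ (β i)) := funext fun i => e _
  rw [e2] at hi ha
  simp only [e] at ha
  have hi0 : AlgebraicIndependent k0 (fun i => mono ξ (β i)) := by
    have : AlgebraicIndependent k0 (fun i => θ (mono ξ (β i))) :=
      hi.restrictScalars (algebraMap k0 k).injective
    exact AlgebraicIndependent.of_comp θ this
  refine hc B ρ β hβ hi0 ?_ hρ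
  intro b hb
  by_contra hno
  rw [isAlg_adjoin_iff] at hno
  have h1 := (hi0.option_iff_transcendental (mono ξ b)).mpr hno
  have h2 := free_lemma hr v θ hg _ h1
  have h3 : AlgebraicIndependent k (fun o : Option (Fin ρ) => o.elim (θ (mono ξ b)) (fun i => θ (mono ξ (β i)))) := by
    convert h2 using 1
    funext o; cases o <;> rfl
  have h4 := (hi.option_iff_transcendental (θ (mono ξ b))).mp h3
  apply h4
  rw [← isAlg_adjoin_iff]
  exact ha b hb

theorem trdeg_theta (v : Fin r → F) (hTB : IsTranscendenceBasis k0 v) (θ : F →ₐ[k0] ℂ)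
    (hg : AlgebraicIndependent k (fun i => θ (v i))) {n : ℕ} (ξ : Fin n → F)
    (hξ : IntermediateField.adjoin k0 (Set.range ξ) = ⊤) :
    Algebra.trdeg k (IntermediateField.adjoin k (Set.range fun i => θ (ξ i))) = r := by
  set E := IntermediateField.adjoin k (Set.range fun i => θ (ξ i)) with hE
  have hmem : ∀ y : F, θ y ∈ E := by
    have : IntermediateField.adjoin k0 (Set.range ξ) ≤ (E.restrictScalars k0).comap θ := by
      rw [IntermediateField.adjoin_le_iff]
      rintro _ ⟨i, rfl⟩
      exact IntermediateField.subset_adjoin _ _ ⟨i, rfl⟩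
    rw [hξ] at this
    exact fun y => this trivial
  let g : Fin r → E := fun i => ⟨θ (v i), hmem _⟩
  have hgi : AlgebraicIndependent k g := AlgebraicIndependent.of_comp E.val hg
  have halgv : ∀ y : F, IsAlgebraic (IntermediateField.adjoin k0 (Set.range v)) y := by
    intro y; rw [isAlg_adjoin_iff]; exact hTB.isAlgebraic.isAlgebraic y
  have hTB' : IsTranscendenceBasis k g := by
    apply isTB_of_field hgi
    have key : ∀ y ∈ E, ∃ h : y ∈ E, IsAlgebraic (IntermediateField.adjoin k (Set.range g)) (⟨y, h⟩ : E) := by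
      let L : IntermediateField k E := (algebraicClosure (IntermediateField.adjoin k (Set.range g)) E).restrictScalars k
      have hLm : ∀ y, y ∈ L ↔ IsAlgebraic (IntermediateField.adjoin k (Set.range g)) y := fun y => mem_algebraicClosure_iff
      have : IntermediateField.adjoin k (Set.range fun i => θ (ξ i)) ≤ L.map E.val := by
        rw [IntermediateField.adjoin_le_iff]
        rintro _ ⟨i, rfl⟩
        refine ⟨⟨θ (ξ i), hmem _⟩, (hLm _).mpr ?_, rfl⟩
        have h1 := isAlg_theta (k := k) θ v (halgv (ξ i))
        -- codomain descent
        obtain ⟨p, hp, hp0⟩ := h1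
        have hKle : ∀ w ∈ IntermediateField.adjoin k (Set.range fun i => θ (v i)), ∃ h : w ∈ E,
            (⟨w, h⟩ : E) ∈ IntermediateField.adjoin k (Set.range g) := by
          have : IntermediateField.adjoin k (Set.range fun i => θ (v i)) ≤
              (IntermediateField.adjoin k (Set.range g)).map E.val := by
            rw [IntermediateField.adjoin_le_iff]
            rintro _ ⟨i, rfl⟩
            exact ⟨g i, IntermediateField.subset_adjoin _ _ ⟨i, rfl⟩, rfl⟩
          intro w hw
          obtain ⟨u, hu, rfl⟩ := this hw
          exact ⟨u.2, hu⟩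
        let ψ : IntermediateField.adjoin k (Set.range fun i => θ (v i)) →+* IntermediateField.adjoin k (Set.range g) :=
          { toFun := fun w => ⟨⟨w, (hKle w w.2).1⟩, (hKle w w.2).2⟩
            map_one' := rfl
            map_mul' := fun _ _ => rfl
            map_zero' := rfl
            map_add' := fun _ _ => rfl }
        refine ⟨p.map ψ, (Polynomial.map_ne_zero_iff ψ.injective).mpr hp, ?_⟩
        apply E.val.injective
        rw [map_zero, Polynomial.aeval_def, Polynomial.eval₂_map, ← RingHom.coe_coe, Polynomial.hom_eval₂]
        exact hp0
      intro y hy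
      obtain ⟨u, hu, rfl⟩ := this hy
      exact ⟨u.2, (hLm _).mp hu⟩
    exact ⟨fun y => (key y y.2).2⟩
  have := hTB'.lift_cardinalMk_eq_trdeg
  simpa using this.symm
end free

theorem countable_adjoin {k0 : Type} [Field k0] [Countable k0] [Algebra k0 ℂ] {ι : Type} [Finite ι] (y : ι → ℂ) :
    Countable (IntermediateField.adjoin k0 (Set.range y)) := by
  have hc : Countable (MvPolynomial ι k0) := by
    have := Finite.to_countable (α := ι)
    rw [← Cardinal.mk_le_aleph0_iff]
    refine (MvPolynomial.cardinalMk_le_max).trans ?_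
    simp
  have : (IntermediateField.adjoin k0 (Set.range y) : Set ℂ) ⊆
      Set.range (fun p : MvPolynomial ι k0 × MvPolynomial ι k0 => aeval y p.1 / aeval y p.2) := by
    intro w hw
    obtain ⟨a, b, h⟩ := (IntermediateField.mem_adjoin_range_iff k0 y w).mp hw
    exact ⟨(a, b), h.symm⟩
  exact ((Set.countable_range _).mono this).to_subtype

theorem relations_gen {k0 F : Type} [Field k0] [CharZero k0] [Countable k0] [Algebra k0 ℂ] [Field F]
    [Algebra k0 F] {n s r : ℕ} (ξ : Fin n → F) (hξ : ∀ i, ξ i ≠ 0)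
    (hgen : IntermediateField.adjoin k0 (Set.range ξ) = ⊤)
    (hr : Algebra.trdeg k0 F = r) (A : Fin s → Fin n → ℝ) (hA : LinearIndependent ℝ A)
    (hc : MCond k0 ξ s r) :
    ∃ δ : ℝ, 0 < δ ∧ ∃ (a t N : ℕ) (e : Fin N → Fin n → ℤ) (η : ℝ), 1 ≤ t ∧ 4 * n * η ≤ t ∧ 0 ≤ η ∧
      (∀ A' : Fin s → Fin n → ℝ, (∀ j i, |A' j i - A j i| ≤ δ) →
        ∀ ℓ : Fin n → ℝ, (∀ j, ∑ i, A' j i * ℓ i = 0) → ∀ b, ∑ i, (e b i : ℝ) * ℓ i ≤ η * ∑ i, |ℓ i|) ∧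
      LinearIndependent k0 (fun b => mono ξ (e b)) ∧
      ∀ i, ∃ coef : Fin (a + 1) → Fin N → k0, coef ≠ 0 ∧
        ∑ j, ∑ b, coef j b • (mono ξ (e b) * ξ i ^ (t * (j : ℕ))) = 0 := by
  let y : Fin s × Fin n → ℂ := fun p => (A p.1 p.2 : ℂ)
  let k := IntermediateField.adjoin k0 (Set.range y)
  haveI : Countable k := countable_adjoin y
  haveI : CharZero k := charZero_of_injective_algebraMap (algebraMap k0 k).injective
  obtain ⟨g, hg, -⟩ := exists_algIndep_nhds (k := k) (r := r) (fun _ => 0) (fun _ => Set.univ) (fun _ => Filter.univ_mem)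
  have hg0 : AlgebraicIndependent k0 g := hg.restrictScalars (algebraMap k0 k).injective
  obtain ⟨ρ, Z, hρ, -, hZ, hZalg⟩ := exists_alg_basis_in hr Set.univ
  have hTB : IsTranscendenceBasis k0 Z := isTB_of_field hZ ⟨fun x => hZalg x trivial⟩
  have hρr : ρ = r := by
    have := hTB.lift_cardinalMk_eq_trdeg
    rw [hr] at this
    simpa using this
  subst hρr
  obtain ⟨θ, hθ⟩ := emb_over Z hTB g hg0
  have hgθ : (fun i => θ (Z i)) = g := funext hθ
  rw [← hgθ] at hg hg0
  have hx0 : ∀ i, θ (ξ i) ≠ 0 := fun i => by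
    rw [Ne, map_eq_zero]; exact hξ i
  have e : ∀ b, mono (fun i => θ (ξ i)) b = θ (mono ξ b) := fun b => (map_mono (θ : F →+* ℂ) ξ b).symm
  obtain ⟨δ, hδ, a, t, N, e', η, h1, h2, h3, h4, h5, h6⟩ := relations (k0 := k0) (k := k) (fun i => θ (ξ i)) hx0
    (trdeg_theta Z hTB θ hg ξ hgen)
    (trdeg_theta Z hTB θ hg0 ξ hgen) A (fun j i => ⟨(A j i : ℂ), IntermediateField.subset_adjoin _ _ ⟨(j, i), rfl⟩⟩)
    (fun j i => rfl) hA (MCond_theta hr Z θ hg ξ hc)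
  refine ⟨δ, hδ, a, t, N, e', η, h1, h2, h3, h4, ?_, ?_⟩
  · simp only [e] at h5
    exact LinearIndependent.of_comp θ.toLinearMap h5
  · intro i
    obtain ⟨coef, hcf, h⟩ := h6 i
    refine ⟨coef, hcf, ?_⟩
    have hh : θ (∑ j, ∑ b, coef j b • (mono ξ (e' b) * ξ i ^ (t * (j : ℕ)))) = 0 := ?_
    · exact (map_eq_zero θ).mp hh
    rw [← h, map_sum]
    refine Finset.sum_congr rfl fun j _ => ?_
    rw [map_sum]
    refine Finset.sum_congr rfl fun b _ => ?_
    rw [map_smul, map_mul, map_pow, e]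
end C2

section D1
open Polynomial NumberField Height
open scoped Real

theorem galProd {K : Type*} [Field K] [Algebra ℚ K] [FiniteDimensional ℚ K] [IsGalois ℚ K] (α : K) :
    ∃ e : ℕ, e * (minpoly ℚ α).natDegree = Fintype.card (K ≃ₐ[ℚ] K) ∧
      ∏ σ : K ≃ₐ[ℚ] K, (X - C (σ α)) = ((minpoly ℚ α).map (algebraMap ℚ K)) ^ e := by
  classical
  set m := minpoly ℚ α with hm
  have hinteg : IsIntegral ℚ α := IsIntegral.of_finite ℚ α
  have hsplit : (m.map (algebraMap ℚ K)).Splits := Normal.splits inferInstance α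
  have hsep : m.Separable := IsGalois.separable ℚ α
  have hmon : (m.map (algebraMap ℚ K)).Monic := (minpoly.monic hinteg).map _
  have hnd : ((m.map (algebraMap ℚ K)).roots).Nodup := nodup_roots (hsep.map)
  set R : Finset K := (m.map (algebraMap ℚ K)).roots.toFinset with hR
  have hmR : m.map (algebraMap ℚ K) = ∏ β ∈ R, (X - C β) := by
    conv_lhs => rw [hsplit.eq_prod_roots_of_monic hmon]
    rw [Finset.prod, hR, Multiset.toFinset_val, hnd.dedup]
  have hmem : ∀ σ : K ≃ₐ[ℚ] K, σ α ∈ R := by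
    intro σ
    rw [hR, Multiset.mem_toFinset, mem_roots hmon.ne_zero, IsRoot.def, eval_map_algebraMap]
    have := aeval_algHom_apply (σ : K →ₐ[ℚ] K) α m
    rw [hm, minpoly.aeval, map_zero] at this
    exact this
  have htrans : ∀ β ∈ R, ∃ τ : K ≃ₐ[ℚ] K, τ α = β := by
    intro β hβ
    rw [hR, Multiset.mem_toFinset, mem_roots hmon.ne_zero, IsRoot.def, eval_map_algebraMap] at hβ
    have : minpoly ℚ α = minpoly ℚ β :=
      minpoly.eq_of_irreducible_of_monic (minpoly.irreducible hinteg) hβ (minpoly.monic hinteg)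
    obtain ⟨τ, hτ⟩ := (Normal.minpoly_eq_iff_mem_orbit (F := ℚ) (E := K)).mp this
    refine ⟨τ⁻¹, ?_⟩
    have h2 : τ β = α := hτ
    rw [← h2]
    exact τ.symm_apply_apply β
  set e := (Finset.univ.filter fun σ : K ≃ₐ[ℚ] K => σ α = α).card with he
  have hfib : ∀ β ∈ R, (Finset.univ.filter fun σ : K ≃ₐ[ℚ] K => σ α = β).card = e := by
    intro β hβ
    obtain ⟨τ, rfl⟩ := htrans β hβ
    symm
    apply Finset.card_bij (fun σ _ => τ * σ)
    · intro σ hσ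
      simp only [Finset.mem_filter, Finset.mem_univ, true_and] at hσ ⊢
      rw [AlgEquiv.mul_apply, hσ]
    · intro a _ b _ h
      exact mul_left_cancel h
    · intro b hb
      simp only [Finset.mem_filter, Finset.mem_univ, true_and] at hb
      refine ⟨τ⁻¹ * b, ?_, by simp⟩
      simp only [Finset.mem_filter, Finset.mem_univ, true_and]
      rw [AlgEquiv.mul_apply, hb]
      exact τ.symm_apply_apply α
  have hprod : ∏ σ : K ≃ₐ[ℚ] K, (X - C (σ α)) = (m.map (algebraMap ℚ K)) ^ e := by
    rw [hmR, ← Finset.prod_pow, ← Finset.prod_fiberwise_of_maps_to (g := fun σ : K ≃ₐ[ℚ] K => σ α) (t := R) (fun σ _ => hmem σ)]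
    refine Finset.prod_congr rfl fun β hβ => ?_
    rw [← hfib β hβ, Finset.prod_congr rfl (g := fun _ => (X - C β : K[X])), Finset.prod_const]
    intro σ hσ
    rw [(Finset.mem_filter.mp hσ).2]
  refine ⟨e, ?_, hprod⟩
  have h1 := congrArg natDegree hprod
  rw [natDegree_prod_of_monic _ _ (fun σ _ => monic_X_sub_C _), hmon.natDegree_pow, (minpoly.monic hinteg).natDegree_map] at h1
  simp at h1
  rw [← h1]
  
theorem coefBound {K : Type*} [Field K] [NumberField K] (v : FinitePlace K) {ι : Type*} (s : Finset ι) (f : ι → K) :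
    ∀ j, v ((∏ i ∈ s, (X - C (f i))).coeff j) ≤ ∏ i ∈ s, max 1 (v (f i)) := by
  classical
  induction s using Finset.induction_on with
  | empty =>
    intro j
    simp only [Finset.prod_empty, coeff_one]
    split_ifs <;> simp
  | insert i s hi ih =>
    intro j
    rw [Finset.prod_insert hi, Finset.prod_insert hi]
    have hpos : 0 ≤ ∏ i ∈ s, max 1 (v (f i)) := Finset.prod_nonneg fun i _ => zero_le_one.trans (le_max_left _ _)
    have hneg : ∀ x y : K, v (x - y) ≤ max (v x) (v y) := by
      intro x y
      rw [sub_eq_add_neg]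
      refine (FinitePlace.add_le v x (-y)).trans ?_
      rw [map_neg_eq_map]
    have h2 : v (f i * (∏ i ∈ s, (X - C (f i))).coeff j) ≤ max 1 (v (f i)) * ∏ i ∈ s, max 1 (v (f i)) := by
      rw [map_mul]
      exact mul_le_mul (le_max_right _ _) (ih j) (apply_nonneg _ _) (zero_le_one.trans (le_max_left _ _))
    rw [sub_mul, coeff_sub, coeff_C_mul]
    refine (hneg _ _).trans (max_le ?_ h2)
    cases j with
    | zero => simp [mul_coeff_zero]; positivity
    | succ j =>
      rw [coeff_X_mul]
      refine (ih j).trans ?_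
      exact le_mul_of_one_le_left hpos (le_max_left _ _)

theorem primCoef {K : Type*} [Field K] [NumberField K] (v : FinitePlace K) (g : ℤ[X]) (hg : g.IsPrimitive) :
    ∃ j, 1 ≤ v ((g.coeff j : ℤ) : K) := by
  by_contra hno
  push Not at hno
  let I : Ideal ℤ :=
    { carrier := {k | v ((k : ℤ) : K) < 1}
      add_mem' := by
        intro a b ha hb
        simp only [Set.mem_ofPred_eq, Int.cast_add] at *
        exact (FinitePlace.add_le v _ _).trans_lt (max_lt ha hb)
      zero_mem' := by simp
      smul_mem' := by
        intro c x hx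
        simp only [Set.mem_ofPred_eq, smul_eq_mul, Int.cast_mul, map_mul] at *
        have hc : v ((c : ℤ) : K) ≤ 1 := by
          have := FinitePlace.norm_le_one K v.maximalIdeal (c : 𝓞 K)
          rw [FinitePlace.norm_embedding_eq] at this
          simpa using this
        exact (mul_le_of_le_one_left (apply_nonneg _ _) hc).trans_lt hx }
  have hI : ∀ k, k ∈ I ↔ v ((k : ℤ) : K) < 1 := fun k => Iff.rfl
  obtain ⟨d, hd⟩ := (IsPrincipalIdealRing.principal I).principal
  have h1 : C d ∣ g := by
    rw [C_dvd_iff_dvd_coeff]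
    intro i
    have : g.coeff i ∈ I := (hI _).mpr (hno i)
    rw [hd] at this
    exact Ideal.mem_span_singleton.mp this
  have hu := hg d h1
  have hdI : d ∈ I := by rw [hd]; exact Ideal.mem_span_singleton_self d
  have : (1 : ℤ) ∈ I := by
    rw [← Ideal.eq_top_iff_one]
    exact Ideal.eq_top_of_isUnit_mem I hdI hu
  rw [hI] at this
  simp at this

theorem primPoly (m : ℚ[X]) (hm : m.Monic) : ∃ g : ℤ[X], g.IsPrimitive ∧ ∃ l : ℤ, l ≠ 0 ∧
    g.map (Int.castRingHom ℚ) = C (l : ℚ) * m ∧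
    ((m.support.lcm fun i => (m.coeff i).den : ℕ) : ℝ) ≤ |(l : ℝ)| := by
  obtain ⟨b, hbm, hbM⟩ := IsLocalization.integerNormalization_spec (nonZeroDivisors ℤ) m
  set M := IsLocalization.integerNormalization (nonZeroDivisors ℤ) m with hM
  have hb0 : b ≠ 0 := nonZeroDivisors.ne_zero hbm
  have hMmap : M.map (Int.castRingHom ℚ) = C (b : ℚ) * m := by
    ext i
    have := congrArg (fun p => p.coeff i) hbM
    simpa using this
  have hM0 : M ≠ 0 := by
    intro h
    rw [h, Polynomial.map_zero] at hMmap
    have := mul_eq_zero.mp hMmap.symm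
    simp [hm.ne_zero, hb0] at this
  have hc0 : M.content ≠ 0 := by rwa [Ne, content_eq_zero_iff]
  have h1 : C ((M.content : ℤ) : ℚ) * (M.primPart.map (Int.castRingHom ℚ)) = C (b : ℚ) * m := by
    rw [← hMmap]
    conv_rhs => rw [M.eq_C_content_mul_primPart]
    simp
  set l := M.primPart.leadingCoeff with hl
  have hl0 : l ≠ 0 := by
    rw [hl, Ne, leadingCoeff_eq_zero]; exact M.isPrimitive_primPart.ne_zero
  have hinj : Function.Injective (Int.castRingHom ℚ) := Int.cast_injective
  have h2 : ((M.content : ℤ) : ℚ) * l = b := by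
    have := congrArg leadingCoeff h1
    rw [leadingCoeff_mul, leadingCoeff_mul, leadingCoeff_C, leadingCoeff_C, hm.leadingCoeff, mul_one,
      leadingCoeff_map_of_injective hinj] at this
    exact this
  have h3 : M.primPart.map (Int.castRingHom ℚ) = C (l : ℚ) * m := by
    have hcq : C ((M.content : ℤ) : ℚ) ≠ 0 := by simpa using hc0
    apply mul_left_cancel₀ hcq
    rw [h1, ← mul_assoc, ← C_mul, h2]
  refine ⟨M.primPart, M.isPrimitive_primPart, l, hl0, h3, ?_⟩
  have h4 : (m.support.lcm fun i => (m.coeff i).den) ∣ l.natAbs := by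
    apply Finset.lcm_dvd
    intro i _
    have h5 : (l : ℚ) * m.coeff i = (M.primPart.coeff i : ℤ) := by
      have := congrArg (fun p => p.coeff i) h3
      simp at this
      exact this.symm
    have hln : ((m.coeff i).den : ℤ) ∣ l := by
      have h6 : (l : ℚ) * (m.coeff i).num = (M.primPart.coeff i : ℤ) * (m.coeff i).den := by
        rw [← h5, mul_assoc, Rat.mul_den_eq_num]
      have h7 : l * (m.coeff i).num = (M.primPart.coeff i : ℤ) * (m.coeff i).den := by exact_mod_cast h6
      have h8 : ((m.coeff i).den : ℤ) ∣ l * (m.coeff i).num := ⟨_, by rw [h7, mul_comm]⟩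
      refine IsCoprime.dvd_of_dvd_mul_right ?_ h8
      rw [Int.isCoprime_iff_nat_coprime]
      exact (m.coeff i).reduced.symm
    exact Int.natCast_dvd.mp hln
  have h9 := Nat.le_of_dvd (Int.natAbs_pos.mpr hl0) h4
  have : (|(l:ℝ)|) = ((l.natAbs : ℕ) : ℝ) := by
    rw [Nat.cast_natAbs]; simp
  rw [this]
  exact_mod_cast h9
end D1

section D2
open Polynomial NumberField Height
open scoped Real

theorem posLog_support {K : Type*} [Field K] [NumberField K] (x : K) :
    (Function.support fun v : FinitePlace K => Real.posLog (v x)).Finite := by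
  by_cases hx : x = 0
  · subst hx; simp
  · refine (FinitePlace.hasFiniteMulSupport hx).subset ?_
    intro v hv h
    apply hv
    have h' : v x = 1 := h
    simp [h']

theorem log_support {K : Type*} [Field K] [NumberField K] (x : K) :
    (Function.support fun v : FinitePlace K => Real.log (v x)).Finite := by
  by_cases hx : x = 0
  · subst hx; simp
  · refine (FinitePlace.hasFiniteMulSupport hx).subset ?_
    intro v hv h
    apply hv
    have h' : v x = 1 := h
    simp [h']

theorem finsum_log {K : Type*} [Field K] [NumberField K] (x : K) (hx : x ≠ 0) :
    ∑ᶠ v : FinitePlace K, Real.log (v x) = - Real.log |((Algebra.norm ℚ x : ℚ) : ℝ)| := by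
  classical
  have hS : (Function.mulSupport fun v : FinitePlace K => v x).Finite := FinitePlace.hasFiniteMulSupport hx
  have h1 := FinitePlace.prod_eq_inv_abs_norm hx
  rw [finprod_eq_prod_of_mulSupport_subset (s := hS.toFinset) _ (by simp)] at h1
  rw [finsum_eq_sum_of_support_subset (s := hS.toFinset)]
  · rw [← Real.log_prod (fun v _ => (FinitePlace.pos_iff.mpr hx).ne'), h1]
    rw [← Real.log_inv]
    simp
  · intro v hv
    simp only [Set.Finite.coe_toFinset]
    intro h
    apply hv
    have h' : v x = 1 := h
    simp [h']

theorem prodFormula {K : Type*} [Field K] [NumberField K] (x : K) (hx : x ≠ 0) :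
    ∑ v : InfinitePlace K, (v.mult : ℝ) * Real.log (v x) + ∑ᶠ v : FinitePlace K, Real.log (v x) = 0 := by
  rw [finsum_log x hx]
  have h := InfinitePlace.prod_eq_abs_norm x
  have h2 := congrArg Real.log h
  rw [Real.log_prod (fun v _ => pow_ne_zero _ (InfinitePlace.pos_iff.mpr hx).ne')] at h2
  simp only [Real.log_pow] at h2
  rw [h2]
  simp

theorem weil_le {K : Type*} [Field K] [NumberField K] [IsGalois ℚ K] (α : K) :
    (Fintype.card (K ≃ₐ[ℚ] K) : ℝ) ^ 2 *
    ((Real.log (((minpoly ℚ α).support.lcm fun i => ((minpoly ℚ α).coeff i).den : ℕ) : ℝ) +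
      (((minpoly ℚ α).aroots ℂ).map fun z => Real.log (max 1 ‖z‖)).sum) /
    ((minpoly ℚ α).natDegree : ℝ)) ≤ ∑ σ : K ≃ₐ[ℚ] K, logHeight₁ (σ α) := by
  classical
  obtain ⟨e, hed, hF⟩ := galProd α
  have hinteg : IsIntegral ℚ α := IsIntegral.of_finite ℚ α
  set m := minpoly ℚ α with hm
  have hmon : m.Monic := minpoly.monic hinteg
  obtain ⟨g, hg, l, hl0, hgl, hlcm⟩ := primPoly m hmon
  have hd : 0 < m.natDegree := minpoly.natDegree_pos hinteg
  set A := ((m.aroots ℂ).map fun z => Real.log (max 1 ‖z‖)).sum with hA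
  have hN : Fintype.card (K ≃ₐ[ℚ] K) = Module.finrank ℚ K := by
    rw [← IsGalois.card_aut_eq_finrank, Nat.card_eq_fintype_card]
  -- archimedean
  have harch : ∀ v : InfinitePlace K, ∑ σ : K ≃ₐ[ℚ] K, Real.posLog (v (σ α)) = e * A := by
    intro v
    have h1 := congrArg (fun p => (p.map v.embedding).roots) hF
    simp only [Polynomial.map_prod, Polynomial.map_sub, map_X, map_C, Polynomial.map_pow, roots_pow,
      Polynomial.map_map] at h1
    have h0 : (∏ σ : K ≃ₐ[ℚ] K, (X - C (v.embedding (σ α)))).roots =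
        Finset.univ.val.map (fun σ : K ≃ₐ[ℚ] K => v.embedding (σ α)) := by
      rw [← roots_multiset_prod_X_sub_C (Finset.univ.val.map (fun σ : K ≃ₐ[ℚ] K => v.embedding (σ α)))]
      rw [Multiset.map_map]; rfl
    rw [h0] at h1
    have hcomp : v.embedding.comp (algebraMap ℚ K) = algebraMap ℚ ℂ := RingHom.ext_rat _ _
    rw [hcomp] at h1
    have h2 := congrArg (fun s : Multiset ℂ => (s.map fun z => Real.log (max 1 ‖z‖)).sum) h1
    simp only [Multiset.map_map, Multiset.map_nsmul, Multiset.sum_nsmul] at h2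
    rw [nsmul_eq_mul] at h2
    rw [hA, aroots_def, ← h2]
    change _ = ∑ σ : K ≃ₐ[ℚ] K, Real.log (max 1 ‖v.embedding (σ α)‖)
    refine Finset.sum_congr rfl fun σ _ => ?_
    rw [InfinitePlace.norm_embedding_eq, Real.posLog_eq_log_max_one (apply_nonneg _ _)]
  have hfin : ∀ v : FinitePlace K, - (e * Real.log (v (l : K))) ≤ ∑ σ : K ≃ₐ[ℚ] K, Real.posLog (v (σ α)) := by
    intro v
    have hge : ∀ e : ℕ, (g ^ e).IsPrimitive := by
      intro e
      induction e with
      | zero => rw [pow_zero]; exact isPrimitive_one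
      | succ k ih => rw [pow_succ]; exact ih.mul hg
    obtain ⟨j, hj⟩ := primCoef v (g ^ e) (hge e)
    have h1 : (g ^ e).map (Int.castRingHom K) = C ((l : K) ^ e) * ∏ σ : K ≃ₐ[ℚ] K, (X - C (σ α)) := by
      rw [hF, Polynomial.map_pow, C_pow, ← mul_pow]
      congr 1
      have := congrArg (Polynomial.map (algebraMap ℚ K)) hgl
      rw [Polynomial.map_map, show (algebraMap ℚ K).comp (Int.castRingHom ℚ) = Int.castRingHom K from RingHom.ext_int _ _] at this
      simpa using this
    have h2 : (((g ^ e).coeff j : ℤ) : K) = (l : K) ^ e * (∏ σ : K ≃ₐ[ℚ] K, (X - C (σ α))).coeff j := by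
      rw [← coeff_C_mul, ← h1, coeff_map]; simp
    rw [h2, map_mul, map_pow] at hj
    have hlv : 0 < v (l : K) := FinitePlace.pos_iff.mpr (by exact_mod_cast hl0)
    have h3 : 1 ≤ v (l : K) ^ e * ∏ σ : K ≃ₐ[ℚ] K, max 1 (v (σ α)) :=
      hj.trans (mul_le_mul_of_nonneg_left (coefBound v _ _ j) (by positivity))
    have hmp : ∀ σ : K ≃ₐ[ℚ] K, max 1 (v (σ α)) ≠ 0 := fun σ => (zero_lt_one.trans_le (le_max_left _ _)).ne'
    have h4 := Real.log_nonneg h3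
    rw [Real.log_mul (by positivity) (Finset.prod_ne_zero_iff.mpr fun σ _ => hmp σ), Real.log_pow,
      Real.log_prod (fun σ _ => hmp σ)] at h4
    have h5 : ∑ σ : K ≃ₐ[ℚ] K, Real.posLog (v (σ α)) = ∑ σ : K ≃ₐ[ℚ] K, Real.log (max 1 (v (σ α))) :=
      Finset.sum_congr rfl fun σ _ => Real.posLog_eq_log_max_one (apply_nonneg _ _)
    rw [h5]; linarith
  have hl0K : (l : K) ≠ 0 := by exact_mod_cast hl0
  have hfinsum : (e : ℝ) * Fintype.card (K ≃ₐ[ℚ] K) * Real.log |(l:ℝ)| ≤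
      ∑ σ : K ≃ₐ[ℚ] K, ∑ᶠ v : FinitePlace K, Real.posLog (v (σ α)) := by
    have hS : (⋃ σ : K ≃ₐ[ℚ] K, Function.support fun v : FinitePlace K => Real.posLog (v (σ α))).Finite :=
      Set.finite_iUnion fun σ => posLog_support _
    have hS2 := hS.union (log_support (l : K))
    set S := hS2.toFinset with hSd
    have h1 : ∀ σ : K ≃ₐ[ℚ] K, ∑ᶠ v : FinitePlace K, Real.posLog (v (σ α)) = ∑ v ∈ S, Real.posLog (v (σ α)) := by
      intro σ
      apply finsum_eq_sum_of_support_subset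
      intro v hv
      rw [hSd, Set.Finite.coe_toFinset]
      exact Or.inl (Set.mem_iUnion.mpr ⟨σ, hv⟩)
    have h2 : ∑ᶠ v : FinitePlace K, Real.log (v (l : K)) = ∑ v ∈ S, Real.log (v (l : K)) := by
      apply finsum_eq_sum_of_support_subset
      intro v hv
      rw [hSd, Set.Finite.coe_toFinset]
      exact Or.inr hv
    rw [finsum_log _ hl0K] at h2
    have h3 : (Algebra.norm ℚ (l : K)) = (l : ℚ) ^ Module.finrank ℚ K := by
      have := Algebra.norm_algebraMap (R := ℚ) (S := K) (l : ℚ)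
      simpa using this
    rw [h3, ← hN] at h2
    simp only [h1]
    rw [Finset.sum_comm]
    refine le_trans ?_ (Finset.sum_le_sum fun v _ => hfin v)
    rw [Finset.sum_neg_distrib, ← Finset.mul_sum, ← h2]
    push_cast
    rw [abs_pow, Real.log_pow]
    apply le_of_eq; ring
  have harchsum : ∑ σ : K ≃ₐ[ℚ] K, ∑ v : InfinitePlace K, (v.mult : ℝ) * Real.posLog (v (σ α)) =
      Fintype.card (K ≃ₐ[ℚ] K) * (e * A) := by
    rw [Finset.sum_comm]
    simp only [← Finset.mul_sum, harch]
    rw [← Finset.sum_mul, hN, ← InfinitePlace.sum_mult_eq]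
    push_cast; rfl
  simp only [NumberField.logHeight₁_eq, Finset.sum_add_distrib]
  rw [harchsum]
  have hlog : Real.log ((m.support.lcm fun i => (m.coeff i).den : ℕ) : ℝ) ≤ Real.log |(l : ℝ)| := by
    apply Real.log_le_log _ hlcm
    have : 0 < m.support.lcm fun i => (m.coeff i).den := by
      rw [Nat.pos_iff_ne_zero, Ne, Finset.lcm_eq_zero_iff]
      rintro ⟨i, _, hi⟩
      exact (m.coeff i).den_ne_zero hi
    exact_mod_cast this
  have hdR : (0:ℝ) < m.natDegree := by exact_mod_cast hd
  have hedR : (e : ℝ) * m.natDegree = Fintype.card (K ≃ₐ[ℚ] K) := by exact_mod_cast hed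
  have hq : ∀ y : ℝ, (Fintype.card (K ≃ₐ[ℚ] K) : ℝ) ^ 2 * (y / m.natDegree) = Fintype.card (K ≃ₐ[ℚ] K) * e * y := by
    intro y; rw [← hedR]; field_simp
  rw [hq]
  have : (0:ℝ) ≤ Fintype.card (K ≃ₐ[ℚ] K) * e := by positivity
  nlinarith [mul_le_mul_of_nonneg_left hlog this]
end D2

section D3
open NumberField Height

theorem place_est {K : Type*} [Field K] (v : AbsoluteValue K ℝ) {n a t N : ℕ} (ht : 1 ≤ t) (e : Fin N → Fin n → ℤ)
    (η M κ₁ κ₂ : ℝ) (hM : 1 ≤ M) (h1 : 1 ≤ κ₁) (h2 : 1 ≤ κ₂)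
    (hs1 : ∀ (f : Fin N → K) (B : ℝ), 0 ≤ B → (∀ b, v (f b) ≤ B) → v (∑ b, f b) ≤ κ₁ * B)
    (hs2 : ∀ (f : Fin (a+1) → K) (B : ℝ), 0 ≤ B → (∀ b, v (f b) ≤ B) → v (∑ b, f b) ≤ κ₂ * B)
    (c : Fin (a+1) → Fin N → K) (hc : ∀ j b, v (c j b) ≤ M)
    (P : Fin n → K) (hP : ∀ i, P i ≠ 0)
    (hdir : ∀ b, ∑ i, (e b i : ℝ) * Real.log (v (P i)) ≤ η * ∑ i, |Real.log (v (P i))|)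
    (i : Fin n) (J : Fin (a+1)) (hJ : ∑ b, c J b * mono P (e b) ≠ 0)
    (hJt : ∀ j, J < j → ∑ b, c j b * mono P (e b) = 0)
    (hrel : ∑ j, (∑ b, c j b * mono P (e b)) * P i ^ (t * (j:ℕ)) = 0) :
    t * Real.posLog (v (P i)) + Real.log (v (∑ b, c J b * mono P (e b))) ≤
      Real.log (κ₁ * κ₂ * M) + η * ∑ i, |Real.log (v (P i))| := by
  classical
  set S := η * ∑ i, |Real.log (v (P i))| with hS
  have hvP : ∀ i, 0 < v (P i) := fun i => v.pos (hP i)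
  have hmono : ∀ b, v (mono P (e b)) ≤ Real.exp S := by
    intro b
    have : v (mono P (e b)) = Real.exp (∑ i, (e b i : ℝ) * Real.log (v (P i))) := by
      rw [mono, map_prod, Real.exp_sum]
      refine Finset.prod_congr rfl fun i _ => ?_
      rw [map_zpow₀, mul_comm, Real.exp_mul, Real.exp_log (hvP i), Real.rpow_intCast]
    rw [this]; exact Real.exp_le_exp.mpr (hdir b)
  have hg : ∀ j, v (∑ b, c j b * mono P (e b)) ≤ κ₁ * (M * Real.exp S) := by
    intro j
    apply hs1 _ _ (by positivity)
    intro b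
    rw [map_mul]
    exact mul_le_mul (hc j b) (hmono b) (apply_nonneg _ _) (by positivity)
  set g : Fin (a+1) → K := fun j => ∑ b, c j b * mono P (e b) with hgdef
  change t * Real.posLog (v (P i)) + Real.log (v (g J)) ≤ _
  change ∀ j, v (g j) ≤ _ at hg
  change ∑ j, g j * P i ^ (t * (j:ℕ)) = 0 at hrel
  have hgJ : 0 < v (g J) := v.pos hJ
  have hbase : Real.log (κ₁ * κ₂ * M) + S = Real.log (κ₁ * κ₂ * M * Real.exp S) := by
    rw [Real.log_mul (x := κ₁ * κ₂ * M) (y := Real.exp S) (by positivity) (by positivity), Real.log_exp]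
  have hk : κ₁ * (M * Real.exp S) ≤ κ₁ * κ₂ * M * Real.exp S := by
    have : 0 ≤ κ₁ * (M * Real.exp S) := by positivity
    nlinarith
  rw [hbase]
  rcases le_or_gt (v (P i)) 1 with hle | hgt
  · have : Real.posLog (v (P i)) = 0 := by
      rw [Real.posLog_eq_zero_iff, abs_of_pos (hvP i)]; exact hle
    rw [this, mul_zero, zero_add]
    exact Real.log_le_log hgJ ((hg J).trans hk)
  · have hpl : Real.posLog (v (P i)) = Real.log (v (P i)) := by
      apply Real.posLog_eq_log; rw [abs_of_pos (hvP i)]; exact hgt.le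
    rw [hpl, ← Real.log_pow, ← Real.log_mul (by positivity) (by positivity)]
    apply Real.log_le_log (by positivity)
    have hJpos : 0 < (J : ℕ) := by
      by_contra h0
      have hJ0 : J = 0 := Fin.ext (by simpa using h0)
      rw [Finset.sum_eq_single J] at hrel
      · rcases mul_eq_zero.mp hrel with h | h
        · exact hJ h
        · exact (pow_ne_zero _ (hP i)) h
      · intro j _ hj
        have : J < j := by rw [hJ0]; exact Fin.pos_iff_ne_zero.mpr (hJ0 ▸ hj)
        change g j * _ = 0
        rw [show g j = 0 from hJt j this, zero_mul]
      · intro h; exact absurd (Finset.mem_univ _) h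
    have hrew : g J * P i ^ (t * (J:ℕ)) = - ∑ j, (if j = J then 0 else g j * P i ^ (t * (j:ℕ))) := by
      rw [← Finset.add_sum_erase _ _ (Finset.mem_univ J)] at hrel
      rw [← Finset.add_sum_erase _ _ (Finset.mem_univ J), if_pos rfl, zero_add,
        Finset.sum_congr rfl (g := fun j => g j * P i ^ (t * (j:ℕ)))]
      · exact eq_neg_of_add_eq_zero_left hrel
      · intro j hj; rw [if_neg (Finset.ne_of_mem_erase hj)]
    have hb := hs2 (fun j => if j = J then 0 else g j * P i ^ (t * (j:ℕ)))
      (κ₁ * (M * Real.exp S) * v (P i) ^ (t * ((J:ℕ) - 1))) (by positivity) (by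
        intro j
        split_ifs with h
        · rw [map_zero]; positivity
        · rcases lt_or_ge J j with h' | h'
          · rw [show g j = 0 from hJt j h', zero_mul, map_zero]; positivity
          · have hlt : (j : ℕ) < J := lt_of_le_of_ne h' (fun h'' => h (Fin.ext h''))
            rw [map_mul, map_pow]
            refine mul_le_mul (hg j) ?_ (by positivity) (by positivity)
            apply pow_le_pow_right₀ hgt.le
            exact Nat.mul_le_mul_left _ (by omega))
    rw [← v.map_neg, ← hrew, map_mul, map_pow] at hb
    have he : t * (J:ℕ) = t + t * ((J:ℕ) - 1) := by
      obtain ⟨k, hk⟩ := Nat.exists_eq_add_of_lt hJpos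
      rw [hk]; simp; ring
    rw [he, pow_add] at hb
    have hp : 0 < v (P i) ^ (t * ((J:ℕ) - 1)) := by positivity
    have : (v (P i) ^ t * v (g J)) * v (P i) ^ (t * ((J:ℕ) - 1)) ≤ (κ₁ * κ₂ * M * Real.exp S) * v (P i) ^ (t * ((J:ℕ) - 1)) := by
      calc _ = v (g J) * (v (P i) ^ t * v (P i) ^ (t * ((J:ℕ) - 1))) := by ring
        _ ≤ _ := hb
        _ = _ := by ring
    exact le_of_mul_le_mul_right this hp

theorem fin_le_one {K : Type*} [Field K] [NumberField K] (v : FinitePlace K) (x : K) (hx : IsIntegral ℤ x) : v x ≤ 1 := by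
  rw [← FinitePlace.norm_embedding_eq]
  exact FinitePlace.norm_le_one K v.maximalIdeal (⟨x, hx⟩ : 𝓞 K)

theorem abs_log_posLog (x : ℝ) : |Real.log x| = Real.posLog x + Real.posLog x⁻¹ := by
  change _ = max 0 (Real.log x) + max 0 (Real.log x⁻¹)
  rw [Real.log_inv]
  rcases le_total 0 (Real.log x) with h | h
  · rw [abs_of_nonneg h, max_eq_right h, max_eq_left (by linarith), add_zero]
  · rw [abs_of_nonpos h, max_eq_left h, max_eq_right (by linarith), zero_add]

theorem K_level {K : Type*} [Field K] [NumberField K] {n a t N : ℕ} (ht : 1 ≤ t) (e : Fin N → Fin n → ℤ)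
    (η M : ℝ) (hη : 0 ≤ η) (h4 : 4 * n * η ≤ t) (hM : 1 ≤ M)
    (c : Fin n → Fin (a+1) → Fin N → K) (hinteg : ∀ i j b, IsIntegral ℤ (c i j b))
    (hc : ∀ (v : InfinitePlace K) i j b, v (c i j b) ≤ M)
    (P : Fin n → K) (hP : ∀ i, P i ≠ 0)
    (hdir : ∀ b, ∀ ℓ : Fin n → ℝ, (∀ l : Fin n → ℤ, mono P l = 1 → ∑ i, (l i : ℝ) * ℓ i = 0) →
      ∑ i, (e b i : ℝ) * ℓ i ≤ η * ∑ i, |ℓ i|)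
    (hne : ∀ i, ∃ j, ∑ b, c i j b * mono P (e b) ≠ 0)
    (hrel : ∀ i, ∑ j, (∑ b, c i j b * mono P (e b)) * P i ^ (t * (j:ℕ)) = 0) :
    t * ∑ i, logHeight₁ (P i) ≤ 2 * (n * (Module.finrank ℚ K * Real.log ((N+1) * (a+1) * M))) := by
  classical
  have hloc : ∀ v : AbsoluteValue K ℝ, ∀ b, ∑ i, (e b i : ℝ) * Real.log (v (P i)) ≤ η * ∑ i, |Real.log (v (P i))| := by
    intro v b
    apply hdir
    intro l hl
    have h := congrArg (fun x => Real.log (v x)) hl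
    simp only [map_one, Real.log_one] at h
    rw [mono, map_prod, Real.log_prod (fun i _ => (v.pos (zpow_ne_zero _ (hP i))).ne')] at h
    rw [← h]
    refine Finset.sum_congr rfl fun i _ => ?_
    rw [map_zpow₀, Real.log_zpow]
  have hsum : ∀ i, t * logHeight₁ (P i) ≤ Module.finrank ℚ K * Real.log ((N+1) * (a+1) * M) +
      2 * η * ∑ i, logHeight₁ (P i) := by
    intro i
    -- top index
    have hex : (Finset.univ.filter fun j => ∑ b, c i j b * mono P (e b) ≠ 0).Nonempty := by
      obtain ⟨j, hj⟩ := hne i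
      exact ⟨j, by simpa using hj⟩
    set J := Finset.max' _ hex with hJd
    have hJm := Finset.max'_mem _ hex
    have hJ : ∑ b, c i J b * mono P (e b) ≠ 0 := (Finset.mem_filter.mp hJm).2
    have hJt : ∀ j, J < j → ∑ b, c i j b * mono P (e b) = 0 := by
      intro j hj
      by_contra h
      exact absurd (Finset.le_max' _ j (by simpa using h)) (not_le.mpr hj)
    set g := ∑ b, c i J b * mono P (e b) with hg
    have hinf : ∀ v : InfinitePlace K, t * Real.posLog (v (P i)) + Real.log (v g) ≤
        Real.log ((N+1) * (a+1) * M) + η * ∑ i, |Real.log (v (P i))| := by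
      intro v
      have gen : ∀ (m : ℕ) (f : Fin m → K) (B : ℝ), 0 ≤ B → (∀ b, v.1 (f b) ≤ B) → v.1 (∑ b, f b) ≤ (m:ℝ) * B := by
        intro m f B hB hf
        refine (v.1.sum_le _ _).trans ((Finset.sum_le_sum fun b _ => hf b).trans ?_)
        simp
      refine place_est v.1 ht e η M (N+1) (a+1) hM (by simp) (by simp) ?_ ?_ (c i) (fun j b => hc v i j b) P hP
        (hloc v.1) i J hJ hJt (hrel i)
      · intro f B hB hf
        refine (gen N f B hB hf).trans ?_
        nlinarith
      · intro f B hB hf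
        have := gen _ f B hB hf
        push_cast at this; exact this
    have hfin : ∀ v : FinitePlace K, t * Real.posLog (v (P i)) + Real.log (v g) ≤
        η * ∑ i, |Real.log (v (P i))| := by
      intro v
      have gen : ∀ (m : ℕ) (f : Fin m → K) (B : ℝ), 0 ≤ B → (∀ b, v.1 (f b) ≤ B) → v.1 (∑ b, f b) ≤ 1 * B := by
        intro m f B hB hf
        rw [one_mul]
        induction m with
        | zero => simpa using hB
        | succ k ih =>
          rw [Fin.sum_univ_succ]
          exact (FinitePlace.add_le v _ _).trans (max_le (hf 0) (ih _ fun b => hf b.succ))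
      have := place_est v.1 ht e η 1 1 1 le_rfl le_rfl le_rfl (gen N) (gen _) (c i) (fun j b => by
          exact fin_le_one v _ (hinteg i j b)) P hP
        (hloc v.1) i J hJ hJt (hrel i)
      simp only [mul_one, Real.log_one, zero_add] at this
      exact this
    -- global sum
    have hS1 : (⋃ k : Fin n, Function.support fun v : FinitePlace K => Real.posLog (v (P k))).Finite :=
      Set.finite_iUnion fun σ => posLog_support _
    have hS2 : (⋃ k : Fin n, Function.support fun v : FinitePlace K => Real.posLog (v (P k))⁻¹).Finite :=
      Set.finite_iUnion fun σ => by
        have := posLog_support (P σ)⁻¹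
        simpa only [map_inv₀] using this
    have hS3 := (hS1.union hS2).union (log_support g)
    set S := hS3.toFinset with hSd
    have hH1 : ∀ k, logHeight₁ (P k) = ∑ v : InfinitePlace K, (v.mult : ℝ) * Real.posLog (v (P k)) + ∑ v ∈ S, Real.posLog (v (P k)) := by
      intro k
      rw [NumberField.logHeight₁_eq]
      congr 1
      apply finsum_eq_sum_of_support_subset
      intro v hv
      rw [hSd, Set.Finite.coe_toFinset]
      exact Or.inl (Or.inl (Set.mem_iUnion.mpr ⟨k, hv⟩))
    have hH2 : ∀ k, logHeight₁ (P k) = ∑ v : InfinitePlace K, (v.mult : ℝ) * Real.posLog (v (P k))⁻¹ + ∑ v ∈ S, Real.posLog (v (P k))⁻¹ := by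
      intro k
      rw [← Height.logHeight₁_inv, NumberField.logHeight₁_eq]
      simp only [map_inv₀]
      congr 1
      apply finsum_eq_sum_of_support_subset
      intro v hv
      rw [hSd, Set.Finite.coe_toFinset]
      exact Or.inl (Or.inr (Set.mem_iUnion.mpr ⟨k, hv⟩))
    have hg0 : ∑ v : InfinitePlace K, (v.mult : ℝ) * Real.log (v g) + ∑ v ∈ S, Real.log (v g) = 0 := by
      rw [← prodFormula g hJ]
      congr 1
      symm
      apply finsum_eq_sum_of_support_subset
      intro v hv
      rw [hSd, Set.Finite.coe_toFinset]
      exact Or.inr hv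
    have hdeg : ∑ v : InfinitePlace K, (v.mult : ℝ) = Module.finrank ℚ K := by
      rw [← InfinitePlace.sum_mult_eq]; push_cast; rfl
    have i1 := Finset.sum_le_sum fun v (_ : v ∈ (Finset.univ : Finset (InfinitePlace K))) =>
      mul_le_mul_of_nonneg_left (hinf v) (Nat.cast_nonneg (α := ℝ) v.mult)
    have i2 := Finset.sum_le_sum fun v (_ : v ∈ S) => hfin v
    have habs : ∑ v : InfinitePlace K, (v.mult : ℝ) * (∑ k, |Real.log (v (P k))|) + ∑ v ∈ S, ∑ k, |Real.log (v (P k))|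
        = 2 * ∑ k, logHeight₁ (P k) := by
      simp only [Finset.mul_sum]
      rw [Finset.sum_comm, Finset.sum_comm (s := S), ← Finset.sum_add_distrib]
      refine Finset.sum_congr rfl fun k _ => ?_
      rw [two_mul]
      nth_rw 1 [hH1 k]
      rw [hH2 k]
      simp only [abs_log_posLog, mul_add, Finset.sum_add_distrib]
      ring
    set LC := Real.log ((N+1) * (a+1) * M) with hLC
    simp only [mul_add, Finset.sum_add_distrib] at i1 i2
    rw [← Finset.sum_mul, hdeg] at i1
    have e1 : ∑ v : InfinitePlace K, (v.mult : ℝ) * (t * Real.posLog (v (P i))) = t * ∑ v : InfinitePlace K, (v.mult : ℝ) * (Real.posLog (v (P i))) := by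
      rw [Finset.mul_sum]; exact Finset.sum_congr rfl fun v _ => by ring
    have e2 : ∑ v : InfinitePlace K, (v.mult : ℝ) * (η * ∑ k, |Real.log (v (P k))|) = η * ∑ v : InfinitePlace K, (v.mult : ℝ) * (∑ k, |Real.log (v (P k))|) := by
      rw [Finset.mul_sum]; exact Finset.sum_congr rfl fun v _ => by ring
    rw [e1, e2] at i1
    rw [← Finset.mul_sum, ← Finset.mul_sum] at i2
    rw [mul_comm 2 η, mul_assoc η, ← habs, hH1 i]
    linarith
  have hall := Finset.sum_le_sum fun i (_ : i ∈ (Finset.univ : Finset (Fin n))) => hsum i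
  rw [← Finset.mul_sum, Finset.sum_const, Finset.card_univ, Fintype.card_fin, nsmul_eq_mul] at hall
  have hpos : 0 ≤ ∑ i, logHeight₁ (P i) := Finset.sum_nonneg fun i _ => Height.zero_le_logHeight₁ _
  nlinarith [mul_le_mul_of_nonneg_right h4 hpos]
end D3

section D4
open NumberField Height

instance qbar_isAlgebraic : Algebra.IsAlgebraic ℚ Qbar := by
  refine ⟨fun x => ?_⟩
  obtain ⟨p, hp, hx⟩ := (AlgebraicClosure.isAlgebraic ℚ).isAlgebraic x
  refine ⟨p, hp, ?_⟩
  rw [Polynomial.aeval_def] at hx ⊢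
  rw [← hx]
  congr 1

instance qbar_normal : Normal ℚ Qbar where
  splits' x := IsAlgClosed.splits _

theorem exists_galois_field (T : Set Qbar) (hT : T.Finite) : ∃ K : IntermediateField ℚ Qbar,
    T ⊆ K ∧ FiniteDimensional ℚ K ∧ IsGalois ℚ K := by
  let L := IntermediateField.adjoin ℚ T
  haveI : FiniteDimensional ℚ L := by
    haveI := hT.to_subtype
    exact IntermediateField.finiteDimensional_adjoin fun x _ => (Algebra.IsAlgebraic.isAlgebraic x).isIntegral
  refine ⟨IntermediateField.normalClosure ℚ L Qbar, ?_, inferInstance, ?_⟩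
  · exact (IntermediateField.subset_adjoin ℚ T).trans L.le_normalClosure
  · haveI : Normal ℚ (IntermediateField.normalClosure ℚ L Qbar) := normalClosure.normal ℚ L Qbar
    exact ⟨⟩

theorem height_int {n a t N : ℕ} (ht : 1 ≤ t) (e : Fin N → Fin n → ℤ)
    (η : ℝ) (hη : 0 ≤ η) (h4 : 4 * n * η ≤ t)
    (c : Fin n → Fin (a+1) → Fin N → Qbar) (hinteg : ∀ i j b, IsIntegral ℤ (c i j b)) :
    ∃ B : ℝ, ∀ P : Fin n → Qbar, (∀ i, P i ≠ 0) →
    (∀ b, ∀ ℓ : Fin n → ℝ, (∀ l : Fin n → ℤ, mono P l = 1 → ∑ i, (l i : ℝ) * ℓ i = 0) →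
      ∑ i, (e b i : ℝ) * ℓ i ≤ η * ∑ i, |ℓ i|) →
    (∀ i, ∃ j, ∑ b, c i j b * mono P (e b) ≠ 0) →
    (∀ i, ∑ j, (∑ b, c i j b * mono P (e b)) * P i ^ (t * (j:ℕ)) = 0) →
    ∑ i, weilHeight (P i) ≤ B := by
  classical
  set M : ℝ := 1 + ∑ i, ∑ j, ∑ b, (((minpoly ℚ (c i j b)).aroots ℂ).map fun z => ‖z‖).sum with hMd
  have hnn : ∀ i j b, 0 ≤ (((minpoly ℚ (c i j b)).aroots ℂ).map fun z => ‖z‖).sum := by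
    intro i j b
    apply Multiset.sum_nonneg
    intro x hx
    obtain ⟨z, _, rfl⟩ := Multiset.mem_map.mp hx
    exact norm_nonneg z
  have hM1 : 1 ≤ M := by
    rw [hMd]
    have : 0 ≤ ∑ i, ∑ j, ∑ b, (((minpoly ℚ (c i j b)).aroots ℂ).map fun z => ‖z‖).sum :=
      Finset.sum_nonneg fun i _ => Finset.sum_nonneg fun j _ => Finset.sum_nonneg fun b _ => hnn i j b
    linarith
  have hMz : ∀ i j b (z : ℂ), z ∈ (minpoly ℚ (c i j b)).aroots ℂ → ‖z‖ ≤ M := by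
    intro i j b z hz
    have h1 : ‖z‖ ≤ (((minpoly ℚ (c i j b)).aroots ℂ).map fun z => ‖z‖).sum := by
      apply Multiset.single_le_sum
      · intro x hx
        obtain ⟨z, _, rfl⟩ := Multiset.mem_map.mp hx
        exact norm_nonneg z
      · exact Multiset.mem_map.mpr ⟨z, hz, rfl⟩
    have h2 := Finset.single_le_sum (fun b _ => hnn i j b) (Finset.mem_univ b)
    have h3 := Finset.single_le_sum (f := fun j => ∑ b, (((minpoly ℚ (c i j b)).aroots ℂ).map fun z => ‖z‖).sum)
      (fun j _ => Finset.sum_nonneg fun b _ => hnn i j b) (Finset.mem_univ j)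
    have h4 := Finset.single_le_sum (f := fun i => ∑ j, ∑ b, (((minpoly ℚ (c i j b)).aroots ℂ).map fun z => ‖z‖).sum)
      (fun i _ => Finset.sum_nonneg fun j _ => Finset.sum_nonneg fun b _ => hnn i j b) (Finset.mem_univ i)
    rw [hMd]; linarith
  set LC := Real.log ((N+1) * (a+1) * M) with hLC
  have hLC0 : 0 ≤ LC := by
    apply Real.log_nonneg
    have h1 : (1:ℝ) ≤ N + 1 := by simp
    have h2 : (1:ℝ) ≤ a + 1 := by simp
    exact one_le_mul_of_one_le_of_one_le (one_le_mul_of_one_le_of_one_le h1 h2) hM1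
  refine ⟨2 * (n * LC), fun P hP hdir hne hrel => ?_⟩
  obtain ⟨K, hK, hfd, hgal⟩ := exists_galois_field (Set.range P ∪ Set.range fun p : Fin n × Fin (a+1) × Fin N => c p.1 p.2.1 p.2.2)
    ((Set.finite_range _).union (Set.finite_range _))
  haveI : NumberField K := ⟨⟩
  let P' : Fin n → K := fun i => ⟨P i, hK (Or.inl ⟨i, rfl⟩)⟩
  let c' : Fin n → Fin (a+1) → Fin N → K := fun i j b => ⟨c i j b, hK (Or.inr ⟨(i, j, b), rfl⟩)⟩
  have hP' : ∀ i, algebraMap K Qbar (P' i) = P i := fun i => rfl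
  have hc' : ∀ i j b, algebraMap K Qbar (c' i j b) = c i j b := fun i j b => rfl
  have hmono : ∀ l, algebraMap K Qbar (mono P' l) = mono P l := fun l => map_mono _ _ _
  have hinj := (algebraMap K Qbar).injective
  have hg : ∀ i j, algebraMap K Qbar (∑ b, c' i j b * mono P' (e b)) = ∑ b, c i j b * mono P (e b) := by
    intro i j
    rw [map_sum]
    exact Finset.sum_congr rfl fun b _ => by rw [map_mul, hmono, hc']
  have hgs : ∀ (σ : K ≃ₐ[ℚ] K) i j, ∑ b, σ (c' i j b) * mono (fun k => σ (P' k)) (e b) = σ (∑ b, c' i j b * mono P' (e b)) := by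
    intro σ i j
    rw [map_sum]
    refine Finset.sum_congr rfl fun b _ => ?_
    rw [map_mul]
    congr 1
    exact (map_mono (σ : K →+* K) P' (e b)).symm
  have hcard : (Fintype.card (K ≃ₐ[ℚ] K) : ℝ) = Module.finrank ℚ K := by
    rw [← IsGalois.card_aut_eq_finrank, Nat.card_eq_fintype_card]
  have key : ∀ σ : K ≃ₐ[ℚ] K, t * ∑ i, logHeight₁ (σ (P' i)) ≤ 2 * (n * (Module.finrank ℚ K * LC)) := by
    intro σ
    refine K_level ht e η M hη h4 hM1 (fun i j b => σ (c' i j b)) ?_ ?_ (fun i => σ (P' i)) ?_ ?_ ?_ ?_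
    · intro i j b
      have h1 : IsIntegral ℤ (c' i j b) := by
        have := hinteg i j b
        rw [← hc'] at this
        exact (isIntegral_algebraMap_iff hinj).mp this
      exact h1.map (σ : K →+* K).toIntAlgHom
    · intro v i j b
      rw [← InfinitePlace.norm_embedding_eq]
      apply hMz i j b
      rw [Polynomial.mem_aroots]
      refine ⟨minpoly.ne_zero ((Algebra.IsAlgebraic.isAlgebraic (c i j b)).isIntegral), ?_⟩
      have h1 : minpoly ℚ (c i j b) = minpoly ℚ (c' i j b) := by
        rw [← hc', minpoly.algebraMap_eq hinj]
      rw [h1]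
      let τ : K →ₐ[ℚ] ℂ := (v.embedding.toRatAlgHom).comp (σ : K →ₐ[ℚ] K)
      have h2 : v.embedding (σ (c' i j b)) = τ (c' i j b) := rfl
      rw [h2, Polynomial.aeval_algHom_apply, minpoly.aeval, map_zero]
    · intro i h
      have : P' i = 0 := by simpa using h
      apply hP i
      rw [← hP', this, map_zero]
    · intro b ℓ hℓ
      apply hdir b ℓ
      intro l hl
      apply hℓ l
      have h1 : mono P' l = 1 := by
        apply hinj; rw [hmono, hl, map_one]
      have h2 := map_mono (σ : K →+* K) P' l
      rw [h1, map_one] at h2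
      exact h2.symm
    · intro i
      obtain ⟨j, hj⟩ := hne i
      refine ⟨j, ?_⟩
      rw [hgs]
      intro h
      apply hj
      rw [← hg]
      have : (∑ b, c' i j b * mono P' (e b)) = 0 := by
        apply σ.injective; rw [h, map_zero]
      rw [this, map_zero]
    · intro i
      simp only [hgs]
      have : ∑ j, (∑ b, c' i j b * mono P' (e b)) * P' i ^ (t * (j:ℕ)) = 0 := by
        apply hinj
        rw [map_sum, map_zero, ← hrel i]
        exact Finset.sum_congr rfl fun j _ => by rw [map_mul, hg, map_pow, hP']
      have h2 := congrArg σ this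
      rw [map_sum, map_zero] at h2
      rw [← h2]
      exact Finset.sum_congr rfl fun j _ => by rw [map_mul, map_pow]
  have hw : ∀ i, (Fintype.card (K ≃ₐ[ℚ] K) : ℝ) ^ 2 * weilHeight (P i) ≤ ∑ σ : K ≃ₐ[ℚ] K, logHeight₁ (σ (P' i)) := by
    intro i
    have h1 : minpoly ℚ (P i) = minpoly ℚ (P' i) := by
      rw [← hP', minpoly.algebraMap_eq hinj]
    rw [weilHeight, h1]
    exact weil_le (P' i)
  have hsum := Finset.sum_le_sum fun i (_ : i ∈ (Finset.univ : Finset (Fin n))) => hw i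
  rw [← Finset.mul_sum, Finset.sum_comm] at hsum
  have hk := Finset.sum_le_sum fun σ (_ : σ ∈ (Finset.univ : Finset (K ≃ₐ[ℚ] K))) => key σ
  rw [← Finset.mul_sum, Finset.sum_const, Finset.card_univ, nsmul_eq_mul, ← hcard] at hk
  set D : ℝ := (Fintype.card (K ≃ₐ[ℚ] K) : ℝ) with hD
  have hDpos : 0 < D := by rw [hD]; exact_mod_cast Fintype.card_pos
  set H := ∑ σ : K ≃ₐ[ℚ] K, ∑ i, logHeight₁ (σ (P' i)) with hH
  have hH0 : 0 ≤ H := Finset.sum_nonneg fun σ _ => Finset.sum_nonneg fun i _ => Height.zero_le_logHeight₁ _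
  have htR : (1:ℝ) ≤ t := by exact_mod_cast ht
  have h5 : H ≤ t * H := by nlinarith
  have h6 : D ^ 2 * ∑ i, weilHeight (P i) ≤ D ^ 2 * (2 * (n * LC)) := by
    calc _ ≤ H := hsum
      _ ≤ _ := h5
      _ ≤ _ := hk
      _ = _ := by ring
  exact le_of_mul_le_mul_left h6 (by positivity)

theorem height_main {n a t N : ℕ} (ht : 1 ≤ t) (e : Fin N → Fin n → ℤ)
    (η : ℝ) (hη : 0 ≤ η) (h4 : 4 * n * η ≤ t)
    (c : Fin n → Fin (a+1) → Fin N → Qbar) :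
    ∃ B : ℝ, ∀ P : Fin n → Qbar, (∀ i, P i ≠ 0) →
    (∀ b, ∀ ℓ : Fin n → ℝ, (∀ l : Fin n → ℤ, mono P l = 1 → ∑ i, (l i : ℝ) * ℓ i = 0) →
      ∑ i, (e b i : ℝ) * ℓ i ≤ η * ∑ i, |ℓ i|) →
    (∀ i, ∃ j, ∑ b, c i j b * mono P (e b) ≠ 0) →
    (∀ i, ∑ j, (∑ b, c i j b * mono P (e b)) * P i ^ (t * (j:ℕ)) = 0) →
    ∑ i, weilHeight (P i) ≤ B := by
  classical
  haveI : Algebra.IsAlgebraic ℤ ℚ := IsLocalization.isAlgebraic ℚ (nonZeroDivisors ℤ)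
  haveI : Algebra.IsAlgebraic ℤ Qbar := Algebra.IsAlgebraic.trans ℤ ℚ Qbar
  obtain ⟨y, hy0, hy⟩ := Algebra.IsAlgebraic.exists_integral_multiples (R := ℤ)
    (Finset.univ.image fun p : Fin n × Fin (a+1) × Fin N => c p.1 p.2.1 p.2.2)
  obtain ⟨B, hB⟩ := height_int ht e η hη h4 (fun i j b => y • c i j b)
    (fun i j b => hy _ (Finset.mem_image.mpr ⟨(i, j, b), Finset.mem_univ _, rfl⟩))
  refine ⟨B, fun P hP hdir hne hrel => hB P hP hdir ?_ ?_⟩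
  · intro i
    obtain ⟨j, hj⟩ := hne i
    refine ⟨j, ?_⟩
    simp only [smul_mul_assoc, ← Finset.smul_sum]
    exact smul_ne_zero hy0 hj
  · intro i
    simp only [smul_mul_assoc, ← Finset.smul_sum]
    rw [hrel i, smul_zero]
end D4

section E1
open MvPolynomial

theorem trdeg_quot_lt {k A : Type} [Field k] [CommRing A] [Algebra k A] [Algebra.FiniteType k A]
    (p q : Ideal A) [p.IsPrime] [q.IsPrime] (h : p < q) :
    Algebra.trdeg k (A ⧸ q) < Algebra.trdeg k (A ⧸ p) := by
  by_contra hle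
  push Not at hle
  obtain ⟨ι, x, hx⟩ := exists_isTranscendenceBasis' k (A ⧸ q)
  have hfin : Algebra.trdeg k (A ⧸ q) < Cardinal.aleph0 := trdeg_lt_aleph0_of_finiteType
  have hι : Cardinal.mk ι = Algebra.trdeg k (A ⧸ q) := hx.cardinalMk_eq_trdeg
  haveI : Finite ι := by rw [← Cardinal.lt_aleph0_iff_finite, hι]; exact hfin
  let f : (A ⧸ p) →ₐ[k] (A ⧸ q) := Ideal.Quotient.factorₐ k h.le
  have hf : Function.Surjective f := Ideal.Quotient.factor_surjective h.le
  choose y hy using fun i => hf (x i)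
  have hfy : f ∘ y = x := funext hy
  have hyi : AlgebraicIndependent k y := by
    apply AlgebraicIndependent.of_comp f
    rw [hfy]; exact hx.1
  have htb : IsTranscendenceBasis k y := hyi.isTranscendenceBasis_of_trdeg_le_of_finite (hle.trans hι.ge)
  obtain ⟨a, haq, hap⟩ := SetLike.exists_of_lt h
  have halg := htb.isAlgebraic.isAlgebraic (Ideal.Quotient.mk p a)
  have hker : (RingHom.ker (f : (A ⧸ p) →+* (A ⧸ q))).comap (algebraMap (Algebra.adjoin k (Set.range y)) (A ⧸ p)) ≠ ⊥ := by
    apply Ideal.comap_ne_bot_of_algebraic_mem (x := Ideal.Quotient.mk p a)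
    · rw [Ne, Ideal.Quotient.eq_zero_iff_mem]; exact hap
    · rw [RingHom.mem_ker]
      change f (Ideal.Quotient.mk p a) = 0
      exact Ideal.Quotient.eq_zero_iff_mem.mpr haq
    · exact halg
  apply hker
  rw [eq_bot_iff]
  rintro ⟨c, hc⟩ hc0
  rw [Ideal.mem_comap, RingHom.mem_ker] at hc0
  change f c = 0 at hc0
  rw [Algebra.adjoin_range_eq_range_aeval] at hc
  obtain ⟨P, rfl⟩ := hc
  have h1 : aeval x P = 0 := by
    rw [← hc0, ← hfy]
    change _ = f (aeval y P)
    exact (comp_aeval_apply (f := y) f P).symm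
  have hP := hx.1.eq_zero_of_aeval_eq_zero P h1
  rw [Ideal.mem_bot]
  apply Subtype.ext
  simp [hP]

theorem trdeg_frac {k A : Type} [Field k] [CommRing A] [IsDomain A] [Algebra k A] :
    Algebra.trdeg k (FractionRing A) = Algebra.trdeg k A := by
  obtain ⟨ι, x, hx⟩ := exists_isTranscendenceBasis' k A
  haveI : Algebra.IsAlgebraic A (FractionRing A) := IsLocalization.isAlgebraic _ (nonZeroDivisors A)
  have h2 := hx.algebraMap_comp (A := FractionRing A)
  rw [← hx.cardinalMk_eq_trdeg, ← h2.cardinalMk_eq_trdeg]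

theorem trdeg_mono_le {k F : Type} [Field k] [Field F] [Algebra k F] {n : ℕ} (ξ : Fin n → F) (hξ : ∀ i, ξ i ≠ 0)
    (hgen : IntermediateField.adjoin k (Set.range ξ) = ⊤) (B : Submodule ℤ (Fin n → ℤ))
    (hB : ∀ b ∈ B, mono ξ b ∈ (⊥ : IntermediateField k F)) :
    Algebra.trdeg k F + Module.finrank ℤ B ≤ n := by
  classical
  obtain ⟨J, hJ, hmax⟩ := exists_maximal_linearIndepOn ℤ (fun i : Fin n => B.mkQ (Pi.single i 1))
  have hcard : Nat.card J + Module.finrank ℤ B ≤ n := by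
    have h1 : Fintype.card J ≤ Module.finrank ℤ ((Fin n → ℤ) ⧸ B) := hJ.fintype_card_le_finrank
    have h2 := Submodule.finrank_quotient_add_finrank B
    rw [Module.finrank_fin_fun] at h2
    rw [Nat.card_eq_fintype_card]
    omega
  set K := IntermediateField.adjoin k (ξ '' J) with hK
  have halg : ∀ i, IsAlgebraic K (ξ i) := by
    intro i
    by_cases hi : i ∈ J
    · exact isAlgebraic_algebraMap (⟨ξ i, IntermediateField.subset_adjoin _ _ ⟨i, hi, rfl⟩⟩ : K)
    obtain ⟨a, ha, hspan⟩ := hmax i hi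
    have hmem : ∀ w ∈ Submodule.span ℤ ((fun i : Fin n => B.mkQ (Pi.single i 1)) '' J), ∀ m : Fin n → ℤ, B.mkQ m = w → mono ξ m ∈ K := by
      intro w hw
      induction hw using Submodule.span_induction with
      | mem x hx =>
        obtain ⟨j, hj, rfl⟩ := hx
        intro m hm
        have : m - Pi.single j 1 ∈ B := by
          rw [← Submodule.ker_mkQ B, LinearMap.mem_ker, map_sub, hm, sub_self]
        have h3 : mono ξ m = mono ξ (m - Pi.single j 1) * mono ξ (Pi.single j 1) := by
          rw [← mono_add hξ, sub_add_cancel]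
        rw [h3]
        refine K.mul_mem (bot_le (a := K) (hB _ this)) ?_
        have h4 : mono ξ (Pi.single j 1) = ξ j := by
          rw [mono, Finset.prod_eq_single j]
          · simp
          · intro i _ hi; simp [hi]
          · simp
        rw [h4]
        exact IntermediateField.subset_adjoin _ _ ⟨j, hj, rfl⟩
      | zero =>
        intro m hm
        have : m ∈ B := by rw [← Submodule.ker_mkQ B, LinearMap.mem_ker, hm]
        exact bot_le (a := K) (hB _ this)
      | add x y _ _ hx hy =>
        intro m hm
        obtain ⟨m', hm'⟩ := B.mkQ_surjective x
        have := hy (m - m') (by rw [map_sub, hm, hm']; abel)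
        have h3 : mono ξ m = mono ξ (m - m') * mono ξ m' := by
          rw [← mono_add hξ, sub_add_cancel]
        rw [h3]
        exact K.mul_mem this (hx m' hm')
      | smul c x _ hx =>
        intro m hm
        obtain ⟨m', hm'⟩ := B.mkQ_surjective x
        have : m - c • m' ∈ B := by
          rw [← Submodule.ker_mkQ B, LinearMap.mem_ker, map_sub, hm, map_smul, hm', sub_self]
        have h3 : mono ξ m = mono ξ (m - c • m') * mono ξ (c • m') := by
          rw [← mono_add hξ, sub_add_cancel]
        have h4 : mono ξ (c • m') = mono ξ m' ^ c := by
          simp only [mono, ← Finset.prod_zpow, Pi.smul_apply, smul_eq_mul]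
          exact Finset.prod_congr rfl fun i _ => by rw [mul_comm, zpow_mul]
        rw [h3, h4]
        exact K.mul_mem (bot_le (a := K) (hB _ this)) (zpow_mem (hx m' hm') c)
    have h5 := hmem _ hspan (a • Pi.single i 1) (by rw [map_smul])
    have h6 : mono ξ (a • Pi.single i 1) = ξ i ^ a := by
      rw [mono, Finset.prod_eq_single i]
      · simp
      · intro j _ hj; simp [hj]
      · simp
    rw [h6] at h5
    have hnat : ξ i ^ a.natAbs ∈ K := by
      rcases Int.natAbs_eq a with h | h
      · rw [h, zpow_natCast] at h5; exact h5
      · rw [h, zpow_neg, zpow_natCast] at h5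
        have := K.inv_mem h5
        rwa [inv_inv] at this
    have hpos : 0 < a.natAbs := Int.natAbs_pos.mpr ha
    exact IsAlgebraic.of_pow hpos (isAlgebraic_algebraMap (⟨_, hnat⟩ : K))
  have hall : Algebra.IsAlgebraic K F := by
    refine ⟨fun y => ?_⟩
    have hle : IntermediateField.adjoin k (Set.range ξ) ≤ (IntermediateField.restrictScalars k (algebraicClosure K F)) := by
      rw [IntermediateField.adjoin_le_iff]
      rintro _ ⟨i, rfl⟩
      exact (halg i).isIntegral
    rw [hgen] at hle
    have : y ∈ algebraicClosure K F := hle (IntermediateField.mem_top (x := y))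
    exact IsIntegral.isAlgebraic this
  haveI : Algebra.IsAlgebraic (Algebra.adjoin k (ξ '' J)) F := ⟨fun y => (isAlg_adjoin_iff _ y).mp (hall.isAlgebraic y)⟩
  have h7 : Algebra.trdeg k F ≤ Cardinal.mk (ξ '' J) := Algebra.IsAlgebraic.trdeg_le_cardinalMk k (ξ '' J)
  have h8 : Cardinal.mk (ξ '' J) ≤ Cardinal.mk J := Cardinal.mk_image_le
  have h9 : Cardinal.mk J = (Nat.card J : ℕ) := by
    rw [Nat.card_eq_fintype_card]; exact Cardinal.mk_fintype _
  calc Algebra.trdeg k F + Module.finrank ℤ B ≤ (Nat.card J : Cardinal) + (Module.finrank ℤ B : Cardinal) := by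
        gcongr; exact h7.trans (h8.trans h9.le)
    _ ≤ n := by exact_mod_cast hcard
end E1

section E2
open MvPolynomial

/-- Coordinates of a torus point. -/
abbrev cv {n : ℕ} (x : TorusPt n) : Fin n → Qbar := fun i => (x i : Qbar)

abbrev RR (n : ℕ) : Type := MvPolynomial (Fin n) Qbar

theorem cv_ne {n : ℕ} (x : TorusPt n) (i : Fin n) : cv x i ≠ 0 := Units.ne_zero _

def vI {n : ℕ} (Z : Set (TorusPt n)) : Ideal (RR n) where
  carrier := {f | ∀ x ∈ Z, eval (cv x) f = 0}
  zero_mem' := fun x _ => map_zero _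
  add_mem' := fun {f g} hf hg x hx => by rw [map_add, hf x hx, hg x hx, add_zero]
  smul_mem' := fun c f hf x hx => by rw [smul_eq_mul, map_mul, hf x hx, mul_zero]

theorem mem_vI {n : ℕ} {Z : Set (TorusPt n)} {f : RR n} : f ∈ vI Z ↔ ∀ x ∈ Z, eval (cv x) f = 0 := Iff.rfl

def zV {n : ℕ} (I : Ideal (RR n)) : Set (TorusPt n) := {x | ∀ f ∈ I, eval (cv x) f = 0}

theorem mem_zV {n : ℕ} {I : Ideal (RR n)} {x : TorusPt n} : x ∈ zV I ↔ ∀ f ∈ I, eval (cv x) f = 0 := Iff.rfl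

theorem zV_closed {n : ℕ} (I : Ideal (RR n)) : ZClosed (zV I) := ⟨I, rfl⟩

theorem zV_vI {n : ℕ} {Z : Set (TorusPt n)} (h : ZClosed Z) : zV (vI Z) = Z := by
  obtain ⟨I, rfl⟩ := h
  ext x
  constructor
  · intro hx f hf
    exact hx f fun y hy => hy f hf
  · intro hx f hf
    exact hf x hx

theorem vI_anti {n : ℕ} {Z W : Set (TorusPt n)} (h : Z ⊆ W) : vI W ≤ vI Z := fun _ hf x hx => hf x (h hx)

theorem zV_anti {n : ℕ} {I J : Ideal (RR n)} (h : I ≤ J) : zV J ⊆ zV I := fun _ hx f hf => hx f (h hf)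

theorem vI_lt {n : ℕ} {Z W : Set (TorusPt n)} (hZ : ZClosed Z) (h : Z ⊂ W) : vI W < vI Z := by
  refine lt_of_le_of_ne (vI_anti h.subset) fun he => ?_
  apply h.2
  intro x hx
  rw [← zV_vI hZ, ← he]
  exact fun f hf => hf x hx

noncomputable def mP {n : ℕ} (P : TorusPt n) : Ideal (RR n) := RingHom.ker (eval (cv P))

instance mP_prime {n : ℕ} (P : TorusPt n) : (mP P).IsPrime := RingHom.ker_isPrime _

theorem mem_mP {n : ℕ} {P : TorusPt n} {f : RR n} : f ∈ mP P ↔ eval (cv P) f = 0 := RingHom.mem_ker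

theorem mem_zV_iff {n : ℕ} {I : Ideal (RR n)} {x : TorusPt n} : x ∈ zV I ↔ I ≤ mP x :=
  ⟨fun h f hf => mem_mP.mpr (h f hf), fun h f hf => mem_mP.mp (h hf)⟩

theorem closed_single {n : ℕ} (f : RR n) : ZClosed {x : TorusPt n | eval (cv x) f = 0} :=
  ⟨{f}, by ext x; simp⟩

theorem closed_inter {n : ℕ} {Z W : Set (TorusPt n)} (hZ : ZClosed Z) (hW : ZClosed W) : ZClosed (Z ∩ W) := by
  obtain ⟨I, rfl⟩ := hZ
  obtain ⟨J, rfl⟩ := hW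
  refine ⟨I ∪ J, ?_⟩
  ext x
  constructor
  · rintro ⟨h1, h2⟩ f (hf | hf)
    · exact h1 f hf
    · exact h2 f hf
  · intro h
    exact ⟨fun f hf => h f (Or.inl hf), fun f hf => h f (Or.inr hf)⟩

theorem closed_union {n : ℕ} {Z W : Set (TorusPt n)} (hZ : ZClosed Z) (hW : ZClosed W) : ZClosed (Z ∪ W) := by
  refine ⟨(vI Z * vI W : Ideal (RR n)), ?_⟩
  ext x
  constructor
  · rintro (hx | hx) f hf
    · exact Ideal.mul_le_left (I := vI Z) (J := vI W) hf x hx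
    · exact Ideal.mul_le_right (I := vI Z) (J := vI W) hf x hx
  · intro h
    by_contra hx
    rw [Set.mem_union, not_or] at hx
    rw [← zV_vI hZ, ← zV_vI hW, mem_zV, mem_zV] at hx
    push Not at hx
    obtain ⟨⟨f, hf, hf'⟩, g, hg, hg'⟩ := hx
    have := h (f * g) (Ideal.mul_mem_mul hf hg)
    rw [map_mul] at this
    exact (mul_ne_zero hf' hg') this

theorem vI_prime {n : ℕ} {Z : Set (TorusPt n)} (h : ZIrred Z) : (vI Z).IsPrime := by
  refine ⟨?_, ?_⟩
  · intro he
    obtain ⟨x, hx⟩ := h.1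
    have : (1 : RR n) ∈ vI Z := he ▸ Submodule.mem_top
    simpa using this x hx
  · intro f g hfg
    refine h.2 _ _ (closed_single f) (closed_single g) fun x hx => ?_
    have := hfg x hx
    rw [map_mul, mul_eq_zero] at this
    exact this

theorem X_notMem_of_le {n : ℕ} {I : Ideal (RR n)} {P : TorusPt n} (h : I ≤ mP P) (i : Fin n) : (X i : RR n) ∉ I := by
  intro hi
  have := mem_mP.mp (h hi)
  rw [eval_X] at this
  exact cv_ne P i this

theorem vI_zV {n : ℕ} {Q : Ideal (RR n)} [Q.IsPrime] {P : TorusPt n} (h : Q ≤ mP P) : vI (zV Q) = Q := by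
  apply le_antisymm
  · intro f hf
    have h1 : f * ∏ i, X i ∈ Q := by
      rw [← IsPrime.vanishingIdeal_zeroLocus (K := Qbar) Q]
      intro y hy
      by_cases hy0 : ∃ i, y i = 0
      · obtain ⟨i, hi⟩ := hy0
        rw [map_mul, map_prod]
        apply mul_eq_zero_of_right
        exact Finset.prod_eq_zero (Finset.mem_univ i) (by rw [aeval_X, hi])
      · push Not at hy0
        rw [map_mul]
        apply mul_eq_zero_of_left
        have := hf (fun i => Units.mk0 (y i) (hy0 i)) (fun g hg => by
          have := hy g hg
          rwa [aeval_eq_eval] at this)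
        rw [aeval_eq_eval]
        exact this
    rcases Ideal.IsPrime.mem_or_mem ‹_› h1 with h2 | h2
    · exact h2
    · rw [Ideal.IsPrime.prod_mem_iff] at h2
      obtain ⟨i, _, hi⟩ := h2
      exact absurd hi (X_notMem_of_le h i)
  · intro f hf x hx
    exact hx f hf

theorem zV_irred {n : ℕ} {Q : Ideal (RR n)} [hQ : Q.IsPrime] {P : TorusPt n} (h : Q ≤ mP P) : ZIrred (zV Q) := by
  refine ⟨⟨P, mem_zV_iff.mpr h⟩, fun Z W hZ hW hZW => ?_⟩
  have h1 : vI Z * vI W ≤ Q := by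
    rw [← vI_zV h]
    intro f hf x hx
    rcases hZW hx with hx | hx
    · exact Ideal.mul_le_left (I := vI Z) (J := vI W) hf x hx
    · exact Ideal.mul_le_right (I := vI Z) (J := vI W) hf x hx
  rcases hQ.mul_le.mp h1 with h2 | h2
  · left; rw [← zV_vI hZ]; exact zV_anti h2
  · right; rw [← zV_vI hW]; exact zV_anti h2

theorem zV_ssubset {n : ℕ} {Q Q' : Ideal (RR n)} [Q.IsPrime] [Q'.IsPrime] {P : TorusPt n} (h : Q' ≤ mP P) (hlt : Q < Q') :
    zV Q' ⊂ zV Q := by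
  refine ⟨zV_anti hlt.le, fun hc => ?_⟩
  have := vI_anti hc
  rw [vI_zV h, vI_zV (hlt.le.trans h)] at this
  exact absurd this (not_le_of_gt hlt)

/-! height of the maximal ideal -/

theorem mP_height {n : ℕ} (P : TorusPt n) : (n : ℕ∞) ≤ (mP P).height := by
  classical
  let φ : ℕ → (RR n →ₐ[Qbar] RR n) := fun k => aeval fun j : Fin n => if (j : ℕ) < k then C (cv P j) else X j
  have hX : ∀ k j, φ k (X j) = if (j : ℕ) < k then C (cv P j) else X j := fun k j => by simp [φ]
  have hcomp : ∀ k l, k ≤ l → (φ l).comp (φ k) = φ l := by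
    intro k l hkl
    apply MvPolynomial.algHom_ext
    intro j
    rw [AlgHom.comp_apply, hX, hX]
    by_cases hj : (j : ℕ) < k
    · rw [if_pos hj, if_pos (hj.trans_le hkl)]
      exact (φ l).commutes _
    · rw [if_neg hj, hX]
  let Q : Fin (n+1) → PrimeSpectrum (RR n) := fun k => ⟨RingHom.ker (φ k), RingHom.ker_isPrime _⟩
  have hle : ∀ k l : ℕ, k ≤ l → RingHom.ker (φ k) ≤ RingHom.ker (φ l) := by
    intro k l hkl f hf
    rw [RingHom.mem_ker] at hf ⊢
    rw [← hcomp k l hkl, AlgHom.comp_apply, hf, map_zero]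
  have hlt : StrictMono Q := by
    rw [Fin.strictMono_iff_lt_succ]
    intro i
    change RingHom.ker (φ (i.castSucc : ℕ)) < RingHom.ker (φ (i.succ : ℕ))
    refine lt_of_le_of_ne (hle _ _ (by simp)) fun he => ?_
    have h1 : (X i - C (cv P i) : RR n) ∈ RingHom.ker (φ (i.succ : ℕ)) := by
      rw [RingHom.mem_ker, map_sub, hX, if_pos (by simp), sub_eq_zero]
      exact ((φ _).commutes _).symm
    rw [← he, RingHom.mem_ker, map_sub, hX, if_neg (by simp)] at h1
    have h2 : φ (i.castSucc : ℕ) (C (cv P i)) = C (cv P i) := (φ _).commutes _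
    rw [h2] at h1
    have h3 := congrArg (eval (fun _ => cv P i + 1)) h1
    simp at h3
  have hlast : RingHom.ker (φ n) ≤ mP P := by
    intro f hf
    rw [RingHom.mem_ker] at hf
    rw [mem_mP]
    have h1 : (aeval (cv P) : RR n →ₐ[Qbar] Qbar).comp (φ n) = aeval (cv P) := by
      apply MvPolynomial.algHom_ext
      intro j
      rw [AlgHom.comp_apply, hX, if_pos j.2]
      simp
    have h2 := congrArg (fun g : RR n →ₐ[Qbar] Qbar => g f) h1
    simp only [AlgHom.comp_apply, hf, map_zero] at h2
    rw [← aeval_eq_eval]; exact h2.symm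
  have hH : (mP P).height = Order.height (⟨mP P, inferInstance⟩ : PrimeSpectrum (RR n)) :=
    PrimeSpectrum.height_eq_orderHeight (⟨mP P, inferInstance⟩ : PrimeSpectrum (RR n))
  rw [hH]
  let L : LTSeries (PrimeSpectrum (RR n)) := LTSeries.mk n Q hlt
  exact Order.length_le_height (p := L) (x := (⟨mP P, inferInstance⟩ : PrimeSpectrum (RR n))) hlast

theorem chain_lemma {n : ℕ} (P : TorusPt n) (S : Finset (RR n)) (hS : ∀ f ∈ S, eval (cv P) f = 0) :
    ∃ (d : ℕ) (Q : Fin (d+1) → Ideal (RR n)), n ≤ d + S.card ∧ (∀ i, (Q i).IsPrime) ∧ StrictMono Q ∧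
      (∀ i, Q i ≤ mP P) ∧ ∀ f ∈ S, f ∈ Q 0 := by
  have hsub : (S : Set (RR n)) ⊆ mP P := fun f hf => mem_mP.mpr (hS f hf)
  have h1 := Ideal.height_le_height_add_encard_of_subset (S : Set (RR n)) hsub
  have hle : Ideal.span (S : Set (RR n)) ≤ mP P := Ideal.span_le.mpr hsub
  haveI := Ideal.isPrime_map_quotientMk_of_isPrime hle
  obtain ⟨l, hl, hlen⟩ := ((mP P).map (Ideal.Quotient.mk (Ideal.span (S : Set (RR n))))).exists_ltSeries_length_eq_height
  have hcomap : ((mP P).map (Ideal.Quotient.mk (Ideal.span (S : Set (RR n))))).comap (Ideal.Quotient.mk _) = mP P := by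
    rw [Ideal.comap_map_of_surjective _ Ideal.Quotient.mk_surjective, ← RingHom.ker_eq_comap_bot, Ideal.mk_ker]
    exact sup_eq_left.mpr hle
  refine ⟨l.length, fun i => (l i).asIdeal.comap (Ideal.Quotient.mk _), ?_, fun i => inferInstance, ?_, ?_, ?_⟩
  · have h2 := (mP_height P).trans h1
    rw [← hlen, Set.encard_coe_eq_coe_finsetCard] at h2
    exact_mod_cast h2
  · intro i j hij
    have h3 : (l i).asIdeal < (l j).asIdeal := l.strictMono hij
    refine lt_of_le_of_ne (Ideal.comap_mono h3.le) fun he => h3.ne ?_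
    exact Ideal.comap_injective_of_surjective _ Ideal.Quotient.mk_surjective he
  · intro i
    conv_rhs => rw [← hcomap]
    apply Ideal.comap_mono
    have h4 : l i ≤ l.last := l.strictMono.monotone (Fin.le_last i)
    rw [hl] at h4
    exact h4
  · intro f hf
    rw [Ideal.mem_comap, Ideal.Quotient.eq_zero_iff_mem.mpr (Ideal.subset_span hf)]
    exact zero_mem _
end E2

section E3
open MvPolynomial

/-- Clearing denominators in finitely many Laurent monomials. -/
theorem clear_den {n : ℕ} {ι : Type} [Finite ι] (e : ι → Fin n → ℤ) : ∃ (D : RR n) (p : ι → RR n),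
    ∀ (L : Type) [Field L] [Algebra Qbar L] (y : Fin n → L), (∀ i, y i ≠ 0) →
      aeval y D ≠ 0 ∧ ∀ b, aeval y (p b) = mono y (e b) * aeval y D := by
  classical
  cases nonempty_fintype ι
  let M : ℕ := ∑ b, ∑ i, (e b i).natAbs
  have hM : ∀ b i, (0 : ℤ) ≤ e b i + M := by
    intro b i
    have h1 : (e b i).natAbs ≤ M :=
      (Finset.single_le_sum (f := fun i => (e b i).natAbs) (fun _ _ => Nat.zero_le _) (Finset.mem_univ i)).trans
        (Finset.single_le_sum (f := fun b => ∑ i, (e b i).natAbs) (fun _ _ => Nat.zero_le _) (Finset.mem_univ b))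
    omega
  refine ⟨∏ i, X i ^ M, fun b => ∏ i, X i ^ (e b i + M).toNat, fun L _ _ y hy => ⟨?_, fun b => ?_⟩⟩
  · simp only [map_prod, map_pow, aeval_X]
    exact Finset.prod_ne_zero_iff.mpr fun i _ => pow_ne_zero _ (hy i)
  · simp only [map_prod, map_pow, aeval_X, mono, ← Finset.prod_mul_distrib]
    refine Finset.prod_congr rfl fun i _ => ?_
    rw [← zpow_natCast, ← zpow_natCast, ← zpow_add₀ (hy i), Int.toNat_of_nonneg (hM b i)]

/-- Function field of a prime ideal. -/
abbrev FF {n : ℕ} (I : Ideal (RR n)) [I.IsPrime] : Type := FractionRing (RR n ⧸ I)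

noncomputable def xi {n : ℕ} (I : Ideal (RR n)) [I.IsPrime] (i : Fin n) : FF I :=
  algebraMap (RR n ⧸ I) (FF I) (Ideal.Quotient.mk I (X i))

theorem aeval_xi {n : ℕ} (I : Ideal (RR n)) [I.IsPrime] (f : RR n) :
    aeval (xi I) f = algebraMap (RR n ⧸ I) (FF I) (Ideal.Quotient.mk I f) := by
  have h : (aeval (xi I) : RR n →ₐ[Qbar] FF I) = ((Algebra.algHom Qbar (RR n ⧸ I) (FF I)).comp (Ideal.Quotient.mkₐ Qbar I)) := by
    apply MvPolynomial.algHom_ext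
    intro i
    rw [aeval_X]; rfl
  rw [h]; rfl

theorem aeval_xi_eq_zero {n : ℕ} (I : Ideal (RR n)) [I.IsPrime] (f : RR n) : aeval (xi I) f = 0 ↔ f ∈ I := by
  rw [aeval_xi, map_eq_zero_iff _ (IsFractionRing.injective (RR n ⧸ I) (FF I)), Ideal.Quotient.eq_zero_iff_mem]

theorem xi_ne {n : ℕ} {I : Ideal (RR n)} [I.IsPrime] {P : TorusPt n} (h : I ≤ mP P) (i : Fin n) : xi I i ≠ 0 := by
  intro h0
  apply X_notMem_of_le h i
  rw [← aeval_xi_eq_zero, aeval_X, h0]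

theorem xi_gen {n : ℕ} (I : Ideal (RR n)) [I.IsPrime] : IntermediateField.adjoin Qbar (Set.range (xi I)) = ⊤ := by
  rw [eq_top_iff]
  intro y _
  have hmem : ∀ f : RR n, aeval (xi I) f ∈ IntermediateField.adjoin Qbar (Set.range (xi I)) := by
    intro f
    have h1 : aeval (xi I) f ∈ Algebra.adjoin Qbar (Set.range (xi I)) := by
      rw [Algebra.adjoin_range_eq_range_aeval]; exact ⟨f, rfl⟩
    exact IntermediateField.algebra_adjoin_le_adjoin _ _ h1
  obtain ⟨a, b, _, rfl⟩ := IsFractionRing.div_surjective (A := RR n ⧸ I) y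
  obtain ⟨a, rfl⟩ := Ideal.Quotient.mk_surjective a
  obtain ⟨b, rfl⟩ := Ideal.Quotient.mk_surjective b
  rw [← aeval_xi, ← aeval_xi]
  exact IntermediateField.div_mem _ (hmem a) (hmem b)

theorem xi_trdeg {n : ℕ} (I : Ideal (RR n)) [I.IsPrime] : Algebra.trdeg Qbar (FF I) = Algebra.trdeg Qbar (RR n ⧸ I) :=
  trdeg_frac

theorem trdeg_ff_le {n : ℕ} (I : Ideal (RR n)) [I.IsPrime] {P : TorusPt n} (h : I ≤ mP P) (B : Submodule ℤ (Fin n → ℤ))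
    (hB : ∀ b ∈ B, ∃ c : Qbar, mono (xi I) b = algebraMap Qbar _ c) : Algebra.trdeg Qbar (RR n ⧸ I) + Module.finrank ℤ B ≤ n := by
  rw [← xi_trdeg]
  refine trdeg_mono_le (xi I) (xi_ne h) (xi_gen I) B fun b hb => ?_
  obtain ⟨c, hc⟩ := hB b hb
  rw [hc]; exact IntermediateField.algebraMap_mem _ _

theorem mono_const_iff {n : ℕ} (I : Ideal (RR n)) [I.IsPrime] {P : TorusPt n} (h : I ≤ mP P) (b : Fin n → ℤ) (c : Qbar) :
    mono (xi I) b = algebraMap Qbar _ c ↔ ∀ x ∈ zV I, mono (cv x) b = c := by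
  obtain ⟨D, p, hp⟩ := clear_den (fun _ : Unit => b)
  obtain ⟨h1, h2⟩ := hp _ (xi I) (xi_ne h)
  specialize h2 ()
  have h3 : mono (xi I) b = algebraMap Qbar _ c ↔ p () - C c * D ∈ I := by
    rw [← aeval_xi_eq_zero, map_sub, map_mul, h2, ← sub_mul]
    rw [show aeval (xi I) (C c) = algebraMap Qbar (FF I) c from (aeval (xi I)).commutes c]
    rw [mul_eq_zero, or_iff_left h1, sub_eq_zero]
  rw [h3]
  conv_lhs => rw [← vI_zV h]
  rw [mem_vI]
  refine forall₂_congr fun x hx => ?_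
  obtain ⟨h4, h5⟩ := hp Qbar (cv x) (cv_ne x)
  specialize h5 ()
  rw [aeval_eq_eval] at h4 h5
  change eval _ _ ≠ 0 at h4
  change eval _ _ = _ * eval _ _ at h5
  rw [map_sub, map_mul, h5, eval_C, ← sub_mul, mul_eq_zero, or_iff_left h4, sub_eq_zero]

theorem chain_trdeg {n d : ℕ} (Q : Fin (d+1) → Ideal (RR n)) [∀ i, (Q i).IsPrime] (hQ : StrictAnti Q) (i : Fin (d+1)) :
    ((i : ℕ) : Cardinal) ≤ Algebra.trdeg Qbar (RR n ⧸ Q i) := by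
  induction i using Fin.induction with
  | zero => simp
  | succ i ih =>
    have h1 := trdeg_quot_lt (k := Qbar) (Q i.succ) (Q i.castSucc) (hQ i.castSucc_lt_succ)
    have h2 := Order.succ_le_of_lt (lt_of_le_of_lt ih h1)
    rw [Cardinal.succ_natCast] at h2
    simpa using h2

theorem chain_bound {n d : ℕ} (S : Set (TorusPt n)) (B : Submodule ℤ (Fin n → ℤ))
    (hB : ∀ b ∈ B, ∃ c : Qbar, ∀ x ∈ S, mono (cv x) b = c) (Z : Fin (d+1) → Set (TorusPt n))
    (hZ : ∀ i, ZClosed (Z i) ∧ ZIrred (Z i) ∧ Z i ⊆ S) (hlt : ∀ i j, i < j → Z i ⊂ Z j) :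
    d + Module.finrank ℤ B ≤ n := by
  haveI : ∀ i, (vI (Z i)).IsPrime := fun i => vI_prime (hZ i).2.1
  have h1 := chain_trdeg (fun i => vI (Z i)) (fun i j hij => vI_lt (hZ i).1 (hlt i j hij)) (Fin.last d)
  obtain ⟨P, hP⟩ := (hZ (Fin.last d)).2.1.1
  have hle : vI (Z (Fin.last d)) ≤ mP P := mem_zV_iff.mp (by rw [zV_vI (hZ _).1]; exact hP)
  have h2 := trdeg_ff_le (vI (Z (Fin.last d))) hle B fun b hb => by
    obtain ⟨c, hc⟩ := hB b hb
    refine ⟨c, (mono_const_iff _ hle b c).mpr fun x hx => hc x ?_⟩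
    rw [zV_vI (hZ _).1] at hx
    exact (hZ _).2.2 hx
  rw [Fin.val_last] at h1
  have h3 : (d : Cardinal) + Module.finrank ℤ B ≤ n := (add_le_add_left h1 _).trans h2
  exact_mod_cast h3

theorem zdim_bdd {n : ℕ} (S : Set (TorusPt n)) : BddAbove {d : ℕ | ∃ Z : Fin (d + 1) → Set (TorusPt n),
    (∀ i, ZClosed (Z i) ∧ ZIrred (Z i) ∧ Z i ⊆ S) ∧
    ∀ i j : Fin (d + 1), i < j → Z i ⊂ Z j} := by
  refine ⟨n, ?_⟩
  rintro d ⟨Z, hZ, hlt⟩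
  have := chain_bound S ⊥ (fun b hb => ⟨1, fun x _ => by rw [Submodule.mem_bot] at hb; rw [hb, mono_zero]⟩) Z hZ hlt
  omega

theorem zdim_le {n : ℕ} (S : Set (TorusPt n)) (hS : S.Nonempty) (B : Submodule ℤ (Fin n → ℤ))
    (hB : ∀ b ∈ B, ∃ c : Qbar, ∀ x ∈ S, mono (cv x) b = c) : zdim S + Module.finrank ℤ B ≤ n := by
  have hne : {d : ℕ | ∃ Z : Fin (d + 1) → Set (TorusPt n),
    (∀ i, ZClosed (Z i) ∧ ZIrred (Z i) ∧ Z i ⊆ S) ∧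
    ∀ i j : Fin (d + 1), i < j → Z i ⊂ Z j}.Nonempty := by
    obtain ⟨P, hP⟩ := hS
    have hmP : zV (mP P) ⊆ S := by
      intro x hx
      have : x = P := by
        funext i
        apply Units.ext
        have := hx (X i - C (cv P i)) (mem_mP.mpr (by simp))
        rw [map_sub, eval_X, eval_C, sub_eq_zero] at this
        exact this
      rw [this]; exact hP
    refine ⟨0, fun _ => zV (mP P), fun _ => ⟨zV_closed _, zV_irred le_rfl, hmP⟩, ?_⟩
    intro i j hij
    exact absurd hij (by omega)
  obtain ⟨Z, hZ, hlt⟩ := Nat.sSup_mem hne (zdim_bdd S)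
  exact chain_bound S B hB Z hZ hlt

theorem le_zdim {n d : ℕ} (S : Set (TorusPt n)) (P : TorusPt n) (Q : Fin (d+1) → Ideal (RR n)) (hp : ∀ i, (Q i).IsPrime)
    (hQ : StrictMono Q) (hle : ∀ i, Q i ≤ mP P) (hS : zV (Q 0) ⊆ S) : d ≤ zdim S := by
  apply le_csSup (zdim_bdd S)
  refine ⟨fun i => zV (Q i.rev), fun i => ⟨zV_closed _, zV_irred (hle _), ?_⟩, fun i j hij => ?_⟩
  · exact (zV_anti (hQ.monotone (Fin.zero_le _))).trans hS
  · exact zV_ssubset (hle _) (hQ (Fin.rev_lt_rev.mpr hij))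
end E3

section E4
open MvPolynomial

theorem cv_mul_apply {n : ℕ} (x y : TorusPt n) (i : Fin n) : cv (x * y) i = cv x i * cv y i := by
  change ((x i * y i : Qbarˣ) : Qbar) = _
  rw [Units.val_mul]

theorem cv_one_apply {n : ℕ} (i : Fin n) : cv (1 : TorusPt n) i = 1 := rfl

theorem cv_inv_apply {n : ℕ} (x : TorusPt n) (i : Fin n) : cv x⁻¹ i = (cv x i)⁻¹ := by
  change (((x i)⁻¹ : Qbarˣ) : Qbar) = _
  rw [Units.val_inv_eq_inv_val]

theorem cv_mul {n : ℕ} (x y : TorusPt n) (b : Fin n → ℤ) : mono (cv (x * y)) b = mono (cv x) b * mono (cv y) b := by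
  simp only [mono, ← Finset.prod_mul_distrib]
  exact Finset.prod_congr rfl fun i _ => by rw [cv_mul_apply, mul_zpow]

theorem cv_one {n : ℕ} (b : Fin n → ℤ) : mono (cv (1 : TorusPt n)) b = 1 := by
  simp only [mono, cv_one_apply, one_zpow, Finset.prod_const_one]

theorem cv_inv {n : ℕ} (x : TorusPt n) (b : Fin n → ℤ) : mono (cv x⁻¹) b = (mono (cv x) b)⁻¹ := by
  simp only [mono, ← Finset.prod_inv_distrib]
  exact Finset.prod_congr rfl fun i _ => by rw [cv_inv_apply, inv_zpow]

theorem mono_neg' {n : ℕ} {F : Type*} [Field F] (x : Fin n → F) (b : Fin n → ℤ) : mono x (-b) = (mono x b)⁻¹ := by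
  simp only [mono, ← Finset.prod_inv_distrib]
  exact Finset.prod_congr rfl fun i _ => by simp

/-- exponents on which every point of `T` is trivial -/
def trivExp {n : ℕ} (T : Set (TorusPt n)) : Submodule ℤ (Fin n → ℤ) :=
  AddSubgroup.toIntSubmodule
    { carrier := {b | ∀ x ∈ T, mono (cv x) b = 1}
      zero_mem' := fun x _ => mono_zero _
      add_mem' := fun {a b} ha hb x hx => by rw [mono_add (cv_ne x), ha x hx, hb x hx, mul_one]
      neg_mem' := fun {a} ha x hx => by rw [mono_neg', ha x hx, inv_one] }

theorem mem_trivExp {n : ℕ} {T : Set (TorusPt n)} {b : Fin n → ℤ} : b ∈ trivExp T ↔ ∀ x ∈ T, mono (cv x) b = 1 := Iff.rfl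

/-- the subgroup cut out by a module of exponents -/
def grpOf {n : ℕ} (B : Submodule ℤ (Fin n → ℤ)) : Set (TorusPt n) := {x | ∀ b ∈ B, mono (cv x) b = 1}

theorem grpOf_alg {n : ℕ} (B : Submodule ℤ (Fin n → ℤ)) : IsAlgSubgroup (grpOf B) := by
  refine ⟨?_, fun b _ => cv_one b, fun x hx y hy b hb => by rw [cv_mul, hx b hb, hy b hb, mul_one],
    fun x hx b hb => by rw [cv_inv, hx b hb, inv_one]⟩
  have : grpOf B = zV (vI (grpOf B)) := by
    apply Set.Subset.antisymm
    · intro x hx f hf; exact hf x hx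
    · intro x hx b hb
      obtain ⟨D, p, hp⟩ := clear_den (fun _ : Unit => b)
      have key : ∀ y : TorusPt n, eval (cv y) (p () - D) = 0 ↔ mono (cv y) b = 1 := by
        intro y
        obtain ⟨h4, h5⟩ := hp Qbar (cv y) (cv_ne y)
        specialize h5 ()
        rw [aeval_eq_eval] at h4 h5
        change eval _ _ ≠ 0 at h4
        change eval _ _ = _ * eval _ _ at h5
        rw [map_sub, h5, ← sub_one_mul, mul_eq_zero, or_iff_left h4, sub_eq_zero]
      rw [← key]
      exact hx _ fun y hy => (key y).mpr (hy b hb)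
  rw [this]
  exact zV_closed _

theorem mem_of_trivExp {n : ℕ} {H : Set (TorusPt n)} (hH : IsAlgSubgroup H) {x : TorusPt n}
    (hx : ∀ b ∈ trivExp H, mono (cv x) b = 1) : x ∈ H := by
  classical
  obtain ⟨hcl, h1, hmul, hinv⟩ := hH
  rw [← zV_vI hcl]
  intro f hf
  let G : Subgroup (TorusPt n) :=
    { carrier := H, one_mem' := h1, mul_mem' := fun {a b} ha hb => hmul a ha b hb, inv_mem' := fun {a} ha => hinv a ha }
  let χ : (Fin n →₀ ℕ) → (G →* Qbar) := fun m =>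
    { toFun := fun g => ∏ i, cv (g : TorusPt n) i ^ m i
      map_one' := by simp only [Subgroup.coe_one, cv_one_apply, one_pow, Finset.prod_const_one]
      map_mul' := fun a b => by simp only [Subgroup.coe_mul, cv_mul_apply, mul_pow, Finset.prod_mul_distrib] }
  have hχ : ∀ m m', χ m = χ m' → ∏ i, cv x i ^ m i = ∏ i, cv x i ^ m' i := by
    intro m m' h
    have hb : ∀ y : TorusPt n, mono (cv y) (fun i => (m i : ℤ) - m' i) = (∏ i, cv y i ^ m i) / ∏ i, cv y i ^ m' i := by
      intro y
      rw [mono, ← Finset.prod_div_distrib]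
      refine Finset.prod_congr rfl fun i _ => ?_
      rw [zpow_sub₀ (cv_ne y i), zpow_natCast, zpow_natCast]
    have hnz : ∀ y : TorusPt n, ∏ i, cv y i ^ m' i ≠ 0 := fun y => Finset.prod_ne_zero_iff.mpr fun i _ => pow_ne_zero _ (cv_ne y i)
    have := hx (fun i => (m i : ℤ) - m' i) (mem_trivExp.mpr fun y hy => by
      rw [hb, div_eq_one_iff_eq (hnz y)]
      exact congrArg (fun c : G →* Qbar => c ⟨y, hy⟩) h)
    rwa [hb, div_eq_one_iff_eq (hnz x)] at this
  have hzero : ∀ c ∈ f.support.image χ, ∑ m ∈ f.support with χ m = c, coeff m f = 0 := by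
    have hli := linearIndependent_monoidHom G Qbar
    rw [linearIndependent_iff'] at hli
    apply hli
    funext g
    have h2 := hf (g : TorusPt n) g.2
    rw [eval_eq'] at h2
    rw [← Finset.sum_fiberwise_of_maps_to (fun m hm => Finset.mem_image_of_mem χ hm)] at h2
    rw [Finset.sum_apply, Pi.zero_apply, ← h2]
    refine Finset.sum_congr rfl fun c _ => ?_
    rw [Pi.smul_apply, smul_eq_mul, Finset.sum_mul]
    refine Finset.sum_congr rfl fun m hm => ?_
    rw [← (Finset.mem_filter.mp hm).2]
    rfl
  rw [eval_eq', ← Finset.sum_fiberwise_of_maps_to (fun m hm => Finset.mem_image_of_mem χ hm)]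
  refine Finset.sum_eq_zero fun c hc => ?_
  obtain ⟨m0, _, rfl⟩ := Finset.mem_image.mp hc
  have h3 : ∑ m ∈ f.support with χ m = χ m0, coeff m f * ∏ i, cv x i ^ m i
      = ∑ m ∈ f.support with χ m = χ m0, coeff m f * ∏ i, cv x i ^ m0 i := by
    refine Finset.sum_congr rfl fun m hm => ?_
    rw [hχ m m0 (Finset.mem_filter.mp hm).2]
  rw [h3, ← Finset.sum_mul, hzero _ hc, zero_mul]

theorem rank_ge {n s : ℕ} {H : Set (TorusPt n)} (hH : IsAlgSubgroup H) (hs : s + zdim H ≤ n) :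
    s ≤ Module.finrank ℤ (trivExp H) := by
  classical
  let v := Module.finBasis ℤ (trivExp H)
  obtain ⟨D, p, hp⟩ := clear_den (fun i => ((v i : trivExp H) : Fin n → ℤ))
  have key : ∀ (y : TorusPt n) i, eval (cv y) (p i - D) = 0 ↔ mono (cv y) (v i) = 1 := by
    intro y i
    obtain ⟨h4, h5⟩ := hp Qbar (cv y) (cv_ne y)
    specialize h5 i
    rw [aeval_eq_eval] at h4 h5
    change eval _ _ ≠ 0 at h4
    change eval _ _ = _ * eval _ _ at h5
    rw [map_sub, h5, ← sub_one_mul, mul_eq_zero, or_iff_left h4, sub_eq_zero]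
  obtain ⟨d, Q, hd, hprime, hmono, hle, hS⟩ := chain_lemma (1 : TorusPt n) (Finset.univ.image fun i => p i - D) (by
    intro f hf
    obtain ⟨i, _, rfl⟩ := Finset.mem_image.mp hf
    rw [key, cv_one])
  have hcard : (Finset.univ.image fun i => p i - D).card ≤ Module.finrank ℤ (trivExp H) := by
    refine Finset.card_image_le.trans ?_
    simp
  have hz : d ≤ zdim H := by
    refine le_zdim H 1 Q hprime hmono hle fun x hx => ?_
    apply mem_of_trivExp hH
    intro b hb
    have hsub : ∀ w : trivExp H, mono (cv x) (w : Fin n → ℤ) = 1 := by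
      intro w
      have hw : w ∈ (trivExp {x}).comap (trivExp H).subtype := by
        have : (⊤ : Submodule ℤ (trivExp H)) ≤ (trivExp {x}).comap (trivExp H).subtype := by
          rw [← v.span_eq, Submodule.span_le]
          rintro _ ⟨i, rfl⟩
          change _ ∈ trivExp {x}
          rw [mem_trivExp]
          rintro y rfl
          exact (key y i).mp (hx _ (hS _ (Finset.mem_image_of_mem _ (Finset.mem_univ i))))
        exact this Submodule.mem_top
      exact mem_trivExp.mp (Submodule.mem_comap.mp hw) x rfl
    exact hsub ⟨b, hb⟩
  omega

/-- Laurent polynomial expressions, evaluated in all fields. -/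
def IsLaur (n : ℕ) (E : ∀ (L : Type) [Field L] [Algebra Qbar L], (Fin n → L) → L) : Prop :=
  ∃ (p D : RR n), ∀ (L : Type) [Field L] [Algebra Qbar L] (y : Fin n → L), (∀ i, y i ≠ 0) →
    aeval y D ≠ 0 ∧ aeval y p = E L y * aeval y D

theorem IsLaur.const {n : ℕ} (c : Qbar) : IsLaur n (fun L _ _ _ => algebraMap Qbar L c) :=
  ⟨C c, 1, fun L _ _ y _ => ⟨by simp, by simp⟩⟩

theorem IsLaur.monom {n : ℕ} (b : Fin n → ℤ) : IsLaur n (fun L _ _ y => mono y b) := by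
  obtain ⟨D, p, hp⟩ := clear_den (fun _ : Unit => b)
  exact ⟨p (), D, fun L _ _ y hy => ⟨(hp L y hy).1, (hp L y hy).2 ()⟩⟩

theorem IsLaur.add {n : ℕ} {E E' : ∀ (L : Type) [Field L] [Algebra Qbar L], (Fin n → L) → L}
    (h : IsLaur n E) (h' : IsLaur n E') : IsLaur n (fun L _ _ y => E L y + E' L y) := by
  obtain ⟨p, D, hp⟩ := h
  obtain ⟨p', D', hp'⟩ := h'
  refine ⟨p * D' + p' * D, D * D', fun L _ _ y hy => ⟨?_, ?_⟩⟩
  · rw [map_mul]; exact mul_ne_zero (hp L y hy).1 (hp' L y hy).1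
  · simp only [map_add, map_mul, (hp L y hy).2, (hp' L y hy).2]; ring

theorem IsLaur.mul {n : ℕ} {E E' : ∀ (L : Type) [Field L] [Algebra Qbar L], (Fin n → L) → L}
    (h : IsLaur n E) (h' : IsLaur n E') : IsLaur n (fun L _ _ y => E L y * E' L y) := by
  obtain ⟨p, D, hp⟩ := h
  obtain ⟨p', D', hp'⟩ := h'
  refine ⟨p * p', D * D', fun L _ _ y hy => ⟨?_, ?_⟩⟩
  · rw [map_mul]; exact mul_ne_zero (hp L y hy).1 (hp' L y hy).1
  · simp only [map_mul, (hp L y hy).2, (hp' L y hy).2]; ring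

theorem IsLaur.pow {n : ℕ} {E : ∀ (L : Type) [Field L] [Algebra Qbar L], (Fin n → L) → L}
    (h : IsLaur n E) (k : ℕ) : IsLaur n (fun L _ _ y => E L y ^ k) := by
  obtain ⟨p, D, hp⟩ := h
  refine ⟨p ^ k, D ^ k, fun L _ _ y hy => ⟨?_, ?_⟩⟩
  · rw [map_pow]; exact pow_ne_zero _ (hp L y hy).1
  · simp only [map_pow, (hp L y hy).2]; ring

theorem IsLaur.sum {n : ℕ} {ι : Type} (S : Finset ι) {E : ι → ∀ (L : Type) [Field L] [Algebra Qbar L], (Fin n → L) → L}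
    (h : ∀ i, IsLaur n (E i)) : IsLaur n (fun L _ _ y => ∑ i ∈ S, E i L y) := by
  classical
  induction S using Finset.induction_on with
  | empty => exact ⟨0, 1, fun L _ _ y _ => ⟨by simp, by simp⟩⟩
  | insert a S ha ih =>
    simp only [Finset.sum_insert ha]
    exact (h a).add ih

theorem IsLaur.poly {n ρ : ℕ} (β : Fin ρ → Fin n → ℤ) (a : MvPolynomial (Fin ρ) Qbar) :
    IsLaur n (fun L _ _ y => aeval (fun i => mono y (β i)) a) := by
  induction a using MvPolynomial.induction_on with
  | C c =>
    obtain ⟨p, D, hp⟩ := IsLaur.const (n := n) c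
    exact ⟨p, D, fun L _ _ y hy => ⟨(hp L y hy).1, by rw [(hp L y hy).2]; beta_reduce; rw [algHom_C]⟩⟩
  | add p q hp hq =>
    simp only [map_add]; exact hp.add hq
  | mul_X p i hp =>
    simp only [map_mul, aeval_X]; exact hp.mul (IsLaur.monom (β i))

theorem IsLaur.exists_poly {n : ℕ} {E : ∀ (L : Type) [Field L] [Algebra Qbar L], (Fin n → L) → L} (h : IsLaur n E) :
    ∃ p : RR n, (∀ (I : Ideal (RR n)) [I.IsPrime] (P : TorusPt n), I ≤ mP P → (E (FF I) (xi I) = 0 ↔ p ∈ I)) ∧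
      ∀ x : TorusPt n, E Qbar (cv x) = 0 ↔ eval (cv x) p = 0 := by
  obtain ⟨p, D, hp⟩ := h
  refine ⟨p, fun I _ P hI => ?_, fun x => ?_⟩
  · obtain ⟨h1, h2⟩ := hp _ (xi I) (xi_ne hI)
    rw [← aeval_xi_eq_zero, h2, mul_eq_zero, or_iff_left h1]
  · obtain ⟨h1, h2⟩ := hp Qbar (cv x) (cv_ne x)
    rw [← aeval_eq_eval]
    change _ ↔ aeval (cv x) p = 0
    rw [h2, mul_eq_zero, or_iff_left h1]
end E4

section E5
open MvPolynomial

theorem chain_trdeg' {n d : ℕ} (Q : Fin (d+1) → Ideal (RR n)) [∀ i, (Q i).IsPrime] (hQ : StrictAnti Q) (i : Fin (d+1)) :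
    Algebra.trdeg Qbar (RR n ⧸ Q 0) + ((i : ℕ) : Cardinal) ≤ Algebra.trdeg Qbar (RR n ⧸ Q i) := by
  induction i using Fin.induction with
  | zero => simp
  | succ i ih =>
    have h1 := trdeg_quot_lt (k := Qbar) (Q i.succ) (Q i.castSucc) (hQ i.castSucc_lt_succ)
    have h2 := Order.succ_le_of_lt (lt_of_le_of_lt ih h1)
    rw [Cardinal.succ_eq_of_lt_aleph0, add_assoc] at h2
    · simpa using h2
    · exact ih.trans_lt trdeg_lt_aleph0_of_finiteType

theorem height_le_of_trdeg {n r : ℕ} (I : Ideal (RR n)) [I.IsPrime] {P : TorusPt n} (h : I ≤ mP P)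
    (hr : Algebra.trdeg Qbar (FF I) = r) : ∃ g : Finset (RR n), I ∈ (Ideal.span (g : Set (RR n))).minimalPrimes ∧ r + g.card ≤ n := by
  obtain ⟨g, hg, hcard⟩ := Ideal.exists_finset_card_eq_height_of_isNoetherianRing I
  refine ⟨g, hg, ?_⟩
  obtain ⟨l, hl, hlen⟩ := I.exists_ltSeries_length_eq_height
  have hlen' : l.length = g.card := by
    rw [← hcard] at hlen; exact_mod_cast hlen
  let Q : Fin (l.length + 1) → Ideal (RR n) := fun i => (l i.rev).asIdeal
  haveI : ∀ i, (Q i).IsPrime := fun i => (l i.rev).isPrime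
  have hanti : StrictAnti Q := fun i j hij => l.strictMono (Fin.rev_lt_rev.mpr hij)
  have h1 := chain_trdeg' Q hanti (Fin.last _)
  have hQ0 : Q 0 = I := by
    change (l (Fin.rev 0)).asIdeal = I
    rw [Fin.rev_zero]
    exact congrArg PrimeSpectrum.asIdeal hl
  have hle : Q (Fin.last _) ≤ mP P := by
    refine le_trans ?_ h
    rw [← hQ0]
    exact hanti.antitone (Fin.zero_le _)
  have h2 := trdeg_ff_le (Q (Fin.last _)) hle ⊥ (fun b hb => ⟨1, by
    rw [Submodule.mem_bot] at hb; rw [hb, mono_zero, map_one]⟩)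
  have h3 : Algebra.trdeg Qbar (RR n ⧸ Q 0) = r := by
    rw [← hr, xi_trdeg]
    congr 1 <;> rw [hQ0]
  rw [h3, Fin.val_last] at h1
  have h4 : (r : Cardinal) + l.length ≤ n := h1.trans (le_self_add.trans h2)
  rw [← hlen']
  exact_mod_cast h4

theorem alg_relation {F : Type} [Field F] [Algebra Qbar F] {ρ : ℕ} (v : Fin ρ → F) (y : F)
    (h : IsAlgebraic (IntermediateField.adjoin Qbar (Set.range v)) y) :
    ∃ (N : ℕ) (a : ℕ → MvPolynomial (Fin ρ) Qbar) (k : ℕ), k ∈ Finset.range N ∧ aeval v (a k) ≠ 0 ∧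
      ∑ j ∈ Finset.range N, aeval v (a j) * y ^ j = 0 := by
  rw [isAlg_adjoin_iff] at h
  obtain ⟨G, hG, hGy⟩ := h
  have hmem : ∀ c : Algebra.adjoin Qbar (Set.range v), ∃ a : MvPolynomial (Fin ρ) Qbar, aeval v a = (c : F) := by
    rintro ⟨c, hc⟩
    rw [Algebra.adjoin_range_eq_range_aeval] at hc
    exact hc
  choose a ha using fun j => hmem (G.coeff j)
  refine ⟨G.natDegree + 1, a, G.natDegree, by simp, ?_, ?_⟩
  · rw [ha]
    intro h0
    apply hG
    rw [← Polynomial.leadingCoeff_eq_zero]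
    exact Subtype.ext h0
  · rw [Polynomial.aeval_eq_sum_range] at hGy
    rw [← hGy]
    refine Finset.sum_congr rfl fun j _ => ?_
    rw [ha, Algebra.smul_def]; rfl

/-- if the condition fails, generic points lie on anomalous subvarieties -/
theorem fib {n s r : ℕ} {X Z : Set (TorusPt n)} (hZX : Z ⊆ X) (hcl : ZClosed Z) (hirr : ZIrred Z) [hp : (vI Z).IsPrime]
    (hr : Algebra.trdeg Qbar (FF (vI Z)) = r) (hc : ¬ MCond Qbar (xi (vI Z)) s r) :
    ∃ h : RR n, h ∉ vI Z ∧ ∀ P ∈ Z, eval (cv P) h ≠ 0 → P ∉ openAnom X s := by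
  classical
  obtain ⟨P0, hP0⟩ := hirr.1
  have hle0 : ∀ P ∈ Z, vI Z ≤ mP P := fun P hP => mem_zV_iff.mp (by rw [zV_vI hcl]; exact hP)
  unfold MCond at hc
  push Not at hc
  obtain ⟨B, ρ, β, hβ, hind, halg, hρ, hlt⟩ := hc
  obtain ⟨g, hg, hgcard⟩ := height_le_of_trdeg (vI Z) (hle0 P0 hP0) hr
  -- other minimal primes
  have hfin : (Ideal.span (g : Set (RR n))).minimalPrimes.Finite := Ideal.finite_minimalPrimes_of_isNoetherianRing _ _
  have hother : ∀ J : Ideal (RR n), ∃ f : RR n, f ∉ vI Z ∧ (J ∈ (Ideal.span (g : Set (RR n))).minimalPrimes → J ≠ vI Z → f ∈ J) := by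
    intro J
    by_cases hJ : J ∈ (Ideal.span (g : Set (RR n))).minimalPrimes ∧ J ≠ vI Z
    · have : ¬ J ≤ vI Z := fun hle => hJ.2 (le_antisymm hle (hg.2 hJ.1.1 hle))
      obtain ⟨f, hf, hf'⟩ := SetLike.not_le_iff_exists.mp this
      exact ⟨f, hf', fun _ _ => hf⟩
    · exact ⟨1, fun h1 => hp.ne_top ((Ideal.eq_top_iff_one _).mpr h1), fun h1 h2 => absurd ⟨h1, h2⟩ hJ⟩
  choose f1 hf1 hf1' using hother
  -- the algebraic relations
  let v := Module.finBasis ℤ B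
  have hrel : ∀ i, ∃ q : RR n, q ∉ vI Z ∧ ∀ P ∈ Z, eval (cv P) q ≠ 0 → ∀ (Q : Ideal (RR n)) [Q.IsPrime], vI Z ≤ Q → Q ≤ mP P →
      (∀ j, mono (xi Q) (β j) = algebraMap Qbar _ (mono (cv P) (β j))) →
      ∃ c : Qbar, mono (xi Q) (v i : Fin n → ℤ) = algebraMap Qbar _ c := by
    intro i
    obtain ⟨N, a, k, hk, hak, hsum⟩ := alg_relation _ _ (halg _ (v i).2)
    obtain ⟨q, hq1, hq2⟩ := (IsLaur.poly β (a k)).exists_poly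
    obtain ⟨t, ht1, _⟩ := (IsLaur.sum (Finset.range N) fun j =>
      (IsLaur.poly β (a j)).mul ((IsLaur.monom (v i : Fin n → ℤ)).pow j)).exists_poly
    refine ⟨q, fun hq => hak ((hq1 (vI Z) P0 (hle0 P0 hP0)).mpr hq), fun P hP hPq Q _ hIQ hQP hconst => ?_⟩
    have h1 : t ∈ vI Z := (ht1 (vI Z) P0 (hle0 P0 hP0)).mp hsum
    have h2 := (ht1 Q P hQP).mpr (hIQ h1)
    have h3 : ∀ j, aeval (fun l => mono (xi Q) (β l)) (a j) = algebraMap Qbar (FF Q) (aeval (fun l => mono (cv P) (β l)) (a j)) := by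
      intro j
      simp only [hconst]
      exact aeval_algebraMap_apply _ _ _
    simp only [h3] at h2
    have h4 : IsAlgebraic Qbar (mono (xi Q) (v i : Fin n → ℤ)) := by
      refine ⟨∑ j ∈ Finset.range N, Polynomial.C (aeval (fun l => mono (cv P) (β l)) (a j)) * Polynomial.X ^ j, ?_, ?_⟩
      · intro h0
        have := congrArg (fun p => Polynomial.coeff p k) h0
        simp only [Polynomial.finset_sum_coeff, Polynomial.coeff_C_mul_X_pow, Polynomial.coeff_zero] at this
        rw [Finset.sum_eq_single k (fun j _ hj => if_neg (Ne.symm hj)) (fun h => absurd hk h), if_pos rfl] at this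
        exact hPq ((hq2 P).mp this)
      · rw [← h2, map_sum]
        refine Finset.sum_congr rfl fun j _ => ?_
        simp
    obtain ⟨c, hc⟩ := minpoly.mem_range_of_degree_eq_one Qbar _
      (IsAlgClosed.degree_eq_one_of_irreducible Qbar (minpoly.irreducible h4.isIntegral))
    exact ⟨c, hc.symm⟩
  choose q hq hq' using hrel
  refine ⟨(∏ J ∈ hfin.toFinset, f1 J) * ∏ i, q i, ?_, fun P hP hPh => ?_⟩
  · intro hmem
    rcases hp.mem_or_mem hmem with h1 | h1
    · rw [Ideal.IsPrime.prod_mem_iff] at h1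
      obtain ⟨J, _, hJ⟩ := h1
      exact hf1 J hJ
    · rw [Ideal.IsPrime.prod_mem_iff] at h1
      obtain ⟨J, _, hJ⟩ := h1
      exact hq J hJ
  rw [map_mul, map_prod, map_prod, mul_ne_zero_iff, Finset.prod_ne_zero_iff, Finset.prod_ne_zero_iff] at hPh
  obtain ⟨hP1, hP2⟩ := hPh
  obtain ⟨D, p, hpD⟩ := clear_den β
  have key : ∀ (y : TorusPt n) i, eval (cv y) (p i - C (mono (cv P) (β i)) * D) = 0 ↔ mono (cv y) (β i) = mono (cv P) (β i) := by
    intro y i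
    obtain ⟨h4, h5⟩ := hpD Qbar (cv y) (cv_ne y)
    specialize h5 i
    rw [aeval_eq_eval] at h4 h5
    change eval _ _ ≠ 0 at h4
    change eval _ _ = _ * eval _ _ at h5
    rw [map_sub, map_mul, eval_C, h5, ← sub_mul, mul_eq_zero, or_iff_left h4, sub_eq_zero]
  set S2 := Finset.univ.image fun i => p i - C (mono (cv P) (β i)) * D with hS2
  obtain ⟨d, Q, hd, hprime, hmono, hle, hS⟩ := chain_lemma P (g ∪ S2) (by
    intro f hf
    rcases Finset.mem_union.mp hf with hf | hf
    · exact mem_mP.mp (hle0 P hP (hg.1.2 (Ideal.subset_span hf)))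
    · obtain ⟨i, _, rfl⟩ := Finset.mem_image.mp hf
      rw [key])
  have hS2card : S2.card ≤ ρ := Finset.card_image_le.trans (by simp)
  have hunion := Finset.card_union_le g S2
  haveI := hprime 0
  have hIQ : vI Z ≤ Q 0 := by
    have : Ideal.span (g : Set (RR n)) ≤ Q 0 := Ideal.span_le.mpr fun f hf => hS f (Finset.mem_union_left _ hf)
    obtain ⟨J, hJ, hJQ⟩ := Ideal.exists_minimalPrimes_le this
    by_cases hJI : J = vI Z
    · rw [← hJI]; exact hJQ
    · exact absurd (mem_mP.mp (hle 0 (hJQ (hf1' J hJ hJI)))) (hP1 J (hfin.mem_toFinset.mpr hJ))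
  have hYZ : zV (Q 0) ⊆ Z := by
    rw [← zV_vI hcl]; exact zV_anti hIQ
  have hPY : P ∈ zV (Q 0) := mem_zV_iff.mpr (hle 0)
  have hconst : ∀ j, mono (xi (Q 0)) (β j) = algebraMap Qbar _ (mono (cv P) (β j)) := fun j =>
    (mono_const_iff (Q 0) (hle 0) _ _).mpr fun x hx =>
      (key x j).mp (hx _ (hS _ (Finset.mem_union_right _ (Finset.mem_image_of_mem _ (Finset.mem_univ j)))))
  have hYv : ∀ i, ∀ x ∈ zV (Q 0), mono (cv x) (v i : Fin n → ℤ) = mono (cv P) (v i : Fin n → ℤ) := by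
    intro i x hx
    obtain ⟨c, hc⟩ := hq' i P hP (hP2 i (Finset.mem_univ i)) (Q 0) hIQ (hle 0) hconst
    have h1 := (mono_const_iff (Q 0) (hle 0) _ _).mp hc
    rw [h1 x hx, h1 P hPY]
  have hYB : ∀ b ∈ B, ∀ x ∈ zV (Q 0), mono (cv x) b = mono (cv P) b := by
    intro b hb x hx
    have : (⊤ : Submodule ℤ B) ≤ (trivExp {P⁻¹ * x}).comap B.subtype := by
      rw [← v.span_eq, Submodule.span_le]
      rintro _ ⟨i, rfl⟩
      change _ ∈ trivExp {P⁻¹ * x}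
      rw [mem_trivExp]
      rintro y rfl
      rw [cv_mul, cv_inv]
      change _ * mono (cv x) (v i : Fin n → ℤ) = 1
      rw [hYv i x hx]
      exact inv_mul_cancel₀ (mono_ne_zero (cv_ne P) _)
    have h1 : mono (cv (P⁻¹ * x)) b = 1 :=
      mem_trivExp.mp (Submodule.mem_comap.mp (this (Submodule.mem_top (x := (⟨b, hb⟩ : B))))) _ rfl
    rw [cv_mul, cv_inv, inv_mul_eq_one₀ (mono_ne_zero (cv_ne P) _)] at h1
    exact h1.symm
  have hzY : d ≤ zdim (zV (Q 0)) := le_zdim _ P Q hprime hmono hle subset_rfl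
  have hzH : zdim ((P * ·) '' grpOf B) + Module.finrank ℤ B ≤ n := by
    refine zdim_le _ (⟨P, 1, (grpOf_alg B).2.1, mul_one P⟩ : ((P * ·) '' grpOf B).Nonempty) B fun b hb => ⟨mono (cv P) b, ?_⟩
    rintro _ ⟨y, hy, rfl⟩
    change mono (cv (P * y)) b = _
    rw [cv_mul, hy b hb, mul_one]
  intro hopen
  apply hopen.2
  rw [Set.mem_iUnion₂]
  refine ⟨zV (Q 0), ⟨hYZ.trans hZX, zV_closed _, zV_irred (hle 0), by omega, (P * ·) '' grpOf B,
    ⟨P, grpOf B, grpOf_alg B, rfl⟩, fun x hx => ⟨P⁻¹ * x, fun b hb => ?_, by simp⟩, by omega⟩, hPY⟩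
  rw [cv_mul, cv_inv, hYB b hb x hx]
  exact inv_mul_cancel₀ (mono_ne_zero (cv_ne P) _)
end E5

section F1
open MvPolynomial

theorem qbar_countable : Countable Qbar := by
  have h := Algebraic.countable ℚ Qbar
  have h2 : {x : Qbar | IsAlgebraic ℚ x} = Set.univ := by
    ext x; exact ⟨fun _ => trivial, fun _ => qbar_isAlgebraic.isAlgebraic x⟩
  rw [h2] at h
  exact Set.countable_univ_iff.mp h

/-- orthonormal frames -/
def Frames (s n : ℕ) : Set (Fin s → Fin n → ℝ) :=
  {A | ∀ j k, ∑ i, A j i * A k i = if j = k then 1 else 0}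

theorem frames_compact (s n : ℕ) : IsCompact (Frames s n) := by
  have hcl : IsClosed (Frames s n) := by
    have : Frames s n = ⋂ j, ⋂ k, {A | ∑ i, A j i * A k i = if j = k then 1 else 0} := by
      ext A; simp [Frames]
    rw [this]
    refine isClosed_iInter fun j => isClosed_iInter fun k => isClosed_eq ?_ continuous_const
    fun_prop
  refine Metric.isCompact_of_isClosed_isBounded hcl ?_
  refine (Metric.isBounded_closedBall (x := (0 : Fin s → Fin n → ℝ)) (r := 1)).subset ?_
  intro A hA
  rw [mem_closedBall_zero_iff, pi_norm_le_iff_of_nonneg zero_le_one]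
  intro j
  rw [pi_norm_le_iff_of_nonneg zero_le_one]
  intro i
  have h1 := hA j j
  rw [if_pos rfl] at h1
  have h2 : A j i * A j i ≤ 1 := by
    rw [← h1]
    exact Finset.single_le_sum (f := fun i => A j i * A j i) (fun i _ => mul_self_nonneg _) (Finset.mem_univ i)
  rw [Real.norm_eq_abs]
  exact abs_le.mpr ⟨by nlinarith, by nlinarith⟩

theorem frames_li {s n : ℕ} {A : Fin s → Fin n → ℝ} (hA : A ∈ Frames s n) : LinearIndependent ℝ A := by
  rw [Fintype.linearIndependent_iff]
  intro g hg k
  have h1 : ∀ i, ∑ j, g j * A j i = 0 := fun i => by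
    have := congrFun hg i
    simpa [Finset.sum_apply] using this
  have h2 : ∑ i, (∑ j, g j * A j i) * A k i = 0 := by simp [h1]
  have h3 : ∑ i, (∑ j, g j * A j i) * A k i = ∑ j, g j * ∑ i, A j i * A k i := by
    simp only [Finset.sum_mul, Finset.mul_sum]
    rw [Finset.sum_comm]
    refine Finset.sum_congr rfl fun j _ => Finset.sum_congr rfl fun i _ => by ring
  rw [h3] at h2
  have h4 : ∀ j, g j * ∑ i, A j i * A k i = if j = k then g j else 0 := by
    intro j
    rw [hA j k]
    split_ifs <;> simp
  simp only [h4, Finset.sum_ite_eq', Finset.mem_univ, if_true] at h2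
  exact h2

theorem inner_frame {n : ℕ} (x y : EuclideanSpace ℝ (Fin n)) : inner ℝ x y = ∑ i, x i * y i := by
  rw [PiLp.inner_apply]
  refine Finset.sum_congr rfl fun i _ => ?_
  generalize x i = a
  generalize y i = b
  change b * a = a * b
  exact mul_comm _ _

theorem ons_frame {s n : ℕ} (W : Submodule ℝ (EuclideanSpace ℝ (Fin n))) (hle : s ≤ Module.finrank ℝ W) :
    ∃ u : Fin s → EuclideanSpace ℝ (Fin n), (∀ j, u j ∈ W) ∧ (fun j i => u j i) ∈ Frames s n := by
  have hu := (stdOrthonormalBasis ℝ W).orthonormal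
  generalize (⇑(stdOrthonormalBasis ℝ W)) = u at hu
  refine ⟨fun j => (u (Fin.castLE hle j) : EuclideanSpace ℝ (Fin n)), fun j => (u _).2, ?_⟩
  intro j k
  have h1 := (orthonormal_iff_ite.mp hu) (Fin.castLE hle j) (Fin.castLE hle k)
  rw [Submodule.coe_inner, inner_frame] at h1
  simp only [Fin.castLE_inj] at h1
  exact h1

theorem exists_frame {s n : ℕ} (Λ : Submodule ℤ (Fin n → ℤ)) (hs : s ≤ Module.finrank ℤ Λ) :
    ∃ A ∈ Frames s n, ∀ ℓ : Fin n → ℝ, (∀ l ∈ Λ, ∑ i, (l i : ℝ) * ℓ i = 0) → ∀ j, ∑ i, A j i * ℓ i = 0 := by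
  have hv0 : ∃ v : Fin (Module.finrank ℤ Λ) → Fin n → ℤ, (∀ i, v i ∈ Λ) ∧ LinearIndependent ℤ v :=
    ⟨fun i => ((Module.finBasis ℤ Λ i : Λ) : Fin n → ℤ), fun i => (Module.finBasis ℤ Λ i).2,
      (Module.finBasis ℤ Λ).linearIndependent.map' Λ.subtype (Submodule.ker_subtype _)⟩
  obtain ⟨v, hvm, hv⟩ := hv0
  have hv' : LinearIndependent ℝ (fun i => algebraMap ℤ ℝ ∘ (v i)) :=
    linearIndependent_algebraMap_comp_iff.mpr hv
  have hw : LinearIndependent ℝ (fun i => (WithLp.toLp 2 (algebraMap ℤ ℝ ∘ (v i)) : EuclideanSpace ℝ (Fin n))) :=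
    hv'.map' (WithLp.linearEquiv 2 ℝ (Fin n → ℝ)).symm.toLinearMap (LinearEquiv.ker _)
  have hW := finrank_span_eq_card hw
  rw [Fintype.card_fin] at hW
  obtain ⟨u, hu1, hu2⟩ := ons_frame (s := s) _ (hs.trans hW.ge)
  refine ⟨_, hu2, ?_⟩
  intro ℓ hℓ j
  refine Submodule.span_induction (p := fun x _ => ∑ i, x i * ℓ i = 0) ?_ ?_ ?_ ?_ (hu1 j)
  · rintro _ ⟨i, rfl⟩
    exact hℓ _ (hvm i)
  · simp
  · intro x y _ _ hx hy
    simp only [PiLp.add_apply, add_mul, Finset.sum_add_distrib, hx, hy, add_zero]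
  · intro a x _ hx
    simp only [PiLp.smul_apply, smul_eq_mul, mul_assoc, ← Finset.mul_sum, hx, mul_zero]

theorem step_frame {n s r : ℕ} {Z : Set (TorusPt n)} (hcl : ZClosed Z) (hirr : ZIrred Z) [hp : (vI Z).IsPrime]
    (hr : Algebra.trdeg Qbar (FF (vI Z)) = r) (hc : MCond Qbar (xi (vI Z)) s r) (A : Fin s → Fin n → ℝ) (hA : LinearIndependent ℝ A) :
    ∃ δ : ℝ, 0 < δ ∧ ∃ h : RR n, h ∉ vI Z ∧ ∃ B : ℝ, ∀ P ∈ Z, eval (cv P) h ≠ 0 →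
      (∃ A' : Fin s → Fin n → ℝ, (∀ j i, |A' j i - A j i| ≤ δ) ∧ ∀ ℓ : Fin n → ℝ,
        (∀ l : Fin n → ℤ, mono (cv P) l = 1 → ∑ i, (l i : ℝ) * ℓ i = 0) → ∀ j, ∑ i, A' j i * ℓ i = 0) →
      ∑ i, weilHeight (P i : Qbar) ≤ B := by
  classical
  obtain ⟨P0, hP0⟩ := hirr.1
  have hle0 : ∀ P ∈ Z, vI Z ≤ mP P := fun P hP => mem_zV_iff.mp (by rw [zV_vI hcl]; exact hP)
  haveI := qbar_countable
  letI : Algebra Qbar ℂ := (IsAlgClosed.lift (R := ℚ) (S := Qbar) (M := ℂ)).toRingHom.toAlgebra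
  obtain ⟨δ, hδ, a, t, N, e, η, ht, h4, hη, hnear, hli, hrel⟩ :=
    relations_gen (xi (vI Z)) (xi_ne (hle0 P0 hP0)) (xi_gen _) hr A hA hc
  choose coef hcoef hsum using hrel
  obtain ⟨B, hB⟩ := height_main ht e η hη h4 coef
  have hg : ∀ i, ∃ j, ∑ b, algebraMap Qbar (FF (vI Z)) (coef i j b) * mono (xi (vI Z)) (e b) ≠ 0 := by
    intro i
    by_contra hcon
    push Not at hcon
    apply hcoef i
    funext j b
    rw [Fintype.linearIndependent_iff] at hli
    exact hli (coef i j) (by rw [← hcon j]; exact Finset.sum_congr rfl fun b _ => by rw [Algebra.smul_def]) b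
  choose j0 hj0 using hg
  have hLg : ∀ i j, IsLaur n (fun L _ _ y => ∑ b, algebraMap Qbar L (coef i j b) * mono y (e b)) := fun i j =>
    IsLaur.sum Finset.univ fun b => (IsLaur.const (coef i j b)).mul (IsLaur.monom (e b))
  have hLX : ∀ i, IsLaur n (fun L _ _ y => y i) := fun i =>
    ⟨X i, 1, fun L _ _ y _ => ⟨by simp, by simp⟩⟩
  have hLrel : ∀ i, IsLaur n (fun L _ _ y => ∑ j : Fin (a+1), (∑ b, algebraMap Qbar L (coef i j b) * mono y (e b)) * y i ^ (t * (j : ℕ))) :=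
    fun i => IsLaur.sum Finset.univ fun j => (hLg i j).mul ((hLX i).pow _)
  choose q hq1 hq2 using fun i => (hLg i (j0 i)).exists_poly
  choose w hw1 hw2 using fun i => (hLrel i).exists_poly
  refine ⟨δ, hδ, ∏ i, q i, ?_, B, fun P hP hPh hfr => ?_⟩
  · rw [Ideal.IsPrime.prod_mem_iff]
    rintro ⟨i, _, hi⟩
    exact hj0 i ((hq1 i (vI Z) P0 (hle0 P0 hP0)).mpr hi)
  · rw [map_prod, Finset.prod_ne_zero_iff] at hPh
    obtain ⟨A', hA', hA'0⟩ := hfr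
    refine hB (cv P) (cv_ne P) (fun b ℓ hℓ => hnear A' hA' ℓ (hA'0 ℓ hℓ) b) (fun i => ⟨j0 i, fun h0 => ?_⟩) (fun i => ?_)
    · exact hPh i (Finset.mem_univ i) ((hq2 i P).mp h0)
    · have h1 : w i ∈ vI Z := by
        rw [← hw1 i (vI Z) P0 (hle0 P0 hP0), ← hsum i]
        refine Finset.sum_congr rfl fun j _ => ?_
        rw [Finset.sum_mul]
        refine Finset.sum_congr rfl fun b _ => ?_
        rw [Algebra.smul_def, mul_assoc]
      exact (hw2 i P).mpr (h1 P hP)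

theorem step {n s : ℕ} {X Z : Set (TorusPt n)} (hZX : Z ⊆ X) (hcl : ZClosed Z) (hirr : ZIrred Z) :
    ∃ h : RR n, h ∉ vI Z ∧ ∃ B : ℝ, ∀ P ∈ Z, eval (cv P) h ≠ 0 → P ∈ openAnom X s →
      (∃ H : Set (TorusPt n), IsAlgSubgroup H ∧ s + zdim H ≤ n ∧ P ∈ H) →
      ∑ i, weilHeight (P i : Qbar) ≤ B := by
  classical
  haveI hp := vI_prime hirr
  obtain ⟨r, hr⟩ : ∃ r : ℕ, Algebra.trdeg Qbar (FF (vI Z)) = r := by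
    rw [xi_trdeg]
    exact Cardinal.lt_aleph0.mp trdeg_lt_aleph0_of_finiteType
  by_cases hc : MCond Qbar (xi (vI Z)) s r
  swap
  · obtain ⟨h, hh, hh'⟩ := fib hZX hcl hirr hr hc
    exact ⟨h, hh, 0, fun P hP hPh hPo => absurd hPo (hh' P hP hPh)⟩
  choose! δ hδ h hh B hB using fun A (hA : A ∈ Frames s n) => step_frame hcl hirr hr hc A (frames_li hA)
  obtain ⟨T, hTK, hT⟩ := (frames_compact s n).elim_nhds_subcover (fun A => Metric.ball A (δ A))
    (fun A hA => Metric.ball_mem_nhds A (hδ A hA))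
  refine ⟨∏ A ∈ T, h A, ?_, ∑ A ∈ T, |B A|, fun P hP hPh _ hPH => ?_⟩
  · rw [Ideal.IsPrime.prod_mem_iff]
    rintro ⟨A, hA, hA'⟩
    exact hh A (hTK A hA) hA'
  rw [map_prod, Finset.prod_ne_zero_iff] at hPh
  obtain ⟨H, hH, hsH, hPH⟩ := hPH
  obtain ⟨A', hA', hA'0⟩ := exists_frame (trivExp H) (rank_ge hH hsH)
  obtain ⟨A, hAT, hAA'⟩ := Set.mem_iUnion₂.mp (hT hA')
  refine (hB A (hTK A hAT) P hP (hPh A hAT) ⟨A', fun j i => ?_, fun ℓ hℓ => ?_⟩).trans ?_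
  · rw [Metric.mem_ball, dist_eq_norm] at hAA'
    have h1 := (norm_le_pi_norm ((A' - A) j) i).trans (norm_le_pi_norm (A' - A) j)
    rw [Real.norm_eq_abs] at h1
    exact h1.trans hAA'.le
  · exact hA'0 ℓ fun l hl => hℓ l (mem_trivExp.mp hl P hPH)
  · exact (le_abs_self _).trans (Finset.single_le_sum (f := fun A => |B A|) (fun _ _ => abs_nonneg _) hAT)

theorem noeth {n s : ℕ} {X : Set (TorusPt n)} (I : Ideal (RR n)) : ∀ Z : Set (TorusPt n), Z ⊆ X → ZClosed Z → vI Z = I →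
    ∃ B : ℝ, ∀ P ∈ Z, P ∈ openAnom X s →
      (∃ H : Set (TorusPt n), IsAlgSubgroup H ∧ s + zdim H ≤ n ∧ P ∈ H) →
      ∑ i, weilHeight (P i : Qbar) ≤ B := by
  induction I using WellFoundedGT.induction with
  | ind I ih =>
    intro Z hZX hcl hI
    by_cases hne : Z.Nonempty
    swap
    · exact ⟨0, fun P hP => absurd ⟨P, hP⟩ hne⟩
    have hproper : ∀ W : Set (TorusPt n), ZClosed W → ¬ Z ⊆ W → ∃ B : ℝ, ∀ P ∈ Z ∩ W, P ∈ openAnom X s →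
      (∃ H : Set (TorusPt n), IsAlgSubgroup H ∧ s + zdim H ≤ n ∧ P ∈ H) →
      ∑ i, weilHeight (P i : Qbar) ≤ B := by
      intro W hW hZW
      have hlt : Z ∩ W ⊂ Z := ⟨Set.inter_subset_left, fun hc => hZW fun x hx => (hc hx).2⟩
      have hcl' := closed_inter hcl hW
      exact ih (vI (Z ∩ W)) (hI ▸ vI_lt hcl' hlt) (Z ∩ W) (Set.inter_subset_left.trans hZX) hcl' rfl
    by_cases hirr : ZIrred Z
    · obtain ⟨h, hh, B, hB⟩ := step (s := s) hZX hcl hirr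
      obtain ⟨B', hB'⟩ := hproper _ (closed_single h) hh
      refine ⟨max B B', fun P hP hPo hPH => ?_⟩
      by_cases hPh : eval (cv P) h = 0
      · exact (hB' P ⟨hP, hPh⟩ hPo hPH).trans (le_max_right _ _)
      · exact (hB P hP hPh hPo hPH).trans (le_max_left _ _)
    · unfold ZIrred at hirr
      push Not at hirr
      obtain ⟨Z₁, Z₂, h1, h2, h12, hn1, hn2⟩ := hirr hne
      obtain ⟨B, hB⟩ := hproper _ h1 hn1
      obtain ⟨B', hB'⟩ := hproper _ h2 hn2
      refine ⟨max B B', fun P hP hPo hPH => ?_⟩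
      rcases h12 hP with hP1 | hP1
      · exact (hB P ⟨hP, hP1⟩ hPo hPH).trans (le_max_left _ _)
      · exact (hB' P ⟨hP, hP1⟩ hPo hPH).trans (le_max_right _ _)
end F1

/-- Bounded Height Theorem, Habegger. The height is bounded
from above on `X^{oa,s} ∩ G^{[s]}`. -/
theorem bounded_height_theorem
    (n s : ℕ) (X : Set (TorusPt n)) (hXcl : ZClosed X) (hXirr : ZIrred X) :
    ∃ B : ℝ, ∀ P ∈ openAnom X s,
      (∃ H : Set (TorusPt n), IsAlgSubgroup H ∧ s + zdim H ≤ n ∧ P ∈ H) →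
      ∑ i, weilHeight (P i : Qbar) ≤ B := by
  obtain ⟨B, hB⟩ := noeth (s := s) (X := X) (vI X) X subset_rfl hXcl rfl
  exact ⟨B, fun P hP hH => hB P hP.1 hP hH⟩

end
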